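/- Let φ ∈ C^∞(ℝ^n_y × ℝ^n_ξ) be real-valued and a ∈ C^∞(ℝ^n_x × ℝ^n_y × ℝ^n_ξ). Assume: |det ∂_y∂_ξ φ(y,ξ)| ≥ C₀ > 0 for all (y,ξ); all derivatives of the entries of ∂_y∂_ξ φ are bounded on ℝ^n × ℝ^n; |∂_ξ^α φ(y,ξ)| ≤ C_α ⟨y⟩ for all multi-indices with |α| ≥ 1; and |∂_x^α ∂_y^β ∂_ξ^γ a(x,y,ξ)| ≤ C_{αβγ} ⟨x⟩^{-|α|} for all α, β, γ. Assume further that a(x,y,ξ) = 0 whenever ξ lies outside some compact set K. Then for every m ∈ ℝ the operator Tu(x) = ∫_{ℝ^n}∫_{ℝ^n} e^{i(x·ξ + φ(y,ξ))} a(x,y,ξ) u(y) dy dξ, defined for Schwartz u, satisfies ‖⟨x⟩^m Tu‖_{L²(ℝ^n)} ≤ C ‖⟨x⟩^m u‖_{L²(ℝ^n)}, where C depends only on n, m, C₀ and finitely many of the constants C_α, C_{αβγ} and the bounds on derivatives of entries of ∂_y∂_ξ φ, and is independent of K. -/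

import Mathlib

open MeasureTheory Complex SchwartzMap
open scoped BigOperators ENNReal Real RealInnerProductSpace

noncomputable section

/-- The derivative of `g` along the direction `v`. -/
def dLine {W F : Type*} [NormedAddCommGroup W] [NormedSpace ℝ W]
    [NormedAddCommGroup F] [NormedSpace ℝ F] (v : W) (g : W → F) : W → F :=
  fun z => fderiv ℝ g z v

/-- The iterated partial derivative `∂^α` along the coordinate directions `dirs`,
with multiplicities given by the multi-index `α`. -/
def mderiv {n : ℕ} {W F : Type*} [NormedAddCommGroup W] [NormedSpace ℝ W]
    [NormedAddCommGroup F] [NormedSpace ℝ F]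
    (dirs : Fin n → W) (α : Fin n → ℕ) (g : W → F) : W → F :=
  ((List.ofFn fun i => (dLine (dirs i) (F := F))^[α i]).foldr (· ∘ ·) id) g

/-- The length `|α|` of a multi-index. -/
def mdeg {n : ℕ} (α : Fin n → ℕ) : ℕ := ∑ i, α i

/-- The first-factor coordinate directions in `ℝ^n × ℝ^n`. -/
def dX {n : ℕ} (i : Fin n) : EuclideanSpace ℝ (Fin n) × EuclideanSpace ℝ (Fin n) :=
  (EuclideanSpace.single i 1, 0)

/-- The second-factor coordinate directions in `ℝ^n × ℝ^n`. -/
def dY {n : ℕ} (j : Fin n) : EuclideanSpace ℝ (Fin n) × EuclideanSpace ℝ (Fin n) :=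
  (0, EuclideanSpace.single j 1)

/-- The entry `∂²φ/∂u_i∂v_j` of the mixed Hessian of a function of two `ℝ^n` variables. -/
def mixedHessXY {n : ℕ}
    (φ : EuclideanSpace ℝ (Fin n) × EuclideanSpace ℝ (Fin n) → ℝ) (i j : Fin n) :
    EuclideanSpace ℝ (Fin n) × EuclideanSpace ℝ (Fin n) → ℝ :=
  dLine (dX i) (dLine (dY j) φ)

/-- The Japanese bracket `⟨x⟩ = (1+|x|²)^{1/2}`. -/
def jap {n : ℕ} (x : EuclideanSpace ℝ (Fin n)) : ℝ := Real.sqrt (1 + ‖x‖ ^ 2)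

/-- The `x`-coordinate directions in `ℝ^n × ℝ^n × ℝ^n`. -/
def d3X {n : ℕ} (i : Fin n) :
    EuclideanSpace ℝ (Fin n) × EuclideanSpace ℝ (Fin n) × EuclideanSpace ℝ (Fin n) :=
  (EuclideanSpace.single i 1, 0, 0)

/-- The `y`-coordinate directions in `ℝ^n × ℝ^n × ℝ^n`. -/
def d3Y {n : ℕ} (j : Fin n) :
    EuclideanSpace ℝ (Fin n) × EuclideanSpace ℝ (Fin n) × EuclideanSpace ℝ (Fin n) :=
  (0, EuclideanSpace.single j 1, 0)

/-- The `ξ`-coordinate directions in `ℝ^n × ℝ^n × ℝ^n`. -/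
def d3Xi {n : ℕ} (k : Fin n) :
    EuclideanSpace ℝ (Fin n) × EuclideanSpace ℝ (Fin n) × EuclideanSpace ℝ (Fin n) :=
  (0, 0, EuclideanSpace.single k 1)

open scoped ContDiff

section SymbolCalculus

variable {ι ι' W V F G : Type*} [NormedAddCommGroup W] [NormedSpace ℝ W]
  [NormedAddCommGroup V] [NormedSpace ℝ V]
  [NormedAddCommGroup F] [NormedSpace ℝ F] [NormedAddCommGroup G] [NormedSpace ℝ G]

theorem contDiff_dLine {f : W → F} (hf : ContDiff ℝ ∞ f) (v : W) : ContDiff ℝ ∞ (dLine v f) := by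
  unfold dLine
  exact (hf.fderiv_right (m := ∞) (by simp)).clm_apply contDiff_const

theorem cd_diff {f : W → F} (hf : ContDiff ℝ ∞ f) : Differentiable ℝ f :=
  hf.differentiable (by simp)

theorem dLine_comm {f : W → F} (hf : ContDiff ℝ ∞ f) (v w : W) :
    dLine v (dLine w f) = dLine w (dLine v f) := by
  funext z
  have hd : DifferentiableAt ℝ (fderiv ℝ f) z :=
    ((hf.fderiv_right (m := ∞) (by simp)).differentiable (by simp)) z
  have hsym : IsSymmSndFDerivAt ℝ f z :=
    (hf.contDiffAt).isSymmSndFDerivAt (by simp; exact WithTop.coe_le_coe.2 (le_top : (2:ℕ∞) ≤ ⊤))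
  have h1 : ∀ a b : W, dLine a (dLine b f) z = fderiv ℝ (fderiv ℝ f) z a b := by
    intro a b
    unfold dLine
    rw [fderiv_clm_apply hd (differentiableAt_const b)]
    simp
  rw [h1, h1, hsym.eq]

theorem dLine_add_fun {f g : W → F} (hf : ContDiff ℝ ∞ f) (hg : ContDiff ℝ ∞ g) (v : W) :
    dLine v (fun z => f z + g z) = fun z => dLine v f z + dLine v g z := by
  funext z
  unfold dLine
  rw [fderiv_fun_add (cd_diff hf z) (cd_diff hg z)]; simp

theorem dLine_mul_fun {A : Type*} [NormedCommRing A] [NormedAlgebra ℝ A] {f g : W → A}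
    (hf : ContDiff ℝ ∞ f) (hg : ContDiff ℝ ∞ g) (v : W) :
    dLine v (fun z => f z * g z) = fun z => dLine v f z * g z + f z * dLine v g z := by
  funext z
  unfold dLine
  rw [fderiv_fun_mul (cd_diff hf z) (cd_diff hg z)]; simp; ring

theorem dLine_clm (T : F →L[ℝ] G) {f : W → F} (hf : ContDiff ℝ ∞ f) (v : W) :
    dLine v (fun z => T (f z)) = fun z => T (dLine v f z) := by
  funext z
  unfold dLine
  rw [show (fun z => T (f z)) = T ∘ f from rfl, fderiv_comp z T.differentiableAt (cd_diff hf z)]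
  simp

theorem dLine_affine {f : W → F} (hf : ContDiff ℝ ∞ f) (L : V →L[ℝ] W) (w : W) (v : V) :
    dLine v (fun z => f (w + L z)) = fun z => dLine (L v) f (w + L z) := by
  funext z
  unfold dLine
  have h : HasFDerivAt (fun z => w + L z) L z := L.hasFDerivAt.const_add w
  have := (cd_diff hf (w + L z)).hasFDerivAt.comp z h
  rw [show (fun z => f (w + L z)) = f ∘ (fun z => w + L z) from rfl, this.fderiv]
  rfl

theorem dLine_inv {𝕜 : Type*} [NormedField 𝕜] [NormedAlgebra ℝ 𝕜] {f : W → 𝕜}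
    (hf : ContDiff ℝ ∞ f) (h0 : ∀ z, f z ≠ 0) (v : W) :
    dLine v (fun z => (f z)⁻¹) = fun z => -((f z)⁻¹ * (f z)⁻¹ * dLine v f z) := by
  funext z
  unfold dLine
  have h : HasFDerivAt (fun z => (f z)⁻¹) _ z :=
    (hasFDerivAt_inv' (𝕜 := ℝ) (h0 z)).comp z (cd_diff hf z).hasFDerivAt
  rw [h.fderiv]; simp; ring

theorem tsupport_dLine_subset (v : W) (f : W → F) : tsupport (dLine v f) ⊆ tsupport f := by
  refine closure_minimal ?_ (isClosed_tsupport f)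
  intro z hz
  by_contra h
  apply hz
  have : fderiv ℝ f z = 0 := by
    by_contra h2
    exact h (support_fderiv_subset ℝ (f := f) h2)
  simp [dLine, this]

/-- Uniform bounds on all directional derivatives of order at most `k` of a family. -/
def SB (s : ι → Set W) : ℕ → (ι → W → F) → Prop
  | 0, f => ∃ C : ℝ, ∀ i, ∀ z ∈ s i, ‖f i z‖ ≤ C
  | k+1, f => (∃ C : ℝ, ∀ i, ∀ z ∈ s i, ‖f i z‖ ≤ C) ∧ ∀ v : W, SB s k (fun i => dLine v (f i))

/-- A family of smooth functions with uniform bounds on derivatives of order at most `k`. -/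
structure Sy (s : ι → Set W) (k : ℕ) (f : ι → W → F) : Prop where
  smooth : ∀ i, ContDiff ℝ ∞ (f i)
  bdd : SB s k f

theorem SB.bound {s : ι → Set W} : ∀ {k : ℕ} {f : ι → W → F}, SB s k f →
    ∃ C : ℝ, ∀ i, ∀ z ∈ s i, ‖f i z‖ ≤ C
  | 0, _, h => h
  | _+1, _, h => h.1

theorem Sy.bound {s : ι → Set W} {k : ℕ} {f : ι → W → F} (h : Sy s k f) :
    ∃ C : ℝ, 0 ≤ C ∧ ∀ i, ∀ z ∈ s i, ‖f i z‖ ≤ C := by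
  obtain ⟨C, hC⟩ := h.bdd.bound
  exact ⟨max C 0, le_max_right _ _, fun i z hz => (hC i z hz).trans (le_max_left _ _)⟩

theorem Sy.d {s : ι → Set W} {k : ℕ} {f : ι → W → F} (h : Sy s (k+1) f) (v : W) :
    Sy s k (fun i => dLine v (f i)) :=
  ⟨fun i => contDiff_dLine (h.smooth i) v, h.bdd.2 v⟩

theorem Sy.succ {s : ι → Set W} {k : ℕ} {f : ι → W → F} (hs : ∀ i, ContDiff ℝ ∞ (f i))
    (hb : ∃ C : ℝ, ∀ i, ∀ z ∈ s i, ‖f i z‖ ≤ C)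
    (h : ∀ v : W, Sy s k (fun i => dLine v (f i))) : Sy s (k+1) f :=
  ⟨hs, hb, fun v => (h v).bdd⟩

theorem SB.pred {s : ι → Set W} : ∀ {k : ℕ} {f : ι → W → F}, SB s (k+1) f → SB s k f
  | 0, _, h => h.1
  | _+1, _, h => ⟨h.1, fun v => (h.2 v).pred⟩

theorem Sy.pred {s : ι → Set W} {k : ℕ} {f : ι → W → F} (h : Sy s (k+1) f) : Sy s k f :=
  ⟨h.smooth, h.bdd.pred⟩

theorem Sy.mono {s : ι → Set W} {k l : ℕ} (hkl : k ≤ l) {f : ι → W → F} (h : Sy s l f) :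
    Sy s k f := by
  induction hkl with
  | refl => exact h
  | step _ ih => exact ih h.pred

theorem Sy.mono_set {s t : ι → Set W} (hst : ∀ i, t i ⊆ s i) :
    ∀ {k : ℕ} {f : ι → W → F}, Sy s k f → Sy t k f
  | 0, f, h => ⟨h.smooth, by
      obtain ⟨C, hC⟩ := h.bdd
      exact ⟨C, fun i z hz => hC i z (hst i hz)⟩⟩
  | k+1, f, h => Sy.succ h.smooth (by
      obtain ⟨C, hC⟩ := h.bdd.bound
      exact ⟨C, fun i z hz => hC i z (hst i hz)⟩) fun v => Sy.mono_set hst (h.d v)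

theorem Sy.add {s : ι → Set W} : ∀ {k : ℕ} {f g : ι → W → F}, Sy s k f → Sy s k g →
    Sy s k (fun i z => f i z + g i z) := by
  intro k
  induction k with
  | zero =>
    intro f g hf hg
    obtain ⟨C, _, hC⟩ := hf.bound
    obtain ⟨D, _, hD⟩ := hg.bound
    exact ⟨fun i => (hf.smooth i).add (hg.smooth i), C + D, fun i z hz =>
      (norm_add_le _ _).trans (add_le_add (hC i z hz) (hD i z hz))⟩
  | succ k ih =>
    intro f g hf hg
    obtain ⟨C, _, hC⟩ := hf.bound
    obtain ⟨D, _, hD⟩ := hg.bound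
    refine Sy.succ (fun i => (hf.smooth i).add (hg.smooth i)) ⟨C + D, fun i z hz =>
      (norm_add_le _ _).trans (add_le_add (hC i z hz) (hD i z hz))⟩ fun v => ?_
    have := ih (hf.d v) (hg.d v)
    convert! this using 2 with i
    exact dLine_add_fun (hf.smooth i) (hg.smooth i) v

theorem Sy.mul {A : Type*} [NormedCommRing A] [NormedAlgebra ℝ A]
    {s : ι → Set W} : ∀ {k : ℕ} {f g : ι → W → A}, Sy s k f → Sy s k g →
    Sy s k (fun i z => f i z * g i z) := by
  intro k
  have key : ∀ {k : ℕ} {f g : ι → W → A}, Sy s k f → Sy s k g →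
      (∃ C : ℝ, ∀ i, ∀ z ∈ s i, ‖f i z * g i z‖ ≤ C) := by
    intro k f g hf hg
    obtain ⟨C, hC0, hC⟩ := hf.bound
    obtain ⟨D, hD0, hD⟩ := hg.bound
    exact ⟨C * D, fun i z hz =>
      (norm_mul_le _ _).trans (mul_le_mul (hC i z hz) (hD i z hz) (norm_nonneg _) hC0)⟩
  induction k with
  | zero =>
    intro f g hf hg
    exact ⟨fun i => (hf.smooth i).mul (hg.smooth i), key hf hg⟩
  | succ k ih =>
    intro f g hf hg
    refine Sy.succ (fun i => (hf.smooth i).mul (hg.smooth i)) (key hf hg) fun v => ?_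
    have := (ih (hf.d v) hg.pred).add (ih hf.pred (hg.d v))
    convert! this using 2 with i
    exact dLine_mul_fun (hf.smooth i) (hg.smooth i) v

theorem Sy.clm (T : F →L[ℝ] G) {s : ι → Set W} : ∀ {k : ℕ} {f : ι → W → F}, Sy s k f →
    Sy s k (fun i z => T (f i z)) := by
  intro k
  have key : ∀ {k : ℕ} {f : ι → W → F}, Sy s k f →
      (∃ C : ℝ, ∀ i, ∀ z ∈ s i, ‖T (f i z)‖ ≤ C) := by
    intro k f hf
    obtain ⟨C, hC0, hC⟩ := hf.bound
    exact ⟨‖T‖ * C, fun i z hz =>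
      (T.le_opNorm _).trans (mul_le_mul_of_nonneg_left (hC i z hz) (norm_nonneg _))⟩
  induction k with
  | zero => intro f hf; exact ⟨fun i => T.contDiff.comp (hf.smooth i), key hf⟩
  | succ k ih =>
    intro f hf
    refine Sy.succ (fun i => T.contDiff.comp (hf.smooth i)) (key hf) fun v => ?_
    have := ih (hf.d v)
    convert! this using 2 with i
    exact dLine_clm T (hf.smooth i) v

theorem dLine_const (v : W) (c : F) : dLine v (fun _ => c) = fun _ => (0 : F) := by
  funext z; simp [dLine]

theorem Sy.zero {s : ι → Set W} : ∀ (k : ℕ), Sy s k (fun (_ : ι) (_ : W) => (0 : F)) := by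
  intro k
  induction k with
  | zero => exact ⟨fun i => contDiff_const, 0, fun i z hz => by simp⟩
  | succ k ih =>
    refine Sy.succ (fun i => contDiff_const) ⟨0, fun i z hz => by simp⟩ fun v => ?_
    simpa [dLine_const] using ih

theorem Sy.const {s : ι → Set W} (k : ℕ) {c : ι → F} {C : ℝ} (hc : ∀ i, ‖c i‖ ≤ C) :
    Sy s k (fun i (_ : W) => c i) := by
  cases k with
  | zero => exact ⟨fun i => contDiff_const, C, fun i z hz => hc i⟩
  | succ k =>
    refine Sy.succ (fun i => contDiff_const) ⟨C, fun i z hz => hc i⟩ fun v => ?_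
    simpa [dLine_const] using Sy.zero k

theorem Sy.neg {s : ι → Set W} {k : ℕ} {f : ι → W → F} (h : Sy s k f) :
    Sy s k (fun i z => - f i z) := by
  simpa using h.clm (-ContinuousLinearMap.id ℝ F)

theorem Sy.sub {s : ι → Set W} {k : ℕ} {f g : ι → W → F} (h : Sy s k f) (h' : Sy s k g) :
    Sy s k (fun i z => f i z - g i z) := by
  simpa [sub_eq_add_neg] using h.add h'.neg

theorem Sy.sum {J : Type*} (S : Finset J) {s : ι → Set W} {k : ℕ} {f : J → ι → W → F}
    (h : ∀ j ∈ S, Sy s k (f j)) : Sy s k (fun i z => ∑ j ∈ S, f j i z) := by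
  classical
  induction S using Finset.induction_on with
  | empty => simpa using Sy.zero k
  | insert a S ha ih =>
    simp_rw [Finset.sum_insert ha]
    exact (h a (by simp)).add (ih fun j hj => h j (by simp [hj]))

theorem Sy.inv {𝕜 : Type*} [NormedField 𝕜] [NormedAlgebra ℝ 𝕜] {s : ι → Set W} {c : ℝ}
    (hc : 0 < c) : ∀ {k : ℕ} {f : ι → W → 𝕜}, Sy s k f → (∀ i z, f i z ≠ 0) →
    (∀ i, ∀ z ∈ s i, c ≤ ‖f i z‖) → Sy s k (fun i z => (f i z)⁻¹) := by
  intro k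
  have key : ∀ {f : ι → W → 𝕜}, (∀ i, ∀ z ∈ s i, c ≤ ‖f i z‖) →
      (∃ C : ℝ, ∀ i, ∀ z ∈ s i, ‖(f i z)⁻¹‖ ≤ C) := by
    intro f h
    refine ⟨c⁻¹, fun i z hz => ?_⟩
    rw [norm_inv]
    exact inv_anti₀ hc (h i z hz)
  induction k with
  | zero =>
    intro f hf h0 h
    exact ⟨fun i => (hf.smooth i).inv (h0 i), key h⟩
  | succ k ih =>
    intro f hf h0 h
    refine Sy.succ (fun i => (hf.smooth i).inv (h0 i)) (key h) fun v => ?_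
    have h1 := ih hf.pred h0 h
    have := ((h1.mul h1).mul (hf.d v)).neg
    convert! this using 2 with i
    exact dLine_inv (hf.smooth i) (h0 i) v

theorem Sy.affine {s : ι → Set W} (t : ι' → Set V) (σ : ι' → ι) (w : ι' → W) (L : V →L[ℝ] W)
    (hst : ∀ i, ∀ z ∈ t i, w i + L z ∈ s (σ i)) : ∀ {k : ℕ} {f : ι → W → F}, Sy s k f →
    Sy t k (fun i z => f (σ i) (w i + L z)) := by
  intro k
  have key : ∀ {k : ℕ} {f : ι → W → F}, Sy s k f →
      (∃ C : ℝ, ∀ i, ∀ z ∈ t i, ‖f (σ i) (w i + L z)‖ ≤ C) := by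
    intro k f hf
    obtain ⟨C, hC0, hC⟩ := hf.bound
    exact ⟨C, fun i z hz => hC _ _ (hst i z hz)⟩
  have sm : ∀ {k : ℕ} {f : ι → W → F}, Sy s k f → ∀ i, ContDiff ℝ ∞ (fun z => f (σ i) (w i + L z)) :=
    fun hf i => (hf.smooth _).comp (contDiff_const.add L.contDiff)
  induction k with
  | zero => intro f hf; exact ⟨sm hf, key hf⟩
  | succ k ih =>
    intro f hf
    refine Sy.succ (sm hf) (key hf) fun v => ?_
    have := ih (hf.d (L v))
    convert! this using 2 with i
    exact dLine_affine (hf.smooth _) L _ v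

theorem Sy.reindex {s : ι → Set W} (σ : ι' → ι) {k : ℕ} {f : ι → W → F} (hf : Sy s k f) :
    Sy (fun i => s (σ i)) k (fun i => f (σ i)) := by
  simpa using hf.affine (fun i => s (σ i)) σ (fun _ => 0) (ContinuousLinearMap.id ℝ W)
    (by simp)

theorem Sy.extend {s : ι → Set W} : ∀ {k : ℕ} {f : ι → W → F}, Sy s k f →
    (∀ i, tsupport (f i) ⊆ s i) → Sy (fun _ => Set.univ) k f := by
  intro k
  have key : ∀ {k : ℕ} {f : ι → W → F}, Sy s k f → (∀ i, tsupport (f i) ⊆ s i) →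
      (∃ C : ℝ, ∀ i, ∀ z ∈ (Set.univ : Set W), ‖f i z‖ ≤ C) := by
    intro k f hf h
    obtain ⟨C, hC0, hC⟩ := hf.bound
    refine ⟨C, fun i z _ => ?_⟩
    by_cases hz : z ∈ s i
    · exact hC i z hz
    · rw [image_eq_zero_of_notMem_tsupport fun h' => hz (h i h')]
      simpa using hC0
  induction k with
  | zero => intro f hf h; exact ⟨hf.smooth, key hf h⟩
  | succ k ih =>
    intro f hf h
    exact Sy.succ hf.smooth (key hf h) fun v =>
      ih (hf.d v) fun i => (tsupport_dLine_subset v _).trans (h i)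

theorem Sy.of_compact (s : ι → Set W) : ∀ (k : ℕ) {f : W → F}, ContDiff ℝ ∞ f →
    HasCompactSupport f → Sy s k (fun _ => f) := by
  intro k
  have key : ∀ {f : W → F}, ContDiff ℝ ∞ f → HasCompactSupport f →
      (∃ C : ℝ, ∀ i, ∀ z ∈ s i, ‖f z‖ ≤ C) := by
    intro f hf h
    obtain ⟨C, hC⟩ := h.exists_bound_of_continuous hf.continuous
    exact ⟨C, fun i z _ => hC z⟩
  induction k with
  | zero => intro f hf h; exact ⟨fun _ => hf, key hf h⟩
  | succ k ih =>
    intro f hf h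
    refine Sy.succ (fun _ => hf) (key hf h) fun v => ih (contDiff_dLine hf v) ?_
    exact h.of_isClosed_subset (isClosed_tsupport _) (tsupport_dLine_subset v f)

theorem Sy.ofReal {s : ι → Set W} {k : ℕ} {f : ι → W → ℝ} (h : Sy s k f) :
    Sy s k (fun i z => (f i z : ℂ)) := h.clm Complex.ofRealCLM

theorem Sy.conj {s : ι → Set W} {k : ℕ} {f : ι → W → ℂ} (h : Sy s k f) :
    Sy s k (fun i z => (starRingEnd ℂ) (f i z)) := h.clm (Complex.conjCLE : ℂ →L[ℝ] ℂ)

theorem Sy.congr {s : ι → Set W} {k : ℕ} {f g : ι → W → F} (h : Sy s k f)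
    (hfg : ∀ i z, g i z = f i z) : Sy s k g := by
  have : g = f := by funext i z; exact hfg i z
  rwa [this]

end SymbolCalculus

section GlobalInverse

variable {E : Type*} [NormedAddCommGroup E] [NormedSpace ℝ E] [FiniteDimensional ℝ E]

theorem exists_equiv_of_lower {F : E → E} {M : ℝ}
    (hM : ∀ z v, ‖v‖ ≤ M * ‖fderiv ℝ F z v‖) (z : E) :
    ∃ e : E ≃L[ℝ] E, (e : E →L[ℝ] E) = fderiv ℝ F z := by
  have hinj : Function.Injective (fderiv ℝ F z : E →ₗ[ℝ] E) := by
    rw [injective_iff_map_eq_zero]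
    intro v hv
    have := hM z v
    rw [show fderiv ℝ F z v = 0 from hv] at this
    simpa using this
  refine ⟨(LinearEquiv.ofInjectiveEndo _ hinj).toContinuousLinearEquiv, ?_⟩
  ext v
  simp

theorem path_lift {F : E → E} (hF : ContDiff ℝ ∞ F) {M : ℝ} (hM0 : 0 ≤ M)
    (hM : ∀ z v, ‖v‖ ≤ M * ‖fderiv ℝ F z v‖) {γ : ℝ → E} (hγ : ContDiff ℝ ∞ γ) {x : E}
    (hx : F x = γ 0) {B : ℝ} (hB0 : 0 ≤ B) (hB : ∀ t ∈ Set.Icc (0:ℝ) 1, ‖deriv γ t‖ ≤ B) :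
    ∃ Γ : ℝ → E, Γ 0 = x ∧ ContinuousOn Γ (Set.Icc 0 1) ∧ (∀ t ∈ Set.Icc (0:ℝ) 1, F (Γ t) = γ t) ∧
      ‖Γ 1 - x‖ ≤ M * B := by
  have : CompleteSpace E := FiniteDimensional.complete ℝ E
  have : ProperSpace E := FiniteDimensional.proper ℝ E
  set D : E → E →L[ℝ] E := fun z => (fderiv ℝ F z).inverse with hD
  have hDF : ∀ z w, fderiv ℝ F z (D z w) = w := by
    intro z w
    obtain ⟨e, he⟩ := exists_equiv_of_lower hM z
    simp [hD, ← he]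
  have hDn : ∀ z w, ‖D z w‖ ≤ M * ‖w‖ := by
    intro z w
    have := hM z (D z w)
    rwa [hDF] at this
  have hDs : ContDiff ℝ ∞ D := by
    rw [contDiff_iff_contDiffAt]
    intro z
    obtain ⟨e, he⟩ := exists_equiv_of_lower hM z
    have h1 : ContDiffAt ℝ ∞ ContinuousLinearMap.inverse (fderiv ℝ F z) := by
      rw [← he]; exact contDiffAt_map_inverse e
    exact h1.comp z (hF.fderiv_right (m := ∞) (by simp)).contDiffAt
  have hγ' : Continuous (deriv γ) := hγ.continuous_deriv (by simp)
  obtain ⟨K, hK⟩ := (isCompact_closedBall x (M * B)).exists_bound_of_continuousOn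
    (hDs.continuous_fderiv (by simp)).continuousOn
  have hKL : LipschitzOnWith (Real.toNNReal K) D (Metric.closedBall x (M * B)) := by
    apply Convex.lipschitzOnWith_of_nnnorm_fderiv_le (𝕜 := ℝ)
      (fun z _ => (hDs.differentiable (by simp)) z) _ (convex_closedBall _ _)
    intro z hz
    rw [← NNReal.coe_le_coe]
    exact (hK z hz).trans (Real.le_coe_toNNReal K)
  have hpl : IsPicardLindelof (fun t z => D z (deriv γ t)) (tmin := 0) (tmax := 1)
      ⟨0, by simp⟩ x ⟨M * B, by positivity⟩ 0 ⟨M * B, by positivity⟩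
      (Real.toNNReal K * Real.toNNReal B) := by
    constructor
    · intro t ht
      apply LipschitzOnWith.of_dist_le_mul
      intro z hz z' hz'
      have h1 := hKL.dist_le_mul z hz z' hz'
      rw [dist_eq_norm] at h1 ⊢
      rw [← sub_apply]
      calc ‖(D z - D z') (deriv γ t)‖ ≤ ‖D z - D z'‖ * ‖deriv γ t‖ :=
            ContinuousLinearMap.le_opNorm _ _
        _ ≤ (Real.toNNReal K * dist z z') * B := by
            gcongr
            exact hB t ht
        _ = _ := by
            rw [NNReal.coe_mul, Real.coe_toNNReal B hB0]; ring
    · intro z _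
      exact ((D z).continuous.comp hγ').continuousOn
    · intro t ht z _
      exact (hDn z _).trans (mul_le_mul_of_nonneg_left (hB t ht) hM0)
    · simp
  obtain ⟨Γ, h0, hΓ⟩ := hpl.exists_eq_forall_mem_Icc_hasDerivWithinAt₀
  have hcont : ContinuousOn Γ (Set.Icc 0 1) := fun t ht => (hΓ t ht).continuousWithinAt
  refine ⟨Γ, h0, hcont, ?_, ?_⟩
  · have hc : ∀ t ∈ Set.Icc (0:ℝ) 1, F (Γ t) - γ t = F (Γ 0) - γ 0 := by
      apply constant_of_has_deriv_right_zero
      · exact (hF.continuous.comp_continuousOn hcont).sub hγ.continuous.continuousOn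
      · intro t ht
        have ht' : t ∈ Set.Icc (0:ℝ) 1 := ⟨ht.1, ht.2.le⟩
        have h1 : HasDerivWithinAt (fun t => F (Γ t)) (fderiv ℝ F (Γ t) (D (Γ t) (deriv γ t)))
            (Set.Icc 0 1) t :=
          ((hF.differentiable (by simp)) (Γ t)).hasFDerivAt.comp_hasDerivWithinAt t (hΓ t ht')
        rw [hDF] at h1
        have h2 : HasDerivAt γ (deriv γ t) t := ((hγ.differentiable (by simp)) t).hasDerivAt
        have h3 := h1.sub h2.hasDerivWithinAt
        rw [sub_self] at h3
        exact h3.mono_of_mem_nhdsWithin (Icc_mem_nhdsGE_of_mem ht)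
    intro t ht
    have := hc t ht
    change Γ 0 = x at h0
    rw [h0, hx, sub_self] at this
    exact sub_eq_zero.1 this
  · have := Convex.norm_image_sub_le_of_norm_hasDerivWithin_le (C := M * B) hΓ
      (fun t ht => (hDn _ _).trans (mul_le_mul_of_nonneg_left (hB t ht) hM0))
      (convex_Icc 0 1) (show (0:ℝ) ∈ Set.Icc (0:ℝ) 1 by simp) (show (1:ℝ) ∈ Set.Icc (0:ℝ) 1 by simp)
    change Γ 0 = x at h0
    simpa [h0] using this

theorem hadamard_lower {F : E → E} (hF : ContDiff ℝ ∞ F) {M : ℝ} (hM0 : 0 ≤ M)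
    (hM : ∀ z v, ‖v‖ ≤ M * ‖fderiv ℝ F z v‖) (x y : E) : ‖y - x‖ ≤ M * ‖F y - F x‖ := by
  have : CompleteSpace E := FiniteDimensional.complete ℝ E
  have hloc : IsLocalHomeomorph F := by
    refine IsLocalHomeomorph.mk F fun z => ?_
    obtain ⟨e, he⟩ := exists_equiv_of_lower hM z
    have hd : HasFDerivAt F (e : E →L[ℝ] E) z := by
      rw [he]; exact ((hF.differentiable (by simp)) z).hasFDerivAt
    refine ⟨(hF.contDiffAt (x := z)).toOpenPartialHomeomorph F hd (by simp), ?_, ?_⟩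
    · exact (hF.contDiffAt (x := z)).mem_toOpenPartialHomeomorph_source hd (by simp)
    · intro w _; rfl
  let H : ℝ → ℝ → E := fun s t => (1 - s) • F (x + t • (y - x)) + s • (F x + t • (F y - F x))
  have Hc : Continuous fun p : ℝ × ℝ => H p.1 p.2 := by
    have := hF.continuous
    fun_prop
  have Hs : ∀ s, ContDiff ℝ ∞ (H s) := by
    intro s
    have h1 : ContDiff ℝ ∞ fun t : ℝ => F (x + t • (y - x)) := hF.comp (by fun_prop)
    exact (h1.const_smul (1 - s)).add (by fun_prop)
  have H0 : ∀ s, F x = H s 0 := by intro s; simp [H, ← add_smul]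
  have H1 : deriv (H 1) = fun _ => F y - F x := by
    funext t
    have : H 1 = fun t => F x + t • (F y - F x) := by funext t; simp [H]
    rw [this]
    have h := ((hasDerivAt_id t).smul_const (F y - F x)).const_add (F x)
    simpa using h.deriv
  have lift1 := path_lift hF hM0 hM (Hs 1) (H0 1) (norm_nonneg (F y - F x))
    (fun t _ => by rw [H1])
  have lifts : ∀ s, ∃ Γ : ℝ → E, Γ 0 = x ∧ ContinuousOn Γ (Set.Icc 0 1) ∧
      (∀ t ∈ Set.Icc (0:ℝ) 1, F (Γ t) = H s t) ∧ (s = 0 → Γ 1 = y) ∧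
      (s = 1 → ‖Γ 1 - x‖ ≤ M * ‖F y - F x‖) := by
    intro s
    by_cases hs0 : s = 0
    · refine ⟨fun t => x + t • (y - x), by simp, by fun_prop, ?_, by simp, by simp [hs0]⟩
      intro t _; simp [H, hs0]
    by_cases hs1 : s = 1
    · obtain ⟨Γ, a, b, c, d⟩ := lift1
      exact ⟨Γ, a, b, by simpa [hs1] using c, by simp [hs0], fun _ => d⟩
    · obtain ⟨B, hB⟩ := (isCompact_Icc (a := (0:ℝ)) (b := 1)).exists_bound_of_continuousOn
        ((Hs s).continuous_deriv (by simp)).continuousOn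
      have hB0 : 0 ≤ B := (norm_nonneg _).trans (hB 0 (by simp))
      obtain ⟨Γ, a, b, c, d⟩ := path_lift hF hM0 hM (Hs s) (H0 s) hB0 hB
      exact ⟨Γ, a, b, c, by simp [hs0], by simp [hs1]⟩
  choose Γ g0 gc gl ge gn using lifts
  let γ₀ : C(unitInterval, E) := ⟨fun t => H 0 t, by
    exact Hc.comp (by fun_prop : Continuous fun t : unitInterval => ((0:ℝ), (t:ℝ)))⟩
  let γ₁ : C(unitInterval, E) := ⟨fun t => H 1 t, by
    exact Hc.comp (by fun_prop : Continuous fun t : unitInterval => ((1:ℝ), (t:ℝ)))⟩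
  let hom : γ₀.HomotopyRel γ₁ {0, 1} :=
    { toFun := fun p => H p.1 p.2
      continuous_toFun := Hc.comp (by fun_prop :
        Continuous fun p : unitInterval × unitInterval => ((p.1:ℝ),(p.2:ℝ)))
      map_zero_left := fun t => rfl
      map_one_left := fun t => rfl
      prop' := by
        intro s t ht
        rcases ht with rfl | rfl
        · simp [γ₀, H, ← add_smul]
        · simp [γ₀, H]; module }
  let Γc : unitInterval → C(unitInterval, E) := fun s =>
    ⟨fun t => Γ s t, (gc s).comp_continuous continuous_subtype_val fun t => t.2⟩
  have mono := hloc.monodromy_theorem (T2Space.isSeparatedMap F) hom Γc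
    (fun s t => gl s t t.2) (fun s => by
      change Γ _ _ = Γ _ _
      simp [g0]) 1
  change Γ _ _ = Γ _ _ at mono
  have e0 : Γ (0:ℝ) 1 = y := ge 0 rfl
  have e1 := gn 1 rfl
  have mono' : Γ (1:ℝ) 1 = Γ (0:ℝ) 1 := by simpa using mono
  rwa [mono', e0] at e1

end GlobalInverse

section NonStationary

/-- Euclidean space of dimension `n`. -/
abbrev ES (n : ℕ) := EuclideanSpace ℝ (Fin n)

/-- The standard basis vectors. -/
abbrev bv {n : ℕ} (i : Fin n) : ES n := EuclideanSpace.single i (1:ℝ)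

variable {W : Type*} [NormedAddCommGroup W] [NormedSpace ℝ W]

/-- The oscillating exponential. -/
def osc (t : ℝ) : ℂ := Complex.exp (Complex.I * (t : ℂ))

theorem norm_osc (t : ℝ) : ‖osc t‖ = 1 := by
  rw [osc, mul_comm]; exact Complex.norm_exp_ofReal_mul_I t

theorem contDiff_osc {Ψ : W → ℝ} (h : ContDiff ℝ ∞ Ψ) : ContDiff ℝ ∞ fun z => osc (Ψ z) := by
  unfold osc
  exact (contDiff_const.mul (Complex.ofRealCLM.contDiff.comp h)).cexp

theorem continuous_osc : Continuous osc := by unfold osc; fun_prop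

theorem osc_add (s t : ℝ) : osc (s + t) = osc s * osc t := by
  rw [osc, osc, osc, ← Complex.exp_add]; push_cast; ring_nf

theorem osc_conj (t : ℝ) : (starRingEnd ℂ) (osc t) = osc (-t) := by
  rw [osc, osc, ← Complex.exp_conj]; simp

theorem dLine_osc {Ψ : W → ℝ} (h : ContDiff ℝ ∞ Ψ) (v : W) :
    dLine v (fun z => osc (Ψ z)) = fun z => Complex.I * ((dLine v Ψ z : ℝ) : ℂ) * osc (Ψ z) := by
  funext z
  have h1 : HasFDerivAt Ψ (fderiv ℝ Ψ z) z := (cd_diff h z).hasFDerivAt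
  have h2 := ((Complex.ofRealCLM.hasFDerivAt.comp z h1).const_mul Complex.I).cexp
  unfold dLine
  have h3 : (fun z => osc (Ψ z)) = fun z => Complex.exp (Complex.I * (Complex.ofRealCLM ∘ Ψ) z) := by
    funext z; simp [osc]
  rw [h3, h2.fderiv]
  simp [osc]
  ring

theorem preimage_compact {n : ℕ} {L : ES n →L[ℝ] W} {w : W} {c c' : W → ℂ}
    (h : IsCompact ((fun ξ => w + L ξ) ⁻¹' tsupport c)) (hc : tsupport c' ⊆ tsupport c) :
    IsCompact ((fun ξ => w + L ξ) ⁻¹' tsupport c') :=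
  h.of_isClosed_subset ((isClosed_tsupport _).preimage (by fun_prop)) (Set.preimage_mono hc)

theorem slice_compact {n : ℕ} {L : ES n →L[ℝ] W} {w : W} {c : W → ℂ}
    (h : IsCompact ((fun ξ => w + L ξ) ⁻¹' tsupport c)) :
    HasCompactSupport fun ξ => c (w + L ξ) :=
  HasCompactSupport.intro h fun ξ hξ => image_eq_zero_of_notMem_tsupport hξ

theorem slice_integrable {n : ℕ} {L : ES n →L[ℝ] W} {w : W} {c : W → ℂ}
    (h : IsCompact ((fun ξ => w + L ξ) ⁻¹' tsupport c)) (hc : ContDiff ℝ ∞ c)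
    {Ψ : W → ℝ} (hΨ : ContDiff ℝ ∞ Ψ) :
    Integrable fun ξ => osc (Ψ (w + L ξ)) * c (w + L ξ) := by
  refine Continuous.integrable_of_hasCompactSupport ?_ (slice_compact h).mul_left
  have := hc.continuous
  have := hΨ.continuous
  have := continuous_osc
  fun_prop

theorem ibp {n : ℕ} (L : ES n →L[ℝ] W) (w : W) {Ψ : W → ℝ} (hΨ : ContDiff ℝ ∞ Ψ)
    {h : W → ℂ} (hh : ContDiff ℝ ∞ h) (hc : IsCompact ((fun ξ => w + L ξ) ⁻¹' tsupport h))
    (v : ES n) :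
    ∫ ξ, osc (Ψ (w + L ξ)) * (dLine (L v) h (w + L ξ)) =
      - ∫ ξ, osc (Ψ (w + L ξ)) * (Complex.I * ((dLine (L v) Ψ (w + L ξ) : ℝ) : ℂ) * h (w + L ξ)) := by
  have e1 := dLine_affine hh L w v
  have e2 := dLine_affine (contDiff_osc hΨ) L w v
  have c1 : IsCompact ((fun ξ => w + L ξ) ⁻¹' tsupport (dLine (L v) h)) :=
    preimage_compact hc (tsupport_dLine_subset _ _)
  rw [dLine_osc hΨ] at e2
  have i1 := slice_integrable c1 (contDiff_dLine hh _) hΨ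
  have i2 := slice_integrable hc hh hΨ
  have i3 : Integrable fun ξ => osc (Ψ (w + L ξ)) *
      (Complex.I * ((dLine (L v) Ψ (w + L ξ) : ℝ) : ℂ) * h (w + L ξ)) := by
    refine slice_integrable (c := fun z => (Complex.I * ((dLine (L v) Ψ z : ℝ) : ℂ) * h z)) ?_ ?_ hΨ
    · exact preimage_compact hc (tsupport_mul_subset_right)
    · exact (contDiff_const.mul (Complex.ofRealCLM.contDiff.comp (contDiff_dLine hΨ _))).mul hh
  have key := integral_mul_fderiv_eq_neg_fderiv_mul_of_integrable (μ := volume)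
    (f := fun ξ => osc (Ψ (w + L ξ))) (g := fun ξ => h (w + L ξ)) (v := v) ?_ ?_ i2 ?_ ?_
  · have e1' : ∀ ξ, fderiv ℝ (fun ξ => h (w + L ξ)) ξ v = dLine (L v) h (w + L ξ) :=
      fun ξ => congrFun e1 ξ
    have e2' : ∀ ξ, fderiv ℝ (fun ξ => osc (Ψ (w + L ξ))) ξ v =
      Complex.I * ((dLine (L v) Ψ (w + L ξ) : ℝ) : ℂ) * osc (Ψ (w + L ξ)) := fun ξ => congrFun e2 ξ
    simp only [e1', e2'] at key
    rw [key]
    congr 2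
    funext ξ; ring
  · refine i3.congr (ae_of_all _ fun ξ => ?_)
    have := congrFun e2 ξ
    simp only [dLine] at this ⊢
    rw [this]; ring
  · refine i1.congr (ae_of_all _ fun ξ => ?_)
    have := congrFun e1 ξ
    simp only [dLine] at this ⊢
    rw [this]
  · intro x _
    exact cd_diff ((contDiff_osc hΨ).comp (contDiff_const.add L.contDiff)) x
  · intro x _
    exact cd_diff (hh.comp (contDiff_const.add L.contDiff)) x

variable {ι : Type*}

theorem ns_step {n : ℕ} (L : ES n →L[ℝ] W) (s : ι → Set W) (Ψ : ι → W → ℝ)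
    (hΨ : ∀ i, ContDiff ℝ ∞ (Ψ i)) (lam : ι → ℝ) (hlam : ∀ i, 1 ≤ lam i) {k : ℕ}
    (hg : ∀ j : Fin n, Sy s (k+1) fun i z => (lam i)⁻¹ * dLine (L (bv j)) (Ψ i) z)
    {c0 : ℝ} (hc0 : 0 < c0)
    (hlow : ∀ i, ∀ z ∈ s i, c0 ≤ ((lam i)⁻¹)^2 + ∑ j, ((lam i)⁻¹ * dLine (L (bv j)) (Ψ i) z)^2)
    {c : ι → W → ℂ} (hc : Sy s (k+1) c) :
    ∃ c' : ι → W → ℂ, Sy s k c' ∧ (∀ i, tsupport (c' i) ⊆ tsupport (c i)) ∧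
      ∀ i w, IsCompact ((fun ξ => w + L ξ) ⁻¹' tsupport (c i)) →
        ∫ ξ, osc (Ψ i (w + L ξ)) * c i (w + L ξ) =
          ((lam i)⁻¹ : ℝ) * ∫ ξ, osc (Ψ i (w + L ξ)) * c' i (w + L ξ) := by
  have hl0 : ∀ i, 0 < (lam i)⁻¹ := fun i => inv_pos.2 (lt_of_lt_of_le one_pos (hlam i))
  have hl1 : ∀ i, (lam i)⁻¹ ≤ 1 := fun i => inv_le_one_of_one_le₀ (hlam i)
  set g : Fin n → ι → W → ℝ := fun j i z => (lam i)⁻¹ * dLine (L (bv j)) (Ψ i) z with hgdef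
  have hlamS : Sy s (k+1) fun i (_ : W) => (lam i)⁻¹ :=
    Sy.const (k+1) (C := 1) (by
      intro i; rw [Real.norm_eq_abs, abs_of_pos (hl0 i)]; exact hl1 i)
  have hqS : Sy s (k+1) fun i z => ((lam i)⁻¹)^2 + ∑ j, (g j i z)^2 := by
    simp only [sq]
    exact (hlamS.mul hlamS).add (Sy.sum _ fun j _ => (hg j).mul (hg j))
  have hqpos : ∀ i z, 0 < ((lam i)⁻¹)^2 + ∑ j, (g j i z)^2 := by
    intro i z
    have := pow_pos (hl0 i) 2
    have : 0 ≤ ∑ j, (g j i z)^2 := Finset.sum_nonneg fun j _ => sq_nonneg _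
    linarith
  set d : ι → W → ℝ := fun i z => (((lam i)⁻¹)^2 + ∑ j, (g j i z)^2)⁻¹ with hd
  have hdS : Sy s (k+1) d := Sy.inv hc0 hqS (fun i z => (hqpos i z).ne') (fun i z hz => by
    rw [Real.norm_eq_abs, abs_of_pos (hqpos i z)]; exact hlow i z hz)
  set h : Fin n → ι → W → ℂ := fun j i z => (g j i z : ℂ) * ((d i z : ℂ) * c i z) with hh
  have hhS : ∀ j, Sy s (k+1) (h j) := fun j => (hg j).ofReal.mul (hdS.ofReal.mul hc)
  have hht : ∀ j i, tsupport (h j i) ⊆ tsupport (c i) := fun j i =>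
    tsupport_mul_subset_right.trans (tsupport_mul_subset_right)
  set c' : ι → W → ℂ := fun i z => ((lam i)⁻¹ : ℝ) * ((d i z : ℂ) * c i z) +
    Complex.I * ∑ j, dLine (L (bv j)) (h j i) z with hc'
  refine ⟨c', ?_, ?_, ?_⟩
  · refine Sy.add (hlamS.pred.ofReal.mul (hdS.ofReal.mul hc).pred) ?_
    exact (Sy.const k (C := 1) (c := fun _ => Complex.I) (by simp)).mul
      (Sy.sum _ fun j _ => (hhS j).d (L (bv j)))
  · intro i
    refine closure_minimal ?_ (isClosed_tsupport _)
    intro z hz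
    by_contra hzn
    apply hz
    have h1 : c i z = 0 := image_eq_zero_of_notMem_tsupport hzn
    have h2 : ∀ j, dLine (L (bv j)) (h j i) z = 0 := fun j =>
      image_eq_zero_of_notMem_tsupport fun h' => hzn (hht j i (tsupport_dLine_subset _ _ h'))
    simp [hc', h1, h2]
  · intro i w hw
    have hj : ∀ j, IsCompact ((fun ξ => w + L ξ) ⁻¹' tsupport (h j i)) := fun j =>
      preimage_compact hw (hht j i)
    have hI : ∀ j, ∫ ξ, osc (Ψ i (w + L ξ)) * (dLine (L (bv j)) (h j i) (w + L ξ)) =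
      - ∫ ξ, osc (Ψ i (w + L ξ)) *
        (Complex.I * ((dLine (L (bv j)) (Ψ i) (w + L ξ) : ℝ) : ℂ) * h j i (w + L ξ)) :=
      fun j => ibp L w (hΨ i) ((hhS j).smooth i) (hj j) (bv j)
    have int1 : ∀ j, Integrable fun ξ => osc (Ψ i (w + L ξ)) * (dLine (L (bv j)) (h j i) (w + L ξ)) :=
      fun j => slice_integrable (preimage_compact (hj j) (tsupport_dLine_subset _ _))
        (contDiff_dLine ((hhS j).smooth i) _) (hΨ i)
    have int2 : Integrable fun ξ => osc (Ψ i (w + L ξ)) * ((d i (w + L ξ) : ℂ) * c i (w + L ξ)) :=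
      slice_integrable (c := fun z => (d i z : ℂ) * c i z)
        (preimage_compact hw tsupport_mul_subset_right)
        ((hdS.ofReal.mul hc).smooth i) (hΨ i)
    have int3 : ∀ j, Integrable fun ξ => osc (Ψ i (w + L ξ)) *
        ((g j i (w + L ξ) : ℂ) * h j i (w + L ξ)) := fun j =>
      slice_integrable (c := fun z => (g j i z : ℂ) * h j i z)
        (preimage_compact (hj j) tsupport_mul_subset_right)
        (((hg j).ofReal.mul (hhS j)).smooth i) (hΨ i)
    have hI' : ∀ j, ((lam i)⁻¹ : ℝ) * (Complex.I * ∫ ξ, osc (Ψ i (w + L ξ)) * (dLine (L (bv j)) (h j i) (w + L ξ)))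
        = ∫ ξ, osc (Ψ i (w + L ξ)) * ((g j i (w + L ξ) : ℂ) * h j i (w + L ξ)) := by
      intro j
      rw [hI, ← integral_neg, ← integral_const_mul, ← integral_const_mul]
      congr 1; funext ξ
      simp only [hgdef]
      push_cast
      linear_combination (-((lam i : ℂ)⁻¹ * osc (Ψ i (w + L ξ)) * ((dLine (L (bv j)) (Ψ i) (w + L ξ) : ℝ) : ℂ) * h j i (w + L ξ))) * Complex.I_mul_I
    have e1 : ∫ ξ, osc (Ψ i (w + L ξ)) * c' i (w + L ξ) =
        ((lam i)⁻¹ : ℝ) * (∫ ξ, osc (Ψ i (w + L ξ)) * ((d i (w + L ξ) : ℂ) * c i (w + L ξ))) +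
        Complex.I * ∑ j, ∫ ξ, osc (Ψ i (w + L ξ)) * (dLine (L (bv j)) (h j i) (w + L ξ)) := by
      rw [← integral_finsetSum _ fun j _ => int1 j, ← integral_const_mul, ← integral_const_mul,
        ← integral_add (int2.const_mul _) ((integrable_finsetSum _ fun j _ => int1 j).const_mul _)]
      congr 1; funext ξ
      simp only [hc']
      rw [← Finset.mul_sum]
      ring
    rw [e1, mul_add, Finset.mul_sum, Finset.mul_sum, Finset.sum_congr rfl fun j _ => hI' j,
      ← integral_finsetSum _ fun j _ => int3 j, ← mul_assoc, ← integral_const_mul,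
      ← integral_add (int2.const_mul _) (integrable_finsetSum _ fun j _ => int3 j)]
    congr 1; funext ξ
    have hq : ((((lam i)⁻¹)^2 + ∑ j, (g j i (w + L ξ))^2 : ℝ) : ℂ) * (d i (w + L ξ) : ℂ) = 1 := by
      rw [← Complex.ofReal_mul, hd]
      rw [mul_inv_cancel₀ (hqpos i _).ne']; simp
    rw [← Finset.mul_sum]
    have : ∑ j, (g j i (w + L ξ) : ℂ) * h j i (w + L ξ) =
        ((∑ j, (g j i (w + L ξ))^2 : ℝ) : ℂ) * ((d i (w + L ξ) : ℂ) * c i (w + L ξ)) := by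
      rw [Complex.ofReal_sum, Finset.sum_mul]
      refine Finset.sum_congr rfl fun j _ => ?_
      simp only [hh]; push_cast; ring
    rw [this]
    rw [Complex.ofReal_add] at hq
    push_cast at hq ⊢
    linear_combination (-(osc (Ψ i (w + L ξ)) * c i (w + L ξ))) * hq

theorem nonstationary {n : ℕ} (L : ES n →L[ℝ] W) (s : ι → Set W) (Ψ : ι → W → ℝ)
    (hΨ : ∀ i, ContDiff ℝ ∞ (Ψ i)) (lam : ι → ℝ) (hlam : ∀ i, 1 ≤ lam i)
    {c0 : ℝ} (hc0 : 0 < c0)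
    (hlow : ∀ i, ∀ z ∈ s i, c0 ≤ ((lam i)⁻¹)^2 + ∑ j, ((lam i)⁻¹ * dLine (L (bv j)) (Ψ i) z)^2)
    {k : ℕ} (M : ℕ)
    (hg : ∀ j : Fin n, Sy s (k+M) fun i z => (lam i)⁻¹ * dLine (L (bv j)) (Ψ i) z)
    {c : ι → W → ℂ} (hc : Sy s (k+M) c) :
    ∃ c' : ι → W → ℂ, Sy s k c' ∧ (∀ i, tsupport (c' i) ⊆ tsupport (c i)) ∧
      ∀ i w, IsCompact ((fun ξ => w + L ξ) ⁻¹' tsupport (c i)) →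
        ∫ ξ, osc (Ψ i (w + L ξ)) * c i (w + L ξ) =
          (((lam i)⁻¹)^M : ℝ) * ∫ ξ, osc (Ψ i (w + L ξ)) * c' i (w + L ξ) := by
  induction M generalizing c with
  | zero => exact ⟨c, hc, fun _ => subset_rfl, by simp⟩
  | succ M ih =>
    obtain ⟨c1, h1, h2, h3⟩ := ns_step L s Ψ hΨ lam hlam (k := k+M) hg hc0 hlow hc
    obtain ⟨c2, h4, h5, h6⟩ := ih (fun j => (hg j).pred) h1
    refine ⟨c2, h4, fun i => (h5 i).trans (h2 i), fun i w hw => ?_⟩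
    rw [h3 i w hw, h6 i w (preimage_compact hw (h2 i)), ← mul_assoc]
    congr 1
    push_cast; ring

end NonStationary

section FTCsection

variable {W V F : Type*} [NormedAddCommGroup W] [NormedSpace ℝ W] [NormedAddCommGroup V]
  [NormedSpace ℝ V] [NormedAddCommGroup F] [NormedSpace ℝ F] {ι : Type*}

/-- Iterated directional derivatives along a list of directions. -/
def dList : List W → (W → F) → (W → F)
  | [], f => f
  | v :: l, f => dList l (dLine v f)

theorem contDiff_dList (l : List W) : ∀ {f : W → F}, ContDiff ℝ ∞ f → ContDiff ℝ ∞ (dList l f) := by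
  induction l with
  | nil => intro f hf; exact hf
  | cons v l ih => intro f hf; exact ih (contDiff_dLine hf v)

theorem tsupport_dList (l : List W) : ∀ (f : W → F), tsupport (dList l f) ⊆ tsupport f := by
  induction l with
  | nil => intro f; exact subset_rfl
  | cons v l ih => intro f; exact (ih _).trans (tsupport_dLine_subset v f)

theorem dList_affine (L : V →L[ℝ] W) (w : W) (l : List V) : ∀ {f : W → F}, ContDiff ℝ ∞ f →
    dList l (fun z => f (w + L z)) = fun z => dList (l.map L) f (w + L z) := by
  induction l with
  | nil => intro f hf; rfl
  | cons v l ih =>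
    intro f hf
    change dList l (dLine v fun z => f (w + L z)) = _
    rw [dLine_affine hf L w v, ih (contDiff_dLine hf _)]
    rfl

theorem Sy.dList {s : ι → Set W} (l : List W) : ∀ {k : ℕ} {f : ι → W → F}, Sy s (k + l.length) f →
    Sy s k (fun i => dList l (f i)) := by
  induction l with
  | nil => intro k f hf; exact hf
  | cons v l ih =>
    intro k f hf
    exact ih (Sy.d (k := k + l.length) hf v)

theorem ftc_one {g : ℝ → ℂ} (hg : ContDiff ℝ ∞ g) (hc : HasCompactSupport g) (x : ℝ) :
    g x = ∫ s, if s ≤ x then dLine (1:ℝ) g s else 0 := by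
  have h1 : ∫ s in Set.Iic x, deriv g s = g x :=
    HasCompactSupport.integral_Iic_deriv_eq (hg.of_le (by simp)) hc x
  rw [← h1, ← integral_indicator measurableSet_Iic]
  congr 1

theorem ftc_pi (m : ℕ) : ∀ {g : (Fin m → ℝ) → ℂ}, ContDiff ℝ ∞ g → HasCompactSupport g →
    ∀ x, g x = ∫ s, if (∀ i, s i ≤ x i) then
      dList (List.ofFn fun i : Fin m => (Pi.single i (1:ℝ) : Fin m → ℝ)) g s else 0 := by
  induction m with
  | zero =>
    intro g hg hc x
    rw [show (volume : Measure (Fin 0 → ℝ)) = Measure.dirac x from Measure.pi_of_empty _ x,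
      integral_dirac]
    simp [dList]
  | succ m ih =>
    intro g hg hc x
    -- slices
    let L0 : ℝ →L[ℝ] (Fin (m+1) → ℝ) := ContinuousLinearMap.pi
      (Fin.cons (ContinuousLinearMap.id ℝ ℝ) (fun _ => 0))
    let L1 : (Fin m → ℝ) →L[ℝ] (Fin (m+1) → ℝ) := ContinuousLinearMap.pi
      (Fin.cons 0 (fun i => ContinuousLinearMap.proj i))
    have hL : ∀ t y, (Fin.cons t y : Fin (m+1) → ℝ) = L0 t + L1 y := by
      intro t y
      funext i
      refine Fin.cases ?_ (fun i => ?_) i <;> simp [L0, L1]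
    have hL01 : L0 1 = Pi.single 0 1 := by
      funext i
      refine Fin.cases ?_ (fun i => ?_) i <;> simp [L0]
    have hL1 : ∀ j, L1 (Pi.single j 1) = Pi.single j.succ 1 := by
      intro j
      funext i
      refine Fin.cases ?_ (fun i => ?_) i
      · simp [L1]
      · simp [L1, Pi.single_apply]
    have hlist : (List.ofFn fun i : Fin (m+1) => (Pi.single i (1:ℝ) : Fin (m+1) → ℝ)) =
        L0 1 :: (List.ofFn fun i : Fin m => (Pi.single i (1:ℝ) : Fin m → ℝ)).map L1 := by
      rw [List.ofFn_succ, List.map_ofFn, hL01]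
      congr 2
      funext j
      simp [hL1]
    set g0 := dLine (L0 1) g with hg0
    have hg0s : ContDiff ℝ ∞ g0 := contDiff_dLine hg _
    have hg0c : HasCompactSupport g0 :=
      hc.of_isClosed_subset (isClosed_tsupport _) (tsupport_dLine_subset _ _)
    set D := dList ((List.ofFn fun i : Fin m => (Pi.single i (1:ℝ) : Fin m → ℝ)).map L1) g0 with hD
    have hDc : HasCompactSupport D :=
      hg0c.of_isClosed_subset (isClosed_tsupport _) (tsupport_dList _ _)
    have hDs : ContDiff ℝ ∞ D := contDiff_dList _ hg0s
    have hemb1 : ∀ t, Topology.IsClosedEmbedding (fun y => L0 t + L1 y) := by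
      intro t
      refine Topology.IsClosedEmbedding.of_continuous_injective_isClosedMap (by fun_prop) ?_ ?_
      · intro y y' h
        have : L1 y = L1 y' := by simpa using h
        funext i
        have := congrFun this i.succ
        simpa [L1] using this
      · have : Function.Injective L1 := by
          intro y y' this
          funext i
          have := congrFun this i.succ
          simpa [L1] using this
        have h1 := (LinearMap.isClosedEmbedding_of_injective (f := L1.toLinearMap)
          (LinearMap.ker_eq_bot.2 this))
        exact ((Homeomorph.addLeft (L0 t)).isClosedEmbedding.comp h1).isClosedMap
    have hemb0 : ∀ y, Topology.IsClosedEmbedding (fun t => L1 y + L0 t) := by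
      intro y
      have : Function.Injective L0 := by
          intro y y' this
          have := congrFun this 0
          simpa [L0] using this
      have h1 := (LinearMap.isClosedEmbedding_of_injective (f := L0.toLinearMap)
          (LinearMap.ker_eq_bot.2 this))
      exact ((Homeomorph.addLeft (L1 y)).isClosedEmbedding.comp h1)
    -- one dimensional step
    have s1 : g x = ∫ t, if t ≤ x 0 then g0 (L0 t + L1 (Fin.tail x)) else 0 := by
      have h1 := ftc_one (g := fun t => g (L1 (Fin.tail x) + L0 t))
        (hg.comp (contDiff_const.add L0.contDiff)) (hc.comp_isClosedEmbedding (hemb0 _)) (x 0)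
      rw [dLine_affine hg] at h1
      have h2 : L1 (Fin.tail x) + L0 (x 0) = x :=
        (add_comm _ _).trans ((hL _ _).symm.trans (Fin.cons_self_tail x))
      rw [h2] at h1
      rw [h1]
      simp only [add_comm (L0 _), hg0]
    have s2 : ∀ t, g0 (L0 t + L1 (Fin.tail x)) = ∫ y, if (∀ i, y i ≤ x (Fin.succ i)) then
        D (L0 t + L1 y) else 0 := by
      intro t
      have h1 := ih (g := fun y => g0 (L0 t + L1 y)) (hg0s.comp (contDiff_const.add L1.contDiff))
        (hg0c.comp_isClosedEmbedding (hemb1 t)) (Fin.tail x)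
      rw [dList_affine L1 (L0 t) _ hg0s] at h1
      exact h1
    have hmeas : Measurable fun s : Fin (m+1) → ℝ => if (∀ i, s i ≤ x i) then D s else 0 := by
      refine Measurable.ite ?_ hDs.continuous.measurable measurable_const
      have : {s : Fin (m+1) → ℝ | ∀ i, s i ≤ x i} = Set.Iic x := by ext s; simp [Pi.le_def]
      rw [this]; exact measurableSet_Iic
    have hIntgr : Integrable fun s : Fin (m+1) → ℝ => if (∀ i, s i ≤ x i) then D s else 0 := by
      refine (hDs.continuous.integrable_of_hasCompactSupport hDc).mono hmeas.aestronglyMeasurable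
        (ae_of_all _ fun s => ?_)
      split_ifs <;> simp
    have mp := (volume_preserving_piFinSuccAbove (fun _ : Fin (m+1) => ℝ) 0).symm
    rw [hlist]
    change _ = ∫ s, if (∀ i, s i ≤ x i) then D s else 0
    rw [← mp.integral_comp']
    have hIntgrB := (mp.integrable_comp_emb (MeasurableEquiv.measurableEmbedding _)).2 hIntgr
    rw [Measure.volume_eq_prod, integral_prod]
    · rw [s1]
      congr 1; funext t
      rw [s2]
      split_ifs with ht
      · congr 1; funext y
        have e1 : (MeasurableEquiv.piFinSuccAbove (fun _ : Fin (m+1) => ℝ) 0).symm (t, y) =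
          L0 t + L1 y := by rw [← hL]; exact Fin.insertNth_zero' t y
        rw [e1, ← hL]
        simp only [Fin.forall_fin_succ]
        simp [ht]
      · symm
        apply integral_eq_zero_of_ae
        refine ae_of_all _ fun y => ?_
        have e1 : (MeasurableEquiv.piFinSuccAbove (fun _ : Fin (m+1) => ℝ) 0).symm (t, y) =
          L0 t + L1 y := by rw [← hL]; exact Fin.insertNth_zero' t y
        simp only [e1, ← hL, Fin.forall_fin_succ]
        simp [ht]
    · exact hIntgrB

/-- Indicator of the orthant below `x`. -/
def orth {n : ℕ} (s x : ES n) : ℂ := by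
  classical exact if ∀ i, s i ≤ x i then 1 else 0

theorem norm_orth_le {n : ℕ} (s x : ES n) : ‖orth s x‖ ≤ 1 := by
  unfold orth; split_ifs <;> simp

theorem measurable_orth {n : ℕ} : Measurable fun p : ES n × ES n => orth p.1 p.2 := by
  unfold orth
  refine Measurable.ite ?_ measurable_const measurable_const
  have : {p : ES n × ES n | ∀ i, p.1 i ≤ p.2 i} = ⋂ i, {p | p.1 i ≤ p.2 i} := by ext; simp
  rw [this]
  refine MeasurableSet.iInter fun i => measurableSet_le ?_ ?_
  · fun_prop
  · fun_prop

/-- All first-factor basis directions. -/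
def dirs1 (n : ℕ) (V : Type*) [NormedAddCommGroup V] : List (ES n × V) :=
  List.ofFn fun i : Fin n => ((bv i, 0) : ES n × V)

theorem ftc {n : ℕ} {c : ES n × V → ℂ} (hc : ContDiff ℝ ∞ c) {Q : Set (ES n)} (hQ : IsCompact Q)
    (hcQ : ∀ z v, z ∉ Q → c (z, v) = 0) (x : ES n) (v : V) :
    c (x, v) = ∫ s, orth s x * dList (dirs1 n V) c (s, v) := by
  let T : (Fin n → ℝ) ≃L[ℝ] ES n := (EuclideanSpace.equiv (Fin n) ℝ).symm
  let L : (Fin n → ℝ) →L[ℝ] ES n × V := (ContinuousLinearMap.inl ℝ (ES n) V).comp (T : (Fin n → ℝ) →L[ℝ] ES n)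
  have hg : ContDiff ℝ ∞ fun y => c ((0, v) + L y) := hc.comp (contDiff_const.add L.contDiff)
  have hLy : ∀ y, ((0, v) + L y : ES n × V) = (T y, v) := by intro y; simp [L]
  have hgc : HasCompactSupport fun y => c ((0, v) + L y) := by
    refine HasCompactSupport.intro (T.toHomeomorph.isCompact_preimage.2 hQ) ?_
    intro y hy
    rw [hLy]
    exact hcQ _ _ hy
  have h1 := ftc_pi n hg hgc (T.symm x)
  rw [dList_affine L _ _ hc] at h1
  have hl : (List.ofFn fun i : Fin n => (Pi.single i (1:ℝ) : Fin n → ℝ)).map L = dirs1 n V := by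
    rw [List.map_ofFn, dirs1]
    congr 1
  rw [hl] at h1
  have mp := (EuclideanSpace.volume_preserving_symm_measurableEquiv_toLp (Fin n)).symm
  simp only [hLy, ContinuousLinearEquiv.apply_symm_apply] at h1
  rw [h1, ← mp.integral_comp']
  congr 1; funext y
  unfold orth
  have e : (MeasurableEquiv.toLp 2 (Fin n → ℝ)).symm.symm y = T y := rfl
  rw [e]
  have e2 : (∀ i, y i ≤ (T.symm x) i) ↔ ∀ i, (T y) i ≤ x i := Iff.rfl
  split_ifs with h3 h4 h4
  · simp
  · exact absurd (e2.1 h3) h4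
  · exact absurd (e2.2 h4) h3
  · simp

end FTCsection

section BaseEstimate

variable {ι ι' : Type*} {Y : Type*} [NormedAddCommGroup Y] [NormedSpace ℝ Y]

theorem es_sum {n : ℕ} (v : ES n) : v = ∑ j, v j • bv j := by
  ext i
  simp [Pi.single_apply]

theorem Sy.bound_first {n : ℕ} {k : ℕ} {f : ι → ES n × Y → ℝ}
    (hfv : ∀ v : ES n, Sy (fun _ => Set.univ) k (fun i => dLine ((v, 0) : ES n × Y) (f i))) :
    ∃ C : ℝ, 0 ≤ C ∧ ∀ i z (v : ES n), |dLine ((v, 0) : ES n × Y) (f i) z| ≤ C * ‖v‖ := by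
  choose C hC0 hC using fun j : Fin n => (hfv (bv j)).bound
  refine ⟨∑ j, C j, Finset.sum_nonneg fun j _ => hC0 j, fun i z v => ?_⟩
  have e : ((v, 0) : ES n × Y) = ∑ j, v j • ((bv j, 0) : ES n × Y) := by
    have : ((v, 0) : ES n × Y) = ContinuousLinearMap.inl ℝ (ES n) Y v := rfl
    rw [this]
    conv_lhs => rw [es_sum v]
    simp [map_sum]
  have : dLine ((v, 0) : ES n × Y) (f i) z = ∑ j, v j * dLine ((bv j, 0) : ES n × Y) (f i) z := by
    unfold dLine
    rw [e, map_sum]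
    simp only [map_smul, smul_eq_mul]
  rw [this, Finset.sum_mul]
  refine (Finset.abs_sum_le_sum_abs _ _).trans (Finset.sum_le_sum fun j _ => ?_)
  rw [abs_mul, mul_comm]
  have h1 := hC j i z (Set.mem_univ _)
  have h2 : |v j| ≤ ‖v‖ := by simpa using PiLp.norm_apply_le v j
  exact mul_le_mul h1 h2 (abs_nonneg _) (hC0 j)

theorem diff_bound {n : ℕ} {k : ℕ} {f : ι → ES n × Y → ℝ} (hf : ∀ i, ContDiff ℝ ∞ (f i))
    (hfv : ∀ v : ES n, Sy (fun _ => Set.univ) k (fun i => dLine ((v, 0) : ES n × Y) (f i))) :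
    ∃ C : ℝ, 0 ≤ C ∧ ∀ i x x' y, |f i (x, y) - f i (x', y)| ≤ C * ‖x - x'‖ := by
  obtain ⟨C, hC0, hC⟩ := Sy.bound_first hfv
  refine ⟨C, hC0, fun i x x' y => ?_⟩
  have h1 : ∀ z : ES n, HasFDerivAt (fun x => f i (x, y))
      ((fderiv ℝ (f i) (z, y)).comp (ContinuousLinearMap.inl ℝ (ES n) Y)) z := by
    intro z
    exact (cd_diff (hf i) (z, y)).hasFDerivAt.comp z (hasFDerivAt_prodMk_left z y)
  have h2 := Convex.norm_image_sub_le_of_norm_hasFDerivWithin_le (s := Set.univ)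
    (f := fun x => f i (x, y)) (C := C) (x := x') (y := x)
    (fun z _ => (h1 z).hasFDerivWithinAt) (fun z _ => by
      refine ContinuousLinearMap.opNorm_le_bound _ hC0 fun v => ?_
      exact hC i (z, y) v) convex_univ (Set.mem_univ _) (Set.mem_univ _)
  simpa using h2

theorem diff_Sy {n : ℕ} (σ : ι' → ι) (lam : ι' → ℝ) (hlam : ∀ i, 1 ≤ lam i)
    (s : ι' → Set (ES n × ES n × Y)) {R : ℝ} (hs : ∀ i, ∀ z ∈ s i, ‖z.1 - z.2.1‖ ≤ R * lam i) :
    ∀ {k : ℕ} {f : ι → ES n × Y → ℝ}, (∀ i, ContDiff ℝ ∞ (f i)) →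
    (∀ v : ES n, Sy (fun _ => Set.univ) k (fun i => dLine ((v, 0) : ES n × Y) (f i))) →
    Sy s k (fun i z => (lam i)⁻¹ * (f (σ i) (z.1, z.2.2) - f (σ i) (z.2.1, z.2.2))) := by
  intro k
  have hl0 : ∀ i, 0 < (lam i)⁻¹ := fun i => inv_pos.2 (lt_of_lt_of_le one_pos (hlam i))
  let P1 : (ES n × ES n × Y) →L[ℝ] ES n × Y :=
    (ContinuousLinearMap.fst ℝ _ _).prod ((ContinuousLinearMap.snd ℝ _ _).comp
      (ContinuousLinearMap.snd ℝ _ _))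
  let P2 : (ES n × ES n × Y) →L[ℝ] ES n × Y := ContinuousLinearMap.snd ℝ _ _
  have hlamS : ∀ k, Sy s k fun i (_ : ES n × ES n × Y) => (lam i)⁻¹ := fun k =>
    Sy.const k (C := 1) (by
      intro i; rw [Real.norm_eq_abs, abs_of_pos (hl0 i)]; exact inv_le_one_of_one_le₀ (hlam i))
  have sm : ∀ {f : ι → ES n × Y → ℝ}, (∀ i, ContDiff ℝ ∞ (f i)) → ∀ i, ContDiff ℝ ∞
      (fun z : ES n × ES n × Y => (lam i)⁻¹ * (f (σ i) (z.1, z.2.2) - f (σ i) (z.2.1, z.2.2))) := by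
    intro f hf i
    exact contDiff_const.mul (((hf _).comp P1.contDiff).sub ((hf _).comp P2.contDiff))
  have key : ∀ {k : ℕ} {f : ι → ES n × Y → ℝ}, (∀ i, ContDiff ℝ ∞ (f i)) →
      (∀ v : ES n, Sy (fun _ => Set.univ) k (fun i => dLine ((v, 0) : ES n × Y) (f i))) →
      ∃ C : ℝ, ∀ i, ∀ z ∈ s i,
        ‖(lam i)⁻¹ * (f (σ i) (z.1, z.2.2) - f (σ i) (z.2.1, z.2.2))‖ ≤ C := by
    intro k f hf hfv
    obtain ⟨C, hC0, hC⟩ := diff_bound hf hfv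
    refine ⟨C * R, fun i z hz => ?_⟩
    rw [norm_mul, Real.norm_eq_abs, abs_of_pos (hl0 i), Real.norm_eq_abs]
    have h1 := (hC (σ i) z.1 z.2.1 z.2.2).trans (mul_le_mul_of_nonneg_left (hs i z hz) hC0)
    rw [inv_mul_le_iff₀ (lt_of_lt_of_le one_pos (hlam i))]
    linarith
  induction k with
  | zero => intro f hf hfv; exact ⟨sm hf, key hf hfv⟩
  | succ k ih =>
    intro f hf hfv
    refine Sy.succ (sm hf) (key hf hfv) fun v => ?_
    obtain ⟨v1, v2, v3⟩ := v
    have t1 : Sy s k (fun i z => dLine ((v1, 0) : ES n × Y) (f (σ i)) (0 + P1 z)) :=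
      (hfv v1).pred.affine s σ (fun _ => 0) P1 (by simp)
    have t2 : Sy s k (fun i z => dLine ((v2, 0) : ES n × Y) (f (σ i)) (0 + P2 z)) :=
      (hfv v2).pred.affine s σ (fun _ => 0) P2 (by simp)
    have t3 := ih (f := fun i => dLine ((0, v3) : ES n × Y) (f i))
      (fun i => contDiff_dLine (hf i) _) (fun v => by
        have := (hfv v).d ((0, v3) : ES n × Y)
        convert! this using 2 with i
        exact dLine_comm (hf i) _ _)
    have := ((hlamS k).mul (t1.sub t2)).add t3
    refine this.congr fun i z => ?_
    have d1 := (cd_diff (hf (σ i)) (P1 z)).hasFDerivAt.comp z P1.hasFDerivAt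
    have d2 := (cd_diff (hf (σ i)) (P2 z)).hasFDerivAt.comp z P2.hasFDerivAt
    have d3 := (d1.sub d2).const_mul (lam i)⁻¹
    have e : (fun z : ES n × ES n × Y => (lam i)⁻¹ *
        (f (σ i) (z.1, z.2.2) - f (σ i) (z.2.1, z.2.2))) =
        fun z => (lam i)⁻¹ * ((f (σ i) ∘ P1) z - (f (σ i) ∘ P2) z) := rfl
    have e1 : P1 (v1, v2, v3) = ((v1, 0) : ES n × Y) + (0, v3) := by simp [P1]
    have e2 : P2 (v1, v2, v3) = ((v2, 0) : ES n × Y) + (0, v3) := by simp [P2]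
    unfold dLine
    rw [e]
    have d3' := d3.fderiv
    simp only [Pi.sub_apply] at d3'
    erw [d3']
    simp only [smul_apply, sub_apply,
      ContinuousLinearMap.comp_apply, e1, e2, map_add, zero_add, smul_eq_mul]
    simp only [P1, P2, ContinuousLinearMap.prod_apply, ContinuousLinearMap.comp_apply,
      ContinuousLinearMap.coe_fst', ContinuousLinearMap.coe_snd']
    ring

/-- A uniform family of nondegenerate phases. -/
structure Phase {n : ℕ} (k : ℕ) (c0 : ℝ) (φ : ι → ES n × ES n → ℝ) : Prop where
  pos : 0 < c0
  smooth : ∀ i, ContDiff ℝ ∞ (φ i)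
  mixed : ∀ v w : ES n, Sy (fun _ => Set.univ) k
    (fun i => dLine ((v, 0) : ES n × ES n) (dLine ((0, w) : ES n × ES n) (φ i)))
  low1 : ∀ i (y y' ξ : ES n), c0 * ‖y - y'‖ ^ 2 ≤
    ∑ j, (dLine ((0, bv j) : ES n × ES n) (φ i) (y, ξ) -
      dLine ((0, bv j) : ES n × ES n) (φ i) (y', ξ)) ^ 2
  low2 : ∀ i (y ξ ξ' : ES n), c0 * ‖ξ - ξ'‖ ^ 2 ≤
    ∑ j, (dLine ((bv j, 0) : ES n × ES n) (φ i) (y, ξ) -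
      dLine ((bv j, 0) : ES n × ES n) (φ i) (y, ξ')) ^ 2

theorem Phase.reindex {n k : ℕ} {c0 : ℝ} {φ : ι → ES n × ES n → ℝ} (h : Phase k c0 φ) (σ : ι' → ι) :
    Phase k c0 (fun i => φ (σ i)) :=
  ⟨h.pos, fun i => h.smooth _, fun v w => (h.mixed v w).reindex σ, fun i => h.low1 _,
    fun i => h.low2 _⟩

theorem Phase.mono {n k l : ℕ} (hkl : k ≤ l) {c0 : ℝ} {φ : ι → ES n × ES n → ℝ}
    (h : Phase l c0 φ) : Phase k c0 φ :=
  ⟨h.pos, h.smooth, fun v w => (h.mixed v w).mono hkl, h.low1, h.low2⟩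

theorem low_of {c0 R lam r S : ℝ} (hc0 : 0 < c0) (hR : 1 ≤ R) (hl : 1 ≤ lam) (hr : 0 ≤ r)
    (hlr : lam ≤ R * (1 + r)) (hS : c0 * r ^ 2 ≤ S) :
    min 1 c0 / (2 * R ^ 2) ≤ (lam⁻¹) ^ 2 + (lam⁻¹) ^ 2 * S := by
  have hlp : 0 < lam := by linarith
  have h1 : min 1 c0 * (1 + r ^ 2) ≤ 1 + S := by
    have a1 : min 1 c0 ≤ 1 := min_le_left _ _
    have a2 : min 1 c0 * r ^ 2 ≤ c0 * r ^ 2 := mul_le_mul_of_nonneg_right (min_le_right _ _) (sq_nonneg r)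
    linarith
  have h2 : lam ^ 2 ≤ 2 * R ^ 2 * (1 + r ^ 2) := by
    have : lam ^ 2 ≤ (R * (1 + r)) ^ 2 := pow_le_pow_left₀ hlp.le hlr 2
    nlinarith [sq_nonneg (1 - r), sq_nonneg R, mul_nonneg (sq_nonneg R) (sq_nonneg (1 - r))]
  have hm : 0 < min 1 c0 := lt_min one_pos hc0
  have hR2 : 0 < 2 * R ^ 2 := by positivity
  have : (lam⁻¹) ^ 2 + (lam⁻¹) ^ 2 * S = (1 + S) / lam ^ 2 := by field_simp
  rw [this, div_le_div_iff₀ hR2 (by positivity)]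
  calc min 1 c0 * lam ^ 2 ≤ min 1 c0 * (2 * R ^ 2 * (1 + r ^ 2)) :=
        mul_le_mul_of_nonneg_left h2 hm.le
    _ = (min 1 c0 * (1 + r ^ 2)) * (2 * R ^ 2) := by ring
    _ ≤ _ := mul_le_mul_of_nonneg_right h1 hR2.le

end BaseEstimate

section TTstar

variable {n : ℕ}

theorem integral_sq_eq {f : ES n → ℂ} : ((∫ x, ‖f x‖ ^ 2 : ℝ) : ℂ) =
    ∫ x, f x * (starRingEnd ℂ) (f x) := by
  rw [← integral_complex_ofReal]
  congr 1; funext x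
  rw [Complex.mul_conj, Complex.normSq_eq_norm_sq]

/-- Abstract `TT*` argument with a Schur bound. -/
theorem ttstar {p : ES n × ES n → ℂ} (hp : Measurable p) {B : ℝ} {Y0 K : Set (ES n)}
    (hY0 : volume Y0 ≠ ⊤) (hK : volume K ≠ ⊤) (hY0m : MeasurableSet Y0) (hKm : MeasurableSet K)
    (hpB : ∀ z, ‖p z‖ ≤ B) (hpY : ∀ y ξ, y ∉ Y0 → p (y, ξ) = 0) (hpK : ∀ y ξ, ξ ∉ K → p (y, ξ) = 0)
    {h : ES n → ℝ} (hh : Integrable h) (hhe : ∀ x, h (-x) = h x)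
    (hk : ∀ ξ ξ', ‖∫ y, p (y, ξ) * (starRingEnd ℂ) (p (y, ξ'))‖ ≤ h (ξ - ξ'))
    {C : ℝ} (hC : 0 < C) (hCh : ∫ x, h x ≤ C) {u : ES n → ℂ} (hu : Integrable u)
    (hu2 : Integrable fun y => ‖u y‖ ^ 2) :
    Integrable (fun ξ => ‖∫ y, p (y, ξ) * u y‖ ^ 2) ∧
    ∫ ξ, ‖∫ y, p (y, ξ) * u y‖ ^ 2 ≤ C * ∫ y, ‖u y‖ ^ 2 := by
  have hB0 : 0 ≤ B := (norm_nonneg _).trans (hpB 0)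
  have hh0 : ∀ x, 0 ≤ h x := fun x => by
    have := (norm_nonneg _).trans (hk x 0); simpa using this
  set F : ES n → ℂ := fun ξ => ∫ y, p (y, ξ) * u y with hF
  have hFm : AEStronglyMeasurable F := by
    have h1 : AEStronglyMeasurable (fun z : ES n × ES n => p (z.2, z.1) * u z.2)
        (volume.prod volume) :=
      ((hp.comp measurable_swap).aestronglyMeasurable).mul hu.1.comp_snd
    exact h1.integral_prod_right'
  have hFK : ∀ ξ, ξ ∉ K → F ξ = 0 := by intro ξ hξ; simp [hF, hpK _ _ hξ]
  have hFB : ∀ ξ, ‖F ξ‖ ≤ B * ∫ y, ‖u y‖ := by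
    intro ξ
    refine (norm_integral_le_integral_norm _).trans ?_
    rw [← integral_const_mul]
    refine integral_mono_of_nonneg (ae_of_all _ fun y => norm_nonneg _) (hu.norm.const_mul _)
      (ae_of_all _ fun y => ?_)
    simp only [norm_mul]
    exact mul_le_mul_of_nonneg_right (hpB _) (norm_nonneg _)
  set BF := B * ∫ y, ‖u y‖ with hBF
  have hBF0 : 0 ≤ BF := (norm_nonneg _).trans (hFB 0)
  have hKi : ∀ c : ℝ, Integrable (K.indicator fun _ => c) := fun c =>
    (integrable_indicator_iff hKm).2 (by simp [hK.lt_top])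
  have hFi : Integrable F := by
    refine (hKi BF).mono' hFm (ae_of_all _ fun ξ => ?_)
    by_cases hξ : ξ ∈ K
    · simpa [hξ] using hFB ξ
    · simp [hξ, hFK ξ hξ]
  have hF2 : Integrable fun ξ => ‖F ξ‖ ^ 2 := by
    refine (hKi (BF ^ 2)).mono' (hFm.norm.pow 2) (ae_of_all _ fun ξ => ?_)
    by_cases hξ : ξ ∈ K
    · simp only [hξ, Set.indicator_of_mem, norm_pow, norm_norm]
      exact pow_le_pow_left₀ (norm_nonneg _) (hFB ξ) 2
    · simp [hξ, hFK ξ hξ]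
  refine ⟨hF2, ?_⟩
  set A := ∫ ξ, ‖F ξ‖ ^ 2 with hA
  set U := ∫ y, ‖u y‖ ^ 2 with hU
  have hA0 : 0 ≤ A := integral_nonneg fun _ => by positivity
  set G : ES n → ℂ := fun y => ∫ ξ, p (y, ξ) * (starRingEnd ℂ) (F ξ) with hG
  have hFc : Integrable fun ξ => (starRingEnd ℂ) (F ξ) := by
    refine hFi.mono (Complex.continuous_conj.comp_aestronglyMeasurable hFm) (ae_of_all _ fun ξ => ?_)
    simp
  have hGm : AEStronglyMeasurable G := by
    have h1 : AEStronglyMeasurable (fun z : ES n × ES n => p z * (starRingEnd ℂ) (F z.2))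
        (volume.prod volume) := hp.aestronglyMeasurable.mul hFc.1.comp_snd
    exact h1.integral_prod_right'
  have hGY : ∀ y, y ∉ Y0 → G y = 0 := by intro y hy; simp [hG, hpY _ _ hy]
  have hGB : ∀ y, ‖G y‖ ≤ B * ∫ ξ, ‖F ξ‖ := by
    intro y
    refine (norm_integral_le_integral_norm _).trans ?_
    rw [← integral_const_mul]
    refine integral_mono_of_nonneg (ae_of_all _ fun y => norm_nonneg _) (hFi.norm.const_mul _)
      (ae_of_all _ fun y => ?_)
    simp only [norm_mul, RCLike.norm_conj]
    exact mul_le_mul_of_nonneg_right (hpB _) (norm_nonneg _)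
  have hYi : ∀ c : ℝ, Integrable (Y0.indicator fun _ => c) := fun c =>
    (integrable_indicator_iff hY0m).2 (by simp [hY0.lt_top])
  have hG2 : Integrable fun y => ‖G y‖ ^ 2 := by
    refine (hYi ((B * ∫ ξ, ‖F ξ‖) ^ 2)).mono' (hGm.norm.pow 2) (ae_of_all _ fun ξ => ?_)
    by_cases hξ : ξ ∈ Y0
    · simp only [hξ, Set.indicator_of_mem, norm_pow, norm_norm]
      exact pow_le_pow_left₀ (norm_nonneg _) (hGB ξ) 2
    · simp [hξ, hGY ξ hξ]
  -- first identity
  have id1 : (A : ℂ) = ∫ y, G y * u y := by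
    rw [hA, integral_sq_eq]
    have e1 : ∀ ξ, F ξ * (starRingEnd ℂ) (F ξ) = ∫ y, p (y, ξ) * u y * (starRingEnd ℂ) (F ξ) := by
      intro ξ; rw [integral_mul_const]
    have e2 : ∀ y, G y * u y = ∫ ξ, p (y, ξ) * u y * (starRingEnd ℂ) (F ξ) := by
      intro y; rw [← integral_mul_const]; congr 1; funext ξ; ring
    simp only [e1, e2]
    refine integral_integral_swap ?_
    have h1 : Integrable (fun z : ES n × ES n => B * (‖F z.1‖ * ‖u z.2‖)) (volume.prod volume) :=
      (Integrable.mul_prod hFi.norm hu.norm).const_mul B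
    refine h1.mono' ?_ (ae_of_all _ fun z => ?_)
    · exact ((hp.comp measurable_swap).aestronglyMeasurable.mul hu.1.comp_snd).mul hFc.1.comp_fst
    · simp only [Function.uncurry, norm_mul, RCLike.norm_conj]
      nlinarith [hpB (z.2, z.1), mul_nonneg (norm_nonneg (u z.2)) (norm_nonneg (F z.1))]
  -- second identity
  have id2 : ((∫ y, ‖G y‖ ^ 2 : ℝ) : ℂ) = ∫ z : ES n × ES n, (starRingEnd ℂ) (F z.1) * F z.2 *
      ∫ y, p (y, z.1) * (starRingEnd ℂ) (p (y, z.2)) := by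
    rw [integral_sq_eq]
    have e1 : ∀ y, G y * (starRingEnd ℂ) (G y) = ∫ z : ES n × ES n,
        (starRingEnd ℂ) (F z.1) * F z.2 * (p (y, z.1) * (starRingEnd ℂ) (p (y, z.2))) := by
      intro y
      have : (starRingEnd ℂ) (G y) = ∫ ξ, (starRingEnd ℂ) (p (y, ξ)) * F ξ := by
        rw [hG, ← integral_conj]; simp
      rw [this, hG, ← integral_prod_mul, Measure.volume_eq_prod]
      congr 1; funext z; ring
    simp only [e1, ← integral_const_mul]
    refine integral_integral_swap ?_
    have h1 : Integrable (fun z : ES n × ES n × ES n =>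
        (Y0.indicator (fun _ => B * B) z.1) * (‖F z.2.1‖ * ‖F z.2.2‖)) (volume.prod volume) :=
      Integrable.mul_prod (hYi _) (Integrable.mul_prod hFi.norm hFi.norm)
    refine h1.mono' ?_ (ae_of_all _ fun z => ?_)
    · have m1 : AEStronglyMeasurable (fun z : ES n × ES n =>  (starRingEnd ℂ) (F z.1) * F z.2)
          (volume.prod volume) := hFc.1.comp_fst.mul hFm.comp_snd
      refine m1.comp_snd.mul (AEStronglyMeasurable.mul ?_ ?_)
      · exact (hp.comp (by fun_prop : Measurable fun z : ES n × ES n × ES n =>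
          (z.1, z.2.1))).aestronglyMeasurable
      · exact Complex.continuous_conj.comp_aestronglyMeasurable
          (hp.comp (by fun_prop : Measurable fun z : ES n × ES n × ES n =>
          (z.1, z.2.2))).aestronglyMeasurable
    · simp only [Function.uncurry, norm_mul, RCLike.norm_conj]
      by_cases hz : z.1 ∈ Y0
      · simp only [hz, Set.indicator_of_mem]
        have := mul_le_mul (hpB (z.1, z.2.1)) (hpB (z.1, z.2.2)) (norm_nonneg _) hB0
        nlinarith [mul_nonneg (norm_nonneg (F z.2.1)) (norm_nonneg (F z.2.2))]
      · simp [hz, hpY _ _ hz]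
  -- Schur bound
  have i1 : Integrable (fun z : ES n × ES n => ‖F z.1‖ ^ 2 * h (z.1 - z.2)) (volume.prod volume) := by
    have := (Integrable.convolution_integrand (ContinuousLinearMap.mul ℝ ℝ) hF2 hh)
    have h2 := this.swap
    refine h2.congr (ae_of_all _ fun z => ?_)
    simp only [Function.comp, Prod.swap, ContinuousLinearMap.mul_apply']
    rw [← hhe, neg_sub]
  have i2 : Integrable (fun z : ES n × ES n => ‖F z.2‖ ^ 2 * h (z.1 - z.2)) (volume.prod volume) := by
    exact (Integrable.convolution_integrand (ContinuousLinearMap.mul ℝ ℝ) hF2 hh)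
  have v1 : ∫ z : ES n × ES n, ‖F z.1‖ ^ 2 * h (z.1 - z.2) ∂(volume.prod volume) = (∫ x, h x) * A := by
    rw [integral_prod _ i1]
    simp only [integral_const_mul, integral_sub_left_eq_self h]
    rw [integral_mul_const, mul_comm]
  have v2 : ∫ z : ES n × ES n, ‖F z.2‖ ^ 2 * h (z.1 - z.2) ∂(volume.prod volume) = (∫ x, h x) * A := by
    rw [integral_prod_symm _ i2]
    simp only [integral_const_mul, integral_sub_right_eq_self h]
    rw [integral_mul_const, mul_comm]
  have schur : ∫ y, ‖G y‖ ^ 2 ≤ C * A := by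
    have h1 : ‖((∫ y, ‖G y‖ ^ 2 : ℝ) : ℂ)‖ ≤ ∫ z : ES n × ES n,
        (‖F z.1‖ ^ 2 * h (z.1 - z.2) + ‖F z.2‖ ^ 2 * h (z.1 - z.2)) / 2 ∂(volume.prod volume) := by
      rw [id2, Measure.volume_eq_prod]
      refine norm_integral_le_of_norm_le ((i1.add i2).div_const 2) (ae_of_all _ fun z => ?_)
      simp only [norm_mul, RCLike.norm_conj]
      have a1 := hk z.1 z.2
      have a2 := hh0 (z.1 - z.2)
      have a3 : ‖F z.1‖ * ‖F z.2‖ ≤ (‖F z.1‖ ^ 2 + ‖F z.2‖ ^ 2) / 2 := by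
        nlinarith [sq_nonneg (‖F z.1‖ - ‖F z.2‖)]
      calc _ ≤ ((‖F z.1‖ ^ 2 + ‖F z.2‖ ^ 2) / 2) * h (z.1 - z.2) :=
            mul_le_mul a3 a1 (norm_nonneg _) (by positivity)
        _ = _ := by ring
    rw [integral_div, integral_add i1 i2, v1, v2] at h1
    rw [Complex.norm_real, Real.norm_eq_abs] at h1
    have h2 := (le_abs_self _).trans h1
    nlinarith [mul_le_mul_of_nonneg_right hCh hA0]
  -- conclusion
  have fin : A ≤ ∫ y, (C * ‖u y‖ ^ 2 + C⁻¹ * ‖G y‖ ^ 2) / 2 := by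
    have h1 : ‖(A : ℂ)‖ ≤ ∫ y, (C * ‖u y‖ ^ 2 + C⁻¹ * ‖G y‖ ^ 2) / 2 := by
      rw [id1]
      refine norm_integral_le_of_norm_le (((hu2.const_mul C).add (hG2.const_mul C⁻¹)).div_const 2)
        (ae_of_all _ fun y => ?_)
      rw [norm_mul]
      have h3 : C⁻¹ * (C * ‖u y‖ - ‖G y‖) ^ 2 = C * ‖u y‖ ^ 2 + C⁻¹ * ‖G y‖ ^ 2 - 2 * (‖G y‖ * ‖u y‖) := by
        field_simp; ring
      have h4 : 0 ≤ C⁻¹ * (C * ‖u y‖ - ‖G y‖) ^ 2 := by positivity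
      linarith
    rw [Complex.norm_real, Real.norm_eq_abs] at h1
    exact (le_abs_self _).trans h1
  rw [integral_div, integral_add (hu2.const_mul C) (hG2.const_mul C⁻¹), integral_const_mul,
    integral_const_mul] at fin
  have : C⁻¹ * ∫ y, ‖G y‖ ^ 2 ≤ A := by
    rw [inv_mul_le_iff₀ hC]; exact schur
  linarith

end TTstar

section BaseEst

variable {n : ℕ} {ι : Type*}

theorem integrable_decay (n : ℕ) : Integrable fun x : ES n => ((1 + ‖x‖)⁻¹) ^ (n + 1) := by
  have h := integrable_one_add_norm (E := ES n) (μ := volume) (r := (n : ℝ) + 1) (by simp)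
  refine h.congr (ae_of_all _ fun x => ?_)
  have : 0 < 1 + ‖x‖ := by positivity
  simp only
  rw [Real.rpow_neg this.le, inv_pow, show (n : ℝ) + 1 = ((n + 1 : ℕ) : ℝ) by push_cast; rfl,
    Real.rpow_natCast]

theorem base_est {k : ℕ} (hk : n + 1 ≤ k) {c0 : ℝ} {φ : ι → ES n × ES n → ℝ} (hφ : Phase k c0 φ)
    {β : ι → ES n × ES n → ℂ} (hβm : ∀ i, Measurable (β i))
    (hβ : Sy (fun _ : ι × ES n => Set.univ) (n + 1) (fun q (y : ES n) => β q.1 (y, q.2)))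
    (κ : ι → ES n) (R : ℝ) (hR : ∀ i y ξ, R < ‖y - κ i‖ → β i (y, ξ) = 0)
    (hK : ∀ i, ∃ K, IsCompact K ∧ ∀ y ξ, ξ ∉ K → β i (y, ξ) = 0) :
    ∃ C, 0 < C ∧ ∀ i (u : ES n → ℂ), Integrable u → (Integrable fun y => ‖u y‖ ^ 2) →
      Integrable (fun ξ => ‖∫ y, osc (φ i (y, ξ)) * β i (y, ξ) * u y‖ ^ 2) ∧
      ∫ ξ, ‖∫ y, osc (φ i (y, ξ)) * β i (y, ξ) * u y‖ ^ 2 ≤ C * ∫ y, ‖u y‖ ^ 2 := by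
  let Q := ι × ES n × ES n
  let Ψ : Q → ES n → ℝ := fun q y => φ q.1 (y, q.2.1) - φ q.1 (y, q.2.2)
  let lam : Q → ℝ := fun q => 1 + ‖q.2.1 - q.2.2‖
  have hlam : ∀ q, 1 ≤ lam q := fun q => by simp [lam]
  let In : ES n → ES n →L[ℝ] ES n × ES n := fun _ => ContinuousLinearMap.inl ℝ (ES n) (ES n)
  have hin : ∀ (f : ES n × ES n → ℝ) (ξ y : ES n), f (y, ξ) =
    f ((0, ξ) + ContinuousLinearMap.inl ℝ (ES n) (ES n) y) := by
      intro f ξ y; simp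
  have hΨ : ∀ q, ContDiff ℝ ∞ (Ψ q) := by
    intro q
    exact ((hφ.smooth q.1).comp (contDiff_prodMk_left _)).sub
      ((hφ.smooth q.1).comp (contDiff_prodMk_left _))
  have dΨ : ∀ q v y, dLine v (Ψ q) y = dLine ((v, 0) : ES n × ES n) (φ q.1) (y, q.2.1) -
      dLine ((v, 0) : ES n × ES n) (φ q.1) (y, q.2.2) := by
    intro q v y
    have h1 : ∀ ξ, HasFDerivAt (fun y => φ q.1 (y, ξ))
      ((fderiv ℝ (φ q.1) (y, ξ)).comp (ContinuousLinearMap.inl ℝ (ES n) (ES n))) y := fun ξ =>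
      (cd_diff (hφ.smooth q.1) (y, ξ)).hasFDerivAt.comp y (hasFDerivAt_prodMk_left y ξ)
    have h2 := ((h1 q.2.1).sub (h1 q.2.2)).fderiv
    unfold dLine
    erw [h2]
    simp
  let Sw : (ES n × ES n) →L[ℝ] (ES n × ES n) :=
    (ContinuousLinearMap.snd ℝ _ _).prod (ContinuousLinearMap.fst ℝ _ _)
  have hg : ∀ j : Fin n, Sy (fun _ : Q => Set.univ) (0 + (n + 1)) fun q y =>
      (lam q)⁻¹ * dLine (ContinuousLinearMap.id ℝ (ES n) (bv j)) (Ψ q) y := by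
    intro j
    let f : ι → ES n × ES n → ℝ := fun i z => dLine ((bv j, 0) : ES n × ES n) (φ i) (0 + Sw z)
    have hfs : ∀ i, ContDiff ℝ ∞ (f i) := fun i =>
      (contDiff_dLine (hφ.smooth i) _).comp (contDiff_const.add Sw.contDiff)
    have hfv : ∀ v : ES n, Sy (fun _ => Set.univ) (n + 1)
        (fun i => dLine ((v, 0) : ES n × ES n) (f i)) := by
      intro v
      have h1 := ((hφ.mixed (bv j) v).mono hk).affine (fun _ => Set.univ) id (fun _ => 0) Sw
        (by simp)
      convert! h1 using 2 with i
      simp only [f]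
      rw [dLine_affine (contDiff_dLine (hφ.smooth i) _)]
      simp only [id]
      rw [dLine_comm (hφ.smooth i)]
      rfl
    have h2 := diff_Sy (n := n) (Y := ES n) (R := 1) (Prod.fst : Q → ι) lam hlam
      (fun q => {z | z.1 = q.2.1 ∧ z.2.1 = q.2.2})
      (by
        rintro q z ⟨h1, h2⟩
        rw [h1, h2]; simp [lam]) hfs hfv
    have h3 := h2.affine (fun _ : Q => Set.univ) id (fun q => (q.2.1, q.2.2, 0))
      ((ContinuousLinearMap.inr ℝ (ES n) (ES n × ES n)).comp
        (ContinuousLinearMap.inr ℝ (ES n) (ES n))) (by simp)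
    rw [zero_add]
    refine h3.congr fun q y => ?_
    rw [ContinuousLinearMap.id_apply, dΨ]
    simp [f, Sw]
  have hlow : ∀ q : Q, ∀ y ∈ (Set.univ : Set (ES n)), min 1 c0 / (2 * 1 ^ 2) ≤ ((lam q)⁻¹) ^ 2 +
      ∑ j, ((lam q)⁻¹ * dLine (ContinuousLinearMap.id ℝ (ES n) (bv j)) (Ψ q) y) ^ 2 := by
    intro q y _
    simp only [ContinuousLinearMap.id_apply, dΨ, mul_pow, ← Finset.mul_sum]
    exact low_of hφ.pos le_rfl (hlam q) (norm_nonneg (q.2.1 - q.2.2)) (by simp [lam])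
      (hφ.low2 q.1 y q.2.1 q.2.2)
  let c : Q → ES n → ℂ := fun q y => β q.1 (y, q.2.1) * (starRingEnd ℂ) (β q.1 (y, q.2.2))
  have hc : Sy (fun _ : Q => Set.univ) (0 + (n + 1)) c := by
    rw [zero_add]
    exact (hβ.reindex (fun q : Q => (q.1, q.2.1))).mul
      (hβ.reindex (fun q : Q => (q.1, q.2.2))).conj
  have hcs : ∀ q, tsupport (c q) ⊆ Metric.closedBall (κ q.1) R := by
    intro q
    refine closure_minimal ?_ Metric.isClosed_closedBall
    intro y hy
    by_contra h
    rw [Metric.mem_closedBall, dist_eq_norm, not_le] at h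
    apply hy
    simp [c, hR _ _ _ h]
  obtain ⟨c', hc', hsub, hIntgr⟩ := nonstationary (ContinuousLinearMap.id ℝ (ES n))
    (fun _ : Q => Set.univ) Ψ hΨ lam hlam
    (by have := hφ.pos; positivity) hlow (n + 1) hg hc
  obtain ⟨C1, hC10, hC1⟩ := hc'.bound
  obtain ⟨B, hB0, hB⟩ := hβ.bound
  set V : ℝ := (volume (Metric.closedBall (0 : ES n) R)).toReal with hV
  let h : ES n → ℝ := fun x => C1 * V * ((1 + ‖x‖)⁻¹) ^ (n + 1)
  have hhi : Integrable h := (integrable_decay n).const_mul _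
  have hbound : ∀ q : Q, ‖∫ y, osc (Ψ q y) * c q y‖ ≤ h (q.2.1 - q.2.2) := by
    intro q
    have h1 := hIntgr q 0 (by
      simp only [ContinuousLinearMap.id_apply, zero_add]
      exact (isCompact_closedBall (κ q.1) R).of_isClosed_subset (isClosed_tsupport _) (hcs q))
    simp only [ContinuousLinearMap.id_apply, zero_add] at h1
    rw [h1, norm_mul]
    have h2 : ‖∫ y, osc (Ψ q y) * c' q y‖ ≤ C1 * V := by
      have e1 : ∫ y, osc (Ψ q y) * c' q y = ∫ y in Metric.closedBall (κ q.1) R,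
          osc (Ψ q y) * c' q y := by
        symm
        apply setIntegral_eq_integral_of_forall_compl_eq_zero
        intro y hy
        rw [image_eq_zero_of_notMem_tsupport fun h' => hy (hcs q (hsub q h')), mul_zero]
      rw [e1]
      have := norm_setIntegral_le_of_norm_le_const (μ := volume)
        (s := Metric.closedBall (κ q.1) R) (C := C1)
        (f := fun y => osc (Ψ q y) * c' q y) measure_closedBall_lt_top (fun y _ => by
          rw [norm_mul, norm_osc, one_mul]; exact hC1 q y (Set.mem_univ _))
      rwa [Measure.real, Measure.addHaar_closedBall_center] at this
    have h3 : ‖((((lam q)⁻¹) ^ (n + 1) : ℝ) : ℂ)‖ = ((lam q)⁻¹) ^ (n + 1) := by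
      rw [Complex.norm_real, Real.norm_eq_abs, abs_of_nonneg]
      have := hlam q
      positivity
    rw [h3]
    simp only [h]
    rw [mul_comm]
    exact mul_le_mul_of_nonneg_right h2 (by have := hlam q; positivity)
  refine ⟨max 1 (∫ x, h x), by positivity, fun i u hu hu2 => ?_⟩
  obtain ⟨K, hKc, hK0⟩ := hK i
  refine ttstar (p := fun z => osc (φ i z) * β i z) (Y0 := Metric.closedBall (κ i) R) (K := K)
    (B := B) ?_ measure_closedBall_lt_top.ne hKc.measure_lt_top.ne measurableSet_closedBall
    hKc.measurableSet ?_ ?_ ?_ hhi ?_ ?_ (by positivity) (le_max_right _ _) hu hu2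
  · exact (continuous_osc.comp (hφ.smooth i).continuous).measurable.mul (hβm i)
  · rintro ⟨y, ξ⟩
    rw [norm_mul, norm_osc, one_mul]
    exact hB (i, ξ) y (Set.mem_univ _)
  · intro y ξ hy
    rw [Metric.mem_closedBall, dist_eq_norm, not_le] at hy
    simp [hR _ _ _ hy]
  · intro y ξ hξ
    simp [hK0 _ _ hξ]
  · intro x; simp [h]
  · intro ξ ξ'
    have h1 := hbound (i, ξ, ξ')
    refine le_trans (le_of_eq ?_) h1
    congr 2; funext y
    simp only [Ψ, c, map_mul, osc_conj]
    rw [sub_eq_add_neg, osc_add]; ring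

end BaseEst

section OrthKernel

variable {n : ℕ} {ι : Type*}

/-- The two-point amplitude. -/
def amp2 (χ : ES n → ℂ) (b : ι → ES n × ES n → ℂ) (q : ι × ES n × ES n)
    (z : ES n × ES n × ES n) : ℂ :=
  b q.1 (z.1, z.2.2) * χ (z.1 - q.2.1) *
    (starRingEnd ℂ) (b q.1 (z.2.1, z.2.2) * χ (z.2.1 - q.2.2))

theorem orth_kernel {l k : ℕ} (hk : l + (n + 1) ≤ k) {c0 : ℝ} {φ : ι → ES n × ES n → ℝ}
    (hφ : Phase k c0 φ) {b : ι → ES n × ES n → ℂ} (hb : Sy (fun _ => Set.univ) k b)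
    (hK : ∀ i, ∃ K, IsCompact K ∧ ∀ y ξ, ξ ∉ K → b i (y, ξ) = 0)
    {χ : ES n → ℂ} (hχ : ContDiff ℝ ∞ χ) {R : ℝ} (hR : 0 ≤ R) (hχR : ∀ x, R < ‖x‖ → χ x = 0) :
    ∃ c' : (ι × ES n × ES n) → ES n × ES n × ES n → ℂ,
      Sy (fun _ => Set.univ) l c' ∧
      (∀ q z, c' q z ≠ 0 → ‖z.1 - q.2.1‖ ≤ R ∧ ‖z.2.1 - q.2.2‖ ≤ R) ∧
      (∀ q, tsupport (c' q) ⊆ {z | ‖z.1 - q.2.1‖ ≤ R}) ∧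
      (∀ q K, IsCompact K → (∀ y ξ, ξ ∉ K → b q.1 (y, ξ) = 0) →
        tsupport (c' q) ⊆ {z | z.2.2 ∈ K}) ∧
      ∀ (q : ι × ES n × ES n) y y',
        ∫ ξ, osc (φ q.1 (y, ξ) - φ q.1 (y', ξ)) * amp2 χ b q (y, y', ξ) =
          ((((1 + ‖q.2.1 - q.2.2‖)⁻¹) ^ (n + 1) : ℝ) : ℂ) *
          ∫ ξ, osc (φ q.1 (y, ξ) - φ q.1 (y', ξ)) * c' q (y, y', ξ) := by
  let Q := ι × ES n × ES n
  let P1 : (ES n × ES n × ES n) →L[ℝ] ES n × ES n :=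
    (ContinuousLinearMap.fst ℝ _ _).prod ((ContinuousLinearMap.snd ℝ _ _).comp
      (ContinuousLinearMap.snd ℝ _ _))
  let P2 : (ES n × ES n × ES n) →L[ℝ] ES n × ES n := ContinuousLinearMap.snd ℝ _ _
  let L : ES n →L[ℝ] (ES n × ES n × ES n) := (ContinuousLinearMap.inr ℝ (ES n) (ES n × ES n)).comp
        (ContinuousLinearMap.inr ℝ (ES n) (ES n))
  let s : Q → Set (ES n × ES n × ES n) := fun q => {z | ‖z.1 - q.2.1‖ ≤ R ∧ ‖z.2.1 - q.2.2‖ ≤ R}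
  have hsc : ∀ q, IsClosed (s q) := fun q => by
    have h1 : IsClosed {z : ES n × ES n × ES n | ‖z.1 - q.2.1‖ ≤ R} :=
      isClosed_le (by fun_prop) continuous_const
    have h2 : IsClosed {z : ES n × ES n × ES n | ‖z.2.1 - q.2.2‖ ≤ R} :=
      isClosed_le (by fun_prop) continuous_const
    exact h1.inter h2
  let Ψ : Q → (ES n × ES n × ES n) → ℝ := fun q z => φ q.1 (0 + P1 z) - φ q.1 (0 + P2 z)
  let lam : Q → ℝ := fun q => 1 + ‖q.2.1 - q.2.2‖
  have hlam : ∀ q, 1 ≤ lam q := fun q => by simp [lam]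
  have hs1 : ∀ i : Q, ∀ z : (ES n × ES n × ES n), z ∈ s i → ‖z.1 - z.2.1‖ ≤ 2 * R + ‖i.2.1 - i.2.2‖ := by
    rintro q z ⟨h1, h2⟩
    have : z.1 - z.2.1 = (z.1 - q.2.1) - (z.2.1 - q.2.2) + (q.2.1 - q.2.2) := by abel
    rw [this]
    refine (norm_add_le _ _).trans ?_
    have := norm_sub_le (z.1 - q.2.1) (z.2.1 - q.2.2)
    linarith
  have hs2 : ∀ i : Q, ∀ z : (ES n × ES n × ES n), z ∈ s i → ‖i.2.1 - i.2.2‖ ≤ 2 * R + ‖z.1 - z.2.1‖ := by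
    rintro q z ⟨h1, h2⟩
    have : q.2.1 - q.2.2 = (z.1 - z.2.1) - ((z.1 - q.2.1) - (z.2.1 - q.2.2)) := by abel
    rw [this]
    refine (norm_sub_le _ _).trans ?_
    have := norm_sub_le (z.1 - q.2.1) (z.2.1 - q.2.2)
    linarith
  have hΨ : ∀ q, ContDiff ℝ ∞ (Ψ q) := fun q =>
    ((hφ.smooth q.1).comp (contDiff_const.add P1.contDiff)).sub
      ((hφ.smooth q.1).comp (contDiff_const.add P2.contDiff))
  have dΨ : ∀ q j z, dLine (L (bv j)) (Ψ q) z =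
      dLine ((0, bv j) : ES n × ES n) (φ q.1) (z.1, z.2.2) -
      dLine ((0, bv j) : ES n × ES n) (φ q.1) (z.2.1, z.2.2) := by
    intro q j z
    have h1 : ∀ P : (ES n × ES n × ES n) →L[ℝ] ES n × ES n, HasFDerivAt (fun z => φ q.1 (0 + P z))
        ((fderiv ℝ (φ q.1) (0 + P z)).comp P) z := fun P =>
      (cd_diff (hφ.smooth q.1) (0 + P z)).hasFDerivAt.comp z (P.hasFDerivAt.const_add 0)
    have h2 := ((h1 P1).sub (h1 P2)).fderiv
    unfold dLine
    erw [h2]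
    simp [P1, P2, L]
  have hg : ∀ j : Fin n, Sy s (l + (n + 1)) fun q z => (lam q)⁻¹ * dLine (L (bv j)) (Ψ q) z := by
    intro j
    have h2 := diff_Sy (n := n) (Y := ES n) (R := 2 * R + 1) (Prod.fst : Q → ι) lam hlam s
      (by
        intro q z hz
        refine (hs1 q z hz).trans ?_
        simp only [lam]
        nlinarith [norm_nonneg (q.2.1 - q.2.2)])
      (f := fun i => dLine ((0, bv j) : ES n × ES n) (φ i))
      (fun i => contDiff_dLine (hφ.smooth i) _) (fun v => (hφ.mixed v (bv j)).mono hk)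
    refine h2.congr fun q z => ?_
    rw [dΨ]
  have hlow : ∀ q : Q, ∀ z ∈ s q, min 1 c0 / (2 * (2 * R + 1) ^ 2) ≤ ((lam q)⁻¹) ^ 2 +
      ∑ j, ((lam q)⁻¹ * dLine (L (bv j)) (Ψ q) z) ^ 2 := by
    intro q z hz
    simp only [dΨ, mul_pow, ← Finset.mul_sum]
    refine low_of hφ.pos (by linarith) (hlam q) (norm_nonneg (z.1 - z.2.1)) ?_
      (hφ.low1 q.1 z.1 z.2.1 z.2.2)
    have := hs2 q z hz
    simp only [lam]
    nlinarith [norm_nonneg (z.1 - z.2.1)]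
  have hχc : HasCompactSupport χ := HasCompactSupport.of_support_subset_isCompact
    (isCompact_closedBall (0 : ES n) R) (fun x hx => by
      rw [mem_closedBall_zero_iff]; by_contra h; exact hx (hχR x (not_le.1 h)))
  have hc : Sy s (l + (n + 1)) (amp2 χ b) := by
    have h1 := (hb.mono hk).affine s (Prod.fst : Q → ι) (fun _ => 0) P1 (by simp)
    have h2 := (hb.mono hk).affine s (Prod.fst : Q → ι) (fun _ => 0) P2 (by simp)
    have hX := Sy.of_compact (ι := Unit) (fun _ => Set.univ) (l + (n + 1)) hχ hχc
    have h3 := hX.affine s (fun _ => ()) (fun q : Q => -q.2.1) (ContinuousLinearMap.fst ℝ _ _) (by simp)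
    have h4 := hX.affine s (fun _ => ()) (fun q : Q => -q.2.2) ((ContinuousLinearMap.fst ℝ (ES n) (ES n)).comp P2) (by simp)
    refine ((h1.mul h3).mul (h2.mul h4).conj).congr fun q z => ?_
    simp [amp2, P1, P2, sub_eq_neg_add]
  have hcs : ∀ q, tsupport (amp2 χ b q) ⊆ s q := by
    intro q
    refine closure_minimal ?_ (hsc q)
    intro z hz
    by_contra h
    apply hz
    simp only [s, Set.mem_setOf_eq, not_and_or, not_le] at h
    rcases h with h | h
    · simp [amp2, hχR _ h]
    · simp [amp2, hχR _ h]
  have hcK : ∀ (q : Q) K, IsCompact K → (∀ y ξ, ξ ∉ K → b q.1 (y, ξ) = 0) →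
        tsupport (amp2 χ b q) ⊆ {z | z.2.2 ∈ K} := by
    intro q K hKc h
    refine closure_minimal ?_ (hKc.isClosed.preimage (by fun_prop))
    intro z hz
    by_contra h'
    apply hz
    simp [amp2, h _ _ h']
  obtain ⟨c', hc', hsub, hIntgr⟩ := nonstationary L s Ψ hΨ lam hlam
    (by have := hφ.pos; positivity) hlow (n + 1) hg hc
  refine ⟨c', hc'.extend fun q => (hsub q).trans (hcs q), fun q z hz =>
    hcs q (hsub q (subset_tsupport _ hz)), fun q z hz => (hcs q (hsub q hz)).1,
    fun q K h1 h2 => (hsub q).trans (hcK q K h1 h2), fun q y y' => ?_⟩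
  obtain ⟨K, hKc, hK0⟩ := hK q.1
  have h1 := hIntgr q (y, y', 0) (by
    refine hKc.of_isClosed_subset ((isClosed_tsupport _).preimage (by fun_prop)) fun ξ hξ => ?_
    have := hcK q K hKc hK0 hξ
    simpa [L] using this)
  simpa [L, Ψ, P1, P2, lam] using h1

end OrthKernel

section OrthEst

variable {n : ℕ} {ι : Type*}

theorem double_bound {X Y : Type*} [MeasureSpace X] [MeasureSpace Y]
    [SFinite (volume : Measure X)] [SFinite (volume : Measure Y)]
    {f : X × Y → ℂ} (hf : AEStronglyMeasurable f (volume.prod volume))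
    {B : Set X} (hB : MeasurableSet B) (hBf : volume B ≠ ⊤) (h0 : ∀ s, s ∉ B → ∀ ξ, f (s, ξ) = 0)
    {M : ℝ} (hM : 0 ≤ M)
    (hd : ∀ s, ∃ g : Y → ℝ, Integrable g ∧ (∀ ξ, ‖f (s, ξ)‖ ≤ g ξ) ∧ ∫ ξ, g ξ ≤ M) :
    ‖∫ ξ, ∫ s, f (s, ξ)‖ ≤ M * (volume B).toReal := by
  have h1 : ‖∫ ξ, ∫ s, f (s, ξ)‖ₑ ≤ ENNReal.ofReal M * volume B := by
    calc ‖∫ ξ, ∫ s, f (s, ξ)‖ₑ ≤ ∫⁻ ξ, ‖∫ s, f (s, ξ)‖ₑ := enorm_integral_le_lintegral_enorm _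
      _ ≤ ∫⁻ ξ, ∫⁻ s, ‖f (s, ξ)‖ₑ := lintegral_mono fun ξ => enorm_integral_le_lintegral_enorm _
      _ = ∫⁻ s, ∫⁻ ξ, ‖f (s, ξ)‖ₑ := by
          rw [lintegral_lintegral_swap]
          exact hf.prod_swap.enorm
      _ ≤ ∫⁻ s, B.indicator (fun _ => ENNReal.ofReal M) s := by
          refine lintegral_mono fun s => ?_
          by_cases hs : s ∈ B
          · simp only [hs, Set.indicator_of_mem]
            obtain ⟨g, hg, hfg, hgM⟩ := hd s
            calc ∫⁻ ξ, ‖f (s, ξ)‖ₑ ≤ ∫⁻ ξ, ENNReal.ofReal (g ξ) := by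
                  refine lintegral_mono fun ξ => ?_
                  rw [← ofReal_norm_eq_enorm]
                  exact ENNReal.ofReal_le_ofReal (hfg ξ)
              _ = ENNReal.ofReal (∫ ξ, g ξ) := by
                  rw [ofReal_integral_eq_lintegral_ofReal hg
                    (ae_of_all _ fun ξ => (norm_nonneg _).trans (hfg ξ))]
              _ ≤ _ := ENNReal.ofReal_le_ofReal hgM
          · simp [h0 s hs, hs]
      _ = _ := by rw [lintegral_indicator_const hB]
  have h2 : ENNReal.ofReal M * volume B ≠ ⊤ := ENNReal.mul_ne_top ENNReal.ofReal_ne_top hBf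
  have h3 := ENNReal.toReal_mono h2 h1
  rwa [toReal_enorm, ENNReal.toReal_mul, ENNReal.toReal_ofReal hM] at h3

theorem int3 {K : Set (ES n)} (hKm : MeasurableSet K) (hKf : volume K ≠ ⊤)
    {g : ES n × ES n × ES n → ℂ} (hg : Measurable g) {B : ℝ} (hB : ∀ z, ‖g z‖ ≤ B)
    (hgK : ∀ ξ p, ξ ∉ K → g (ξ, p) = 0) {u u' : ES n → ℂ} (hu : Integrable u)
    (hu' : Integrable u') :
    Integrable (fun z : ES n × ES n × ES n => g z * (u z.2.1 * u' z.2.2))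
      (volume.prod volume) := by
  have hKi : Integrable (K.indicator fun _ => B) :=
    (integrable_indicator_iff hKm).2 (by simp [hKf.lt_top])
  have h1 : Integrable (fun p : ES n × ES n => u p.1 * u' p.2) volume := hu.mul_prod hu'
  refine (hKi.mul_prod h1.norm).mono' (hg.aestronglyMeasurable.mul h1.1.comp_snd)
    (ae_of_all _ ?_)
  rintro ⟨ξ, p⟩
  by_cases hξ : ξ ∈ K
  · simp only [norm_mul, hξ, Set.indicator_of_mem]
    exact mul_le_mul_of_nonneg_right (hB _) (by positivity)
  · simp [hgK ξ p hξ, hξ]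

/-- The localized operator. -/
def Floc (χ : ES n → ℂ) (φ : ES n × ES n → ℝ) (b : ES n × ES n → ℂ) (κ : ES n) (u : ES n → ℂ)
    (ξ : ES n) : ℂ := ∫ y, osc (φ (y, ξ)) * (b (y, ξ) * χ (y - κ)) * u y

set_option maxHeartbeats 2000000 in
theorem orth_est {k : ℕ} (hk : 3 * n + 2 ≤ k) {c0 : ℝ} {φ : ι → ES n × ES n → ℝ}
    (hφ : Phase k c0 φ) {b : ι → ES n × ES n → ℂ} (hb : Sy (fun _ => Set.univ) k b)
    (hK : ∀ i, ∃ K, IsCompact K ∧ ∀ y ξ, ξ ∉ K → b i (y, ξ) = 0)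
    {χ : ES n → ℂ} (hχ : ContDiff ℝ ∞ χ) {R : ℝ} (hR : 0 < R) (hχR : ∀ x, R < ‖x‖ → χ x = 0) :
    ∃ C, 0 < C ∧ ∀ i κ κ' (u u' : ES n → ℂ), Integrable u → (Integrable fun y => ‖u y‖ ^ 2) →
      Integrable u' → (Integrable fun y => ‖u' y‖ ^ 2) →
      ‖∫ ξ, Floc χ (φ i) (b i) κ u ξ * (starRingEnd ℂ) (Floc χ (φ i) (b i) κ' u' ξ)‖ ≤
        C * ((1 + ‖κ - κ'‖)⁻¹) ^ (n + 1) * ((∫ y, ‖u y‖ ^ 2) + ∫ y, ‖u' y‖ ^ 2) := by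
  obtain ⟨c', hc', hcsup, hcs1, hcsK, hIntgr⟩ := orth_kernel (l := 2 * n + 1) (by omega) hφ hb hK hχ hR.le hχR
  let D : (ι × ES n × ES n) → ES n × ES n × ES n → ℂ := fun q => dList (dirs1 n (ES n × ES n)) (c' q)
  have hD : Sy (fun _ => Set.univ) (n + 1) D := by
    refine Sy.dList _ (hc'.mono ?_)
    simp [dirs1]; omega
  have hDs : ∀ q, tsupport (D q) ⊆ tsupport (c' q) := fun q => tsupport_dList _ _
  -- bump equal to one on the ball
  let ch : ContDiffBump (0 : ES n) := ⟨R, R + 1, hR, by linarith⟩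
  have hch1 : ∀ x : ES n, ‖x‖ ≤ R → ch x = 1 := fun x hx =>
    ch.one_of_mem_closedBall (by simpa [ch] using hx)
  have hch0 : ∀ x : ES n, R + 1 < ‖x‖ → ch x = 0 := fun x hx => ch.zero_of_le_dist (by
    simpa [ch] using hx.le)
  let β1 : (ι × ES n × {K : Set (ES n) // IsCompact K}) → ES n × ES n → ℂ := fun q z => ((ch (z.1 - q.2.1) : ℝ) : ℂ) *
    (q.2.2.1.indicator (fun _ => (1 : ℂ)) z.2)
  have hβmOne : ∀ q, Measurable (β1 q) := by
    intro q
    refine Measurable.mul ?_ ?_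
    · exact (Complex.continuous_ofReal.comp (ch.continuous.comp (by fun_prop))).measurable
    · exact (measurable_const.indicator q.2.2.2.measurableSet).comp measurable_snd
  have hβ1 : Sy (fun _ : (ι × ES n × {K : Set (ES n) // IsCompact K}) × ES n => Set.univ) (n + 1) (fun q y => β1 q.1 (y, q.2)) := by
    have h1 := Sy.of_compact (ι := Unit) (fun _ => Set.univ) (n + 1) (f := fun x => ch x) ch.contDiff ch.hasCompactSupport
    have h2 := (h1.affine (fun _ : (ι × ES n × {K : Set (ES n) // IsCompact K}) × ES n => Set.univ) (fun _ => ()) (fun q => - q.1.2.1)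
      (ContinuousLinearMap.id ℝ _) (by simp)).ofReal
    have h3 := Sy.const (W := ES n) (s := fun _ : (ι × ES n × {K : Set (ES n) // IsCompact K}) × ES n => Set.univ) (n + 1) (F := ℂ)
      (c := fun q => q.1.2.2.1.indicator (fun _ => (1 : ℂ)) q.2) (C := 1) (by
        intro q
        by_cases h : q.2 ∈ q.1.2.2.1 <;> simp [h])
    refine (h2.mul h3).congr fun q y => ?_
    simp [β1, sub_eq_neg_add]
  obtain ⟨C1, hC1, hB1⟩ := base_est (k := k) (by omega) (hφ.reindex (Prod.fst : (ι × ES n × {K : Set (ES n) // IsCompact K}) → ι)) hβmOne hβ1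
    (fun q => q.2.1) (R + 1) (by intro q y ξ h; simp [β1, hch0 _ h])
    (by intro q; exact ⟨q.2.2.1, q.2.2.2, fun y ξ h => by simp [β1, h]⟩)
  let β2 : ((ι × ES n × ES n) × ES n) → ES n × ES n → ℂ := fun q z => (starRingEnd ℂ) (D q.1 (q.2, z))
  have hβmTwo : ∀ q, Measurable (β2 q) := fun q =>
    (Complex.continuous_conj.comp ((hD.smooth q.1).continuous.comp (by fun_prop))).measurable
  have hβ2 : Sy (fun _ : ((ι × ES n × ES n) × ES n) × ES n => Set.univ) (n + 1) (fun q y => β2 q.1 (y, q.2)) := by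
    have h1 := (hD.affine (fun _ : ((ι × ES n × ES n) × ES n) × ES n => Set.univ) (fun q => q.1.1)
      (fun q => (q.1.2, 0, q.2)) ((ContinuousLinearMap.inr ℝ (ES n) (ES n × ES n)).comp
        (ContinuousLinearMap.inl ℝ (ES n) (ES n))) (by simp)).conj
    refine h1.congr fun q y => ?_
    simp [β2]
  have hD0 : ∀ q z, D q z ≠ 0 → z ∈ tsupport (c' q) := fun q z h => hDs q (subset_tsupport _ h)
  have hDy' : ∀ (q : (ι × ES n × ES n)) z, R < ‖z.2.1 - q.2.2‖ → D q z = 0 := by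
    intro q z h
    by_contra h'
    have h1 : tsupport (c' q) ⊆ {z | ‖z.2.1 - q.2.2‖ ≤ R} := closure_minimal
      (fun z hz => (hcsup q z hz).2) (isClosed_le (by fun_prop) continuous_const)
    exact absurd (h1 (hD0 q z h')) (not_le.2 h)
  have hDs0 : ∀ (q : (ι × ES n × ES n)) z, R < ‖z.1 - q.2.1‖ → D q z = 0 := by
    intro q z h
    by_contra h'
    exact absurd (hcs1 q (hD0 q z h')) (not_le.2 h)
  have hDK : ∀ (q : (ι × ES n × ES n)) K, IsCompact K → (∀ y ξ, ξ ∉ K → b q.1 (y, ξ) = 0) →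
      ∀ z, z.2.2 ∉ K → D q z = 0 := by
    intro q K h1 h2 z h
    by_contra h'
    exact h (hcsK q K h1 h2 (hD0 q z h'))
  obtain ⟨C2, hC2, hB2⟩ := base_est (k := k) (by omega) (hφ.reindex (fun q : ((ι × ES n × ES n) × ES n) => q.1.1)) hβmTwo hβ2
    (fun q => q.1.2.2) R (by intro q y ξ h; simp [β2, hDy' q.1 (q.2, y, ξ) h])
    (by
      intro q
      obtain ⟨K, hKc, h⟩ := hK q.1.1
      exact ⟨K, hKc, fun y ξ h' => by simp [β2, hDK q.1 K hKc h (q.2, y, ξ) h']⟩)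
  set V : ℝ := (volume (Metric.closedBall (0 : ES n) R)).toReal with hV
  have hV0 : 0 ≤ V := ENNReal.toReal_nonneg
  refine ⟨(C1 + C2) * (V + 1), by positivity, fun i κ κ' u u' hu hu2 hu' hu2' => ?_⟩
  let q : ι × ES n × ES n := (i, κ, κ')
  obtain ⟨K, hKc, hK0⟩ := hK i
  have hphc := (hφ.smooth i).continuous
  let ph : ES n × ES n × ES n → ℂ := fun z => osc (φ i (z.2.1, z.1) - φ i (z.2.2, z.1))
  have hph : Continuous ph := continuous_osc.comp (by fun_prop)
  let g1 : ES n × ES n × ES n → ℂ := fun z => ph z * amp2 χ b q (z.2.1, z.2.2, z.1)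
  let g2 : ES n × ES n × ES n → ℂ := fun z => ph z * c' q (z.2.1, z.2.2, z.1)
  let ub : ES n → ℂ := fun y => (starRingEnd ℂ) (u' y)
  have hub : Integrable ub := Complex.conjCLE.toContinuousLinearMap.integrable_comp hu'
  obtain ⟨Bb, hBb0, hBb⟩ := hb.bound
  have hχc : HasCompactSupport χ := HasCompactSupport.of_support_subset_isCompact
    (isCompact_closedBall (0 : ES n) R) (fun x hx => by
      rw [mem_closedBall_zero_iff]; by_contra h; exact hx (hχR x (not_le.1 h)))
  obtain ⟨Bχ, hBχ⟩ := hχc.exists_bound_of_continuous hχ.continuous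
  have hBχ0 : 0 ≤ Bχ := (norm_nonneg _).trans (hBχ 0)
  obtain ⟨Bc, hBc0, hBc⟩ := hc'.bound
  obtain ⟨BD, hBD0, hBD⟩ := hD.bound
  obtain ⟨B1, hB10, hB1'⟩ := hβ1.bound
  have hbc := (hb.smooth i).continuous
  have hχcc := hχ.continuous
  have hg1 : Integrable (fun z : ES n × ES n × ES n => g1 z * (u z.2.1 * ub z.2.2))
      (volume.prod volume) := by
    refine int3 hKc.measurableSet hKc.measure_lt_top.ne (B := Bb * Bχ * (Bb * Bχ)) ?_ ?_ ?_ hu hub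
    · refine (hph.mul ?_).measurable
      simp only [amp2, q]
      refine Continuous.mul (by fun_prop) (Complex.continuous_conj.comp (by fun_prop))
    · intro z
      simp only [g1, ph, amp2, norm_mul, norm_osc, one_mul, RCLike.norm_conj]
      gcongr <;> first | exact hBb _ _ (Set.mem_univ _) | exact hBχ _
    · intro ξ p hξ
      simp [g1, amp2, q, hK0 _ _ hξ]
  have hc'c := (hc'.smooth q).continuous
  have hc'K : ∀ z, z.2.2 ∉ K → c' q z = 0 := by
    intro z h
    by_contra h'
    exact h (hcsK q K hKc hK0 (subset_tsupport _ h'))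
  have hg2 : Integrable (fun z : ES n × ES n × ES n => g2 z * (u z.2.1 * ub z.2.2))
      (volume.prod volume) := by
    refine int3 hKc.measurableSet hKc.measure_lt_top.ne (B := Bc) ?_ ?_ ?_ hu hub
    · exact (hph.mul (by fun_prop)).measurable
    · intro z
      simp only [g2, ph, norm_mul, norm_osc, one_mul]
      exact hBc _ _ (Set.mem_univ _)
    · intro ξ p hξ
      simp [g2, hc'K (p.1, p.2, ξ) hξ]
  let w : ℝ := ((1 + ‖κ - κ'‖)⁻¹) ^ (n + 1)
  have hw : 0 ≤ w := by positivity
  have step1 : ∀ ξ, Floc χ (φ i) (b i) κ u ξ * (starRingEnd ℂ) (Floc χ (φ i) (b i) κ' u' ξ) =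
      ∫ p : ES n × ES n, g1 (ξ, p) * (u p.1 * ub p.2) := by
    intro ξ
    unfold Floc
    rw [← integral_conj, ← integral_prod_mul]
    refine integral_congr_ae (ae_of_all _ fun p => ?_)
    simp only [g1, ph, amp2, q, ub, map_mul, osc_conj, sub_eq_add_neg, osc_add]
    ring
  have step2 : ∫ ξ, ∫ p : ES n × ES n, g1 (ξ, p) * (u p.1 * ub p.2) =
      (w : ℂ) * ∫ ξ, ∫ p : ES n × ES n, g2 (ξ, p) * (u p.1 * ub p.2) := by
    have w1 := integral_integral_swap (f := fun ξ (p : ES n × ES n) => g1 (ξ, p) * (u p.1 * ub p.2)) hg1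
    have w2 := integral_integral_swap (f := fun ξ (p : ES n × ES n) => g2 (ξ, p) * (u p.1 * ub p.2)) hg2
    rw [w1, w2, ← integral_const_mul]
    refine integral_congr_ae (ae_of_all _ fun p => ?_)
    simp only
    rw [integral_mul_const, integral_mul_const, ← mul_assoc (w : ℂ)]
    congr 1
    exact hIntgr q p.1 p.2
  let j1 : ι × ES n × {K : Set (ES n) // IsCompact K} := (i, κ, ⟨K, hKc⟩)
  let F1 : ES n → ES n → ℂ := fun s ξ => ∫ y, osc (φ i (y, ξ)) * β1 j1 (y, ξ) * (orth s y * u y)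
  let F2 : ES n → ES n → ℂ := fun s ξ => ∫ y, osc (φ i (y, ξ)) * β2 (q, s) (y, ξ) * u' y
  have hDc := (hD.smooth q).continuous
  have hbm : MeasurableSet (Metric.closedBall κ R) := measurableSet_closedBall
  have step3 : ∀ ξ, ∫ p : ES n × ES n, g2 (ξ, p) * (u p.1 * ub p.2) =
      ∫ s, F1 s ξ * (starRingEnd ℂ) (F2 s ξ) := by
    intro ξ
    let G : ES n × ES n × ES n → ℂ := fun z => ph (ξ, z.2) * β1 j1 (z.2.1, ξ) * orth z.1 z.2.1 *
      D q (z.1, z.2.2, ξ)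
    have hG : Integrable (fun z : ES n × ES n × ES n => G z * (u z.2.1 * ub z.2.2))
        (volume.prod volume) := by
      refine int3 hbm measure_closedBall_lt_top.ne (B := 1 * B1 * 1 * BD) ?_ ?_ ?_ hu hub
      · have m1 : Measurable fun z : ES n × ES n × ES n => ph (ξ, z.2) :=
          (hph.comp (by fun_prop)).measurable
        have m2 : Measurable fun z : ES n × ES n × ES n => β1 j1 (z.2.1, ξ) :=
          (hβmOne j1).comp (by fun_prop)
        have m3 : Measurable fun z : ES n × ES n × ES n => orth z.1 z.2.1 :=
          measurable_orth.comp (g := fun p : ES n × ES n => orth p.1 p.2)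
            (f := fun z : ES n × ES n × ES n => (z.1, z.2.1)) (by fun_prop)
        have m4 : Measurable fun z : ES n × ES n × ES n => D q (z.1, z.2.2, ξ) :=
          (hDc.comp (by fun_prop)).measurable
        exact ((m1.mul m2).mul m3).mul m4
      · intro z
        simp only [G, norm_mul]
        gcongr
        · simp only [ph, norm_osc, le_refl]
        · exact hB1' (j1, ξ) _ (Set.mem_univ _)
        · exact norm_orth_le _ _
        · exact hBD _ _ (Set.mem_univ _)
      · intro s p hs
        rw [Metric.mem_closedBall, dist_eq_norm, not_le] at hs
        simp [G, hDs0 q (s, p.2, ξ) hs]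
    have e1 : ∀ s, F1 s ξ * (starRingEnd ℂ) (F2 s ξ) =
        ∫ p : ES n × ES n, G (s, p) * (u p.1 * ub p.2) := by
      intro s
      simp only [F1, F2]
      rw [← integral_conj, ← integral_prod_mul]
      refine integral_congr_ae (ae_of_all _ fun p => ?_)
      simp only [G, ph, β2, ub, map_mul, osc_conj, sub_eq_add_neg, osc_add, Complex.conj_conj]
      ring
    simp_rw [e1]
    rw [integral_integral_swap (f := fun s (p : ES n × ES n) => G (s, p) * (u p.1 * ub p.2)) hG]
    refine integral_congr_ae (ae_of_all _ fun p => ?_)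
    simp only
    rw [integral_mul_const]
    congr 1
    have e2 := ftc (hc'.smooth q) (isCompact_closedBall κ R) (fun z v hz => by
      by_contra h'
      exact hz (by rw [Metric.mem_closedBall, dist_eq_norm]; exact (hcsup q _ h').1)) p.1 (p.2, ξ)
    have e3 : c' q (p.1, p.2, ξ) = β1 j1 (p.1, ξ) * c' q (p.1, p.2, ξ) := by
      by_cases h0 : c' q (p.1, p.2, ξ) = 0
      · simp [h0]
      · have hξ : ξ ∈ K := by
          by_contra h'
          exact h0 (hc'K (p.1, p.2, ξ) h')
        have h5 : ch (p.1 - κ) = 1 := hch1 _ (hcsup q _ h0).1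
        simp [β1, j1, h5, hξ]
    simp only [g2, G]
    rw [e3, e2, ← mul_assoc, ← integral_const_mul]
    refine integral_congr_ae (ae_of_all _ fun s => ?_)
    simp only [D]
    ring
  have hou : ∀ s, Integrable fun y => orth s y * u y := by
    intro s
    have m3 : Measurable fun y : ES n => orth s y :=
      measurable_orth.comp (g := fun p : ES n × ES n => orth p.1 p.2)
        (f := fun y : ES n => (s, y)) (by fun_prop)
    refine hu.bdd_mul (c := 1) m3.aestronglyMeasurable
      (ae_of_all _ fun y => norm_orth_le s y)
  have hou1 : ∀ s y, ‖orth s y * u y‖ ^ 2 ≤ ‖u y‖ ^ 2 := by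
    intro s y
    rw [norm_mul]
    refine pow_le_pow_left₀ (by positivity) ?_ 2
    exact mul_le_of_le_one_left (norm_nonneg _) (norm_orth_le s y)
  have hou2 : ∀ s, Integrable fun y => ‖orth s y * u y‖ ^ 2 := by
    intro s
    refine hu2.mono' ((hou s).1.norm.pow 2) (ae_of_all _ fun y => ?_)
    rw [Real.norm_eq_abs, abs_of_nonneg (by positivity)]
    exact hou1 s y
  have hF1 := fun s => hB1 j1 (fun y => orth s y * u y) (hou s) (hou2 s)
  have hF2 := fun s => hB2 (q, s) u' hu' hu2'
  simp_rw [step1]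
  rw [step2, norm_mul, Complex.norm_real, Real.norm_eq_abs, abs_of_nonneg hw]
  simp_rw [step3]
  have hF1m : AEStronglyMeasurable (fun z : ES n × ES n => F1 z.1 z.2) (volume.prod volume) := by
    have h1 : AEStronglyMeasurable (fun z : (ES n × ES n) × ES n =>
        osc (φ i (z.2, z.1.2)) * β1 j1 (z.2, z.1.2) * (orth z.1.1 z.2 * u z.2))
        ((volume.prod volume).prod volume) := by
      refine AEStronglyMeasurable.mul ?_ (AEStronglyMeasurable.mul ?_ hu.1.comp_snd)
      · refine Measurable.aestronglyMeasurable (Measurable.mul ?_ ((hβmOne j1).comp (by fun_prop)))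
        exact (continuous_osc.comp (by fun_prop)).measurable
      · exact (measurable_orth.comp (g := fun p : ES n × ES n => orth p.1 p.2)
          (f := fun z : (ES n × ES n) × ES n => (z.1.1, z.2)) (by fun_prop)).aestronglyMeasurable
    exact h1.integral_prod_right'
  have hF2m : AEStronglyMeasurable (fun z : ES n × ES n => F2 z.1 z.2) (volume.prod volume) := by
    have h1 : AEStronglyMeasurable (fun z : (ES n × ES n) × ES n =>
        osc (φ i (z.2, z.1.2)) * β2 (q, z.1.1) (z.2, z.1.2) * u' z.2)
        ((volume.prod volume).prod volume) := by
      refine AEStronglyMeasurable.mul ?_ hu'.1.comp_snd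
      refine Measurable.aestronglyMeasurable (Measurable.mul ?_ ?_)
      · exact (continuous_osc.comp (by fun_prop)).measurable
      · have m4 : Continuous fun z : (ES n × ES n) × ES n => D q (z.1.1, z.2, z.1.2) :=
          hDc.comp (by fun_prop)
        exact (Complex.continuous_conj.comp m4).measurable
    exact h1.integral_prod_right'
  have hI0 : 0 ≤ ∫ y, ‖u y‖ ^ 2 := integral_nonneg fun _ => by positivity
  have hI0' : 0 ≤ ∫ y, ‖u' y‖ ^ 2 := integral_nonneg fun _ => by positivity
  have hM0 : 0 ≤ (C1 + C2) * ((∫ y, ‖u y‖ ^ 2) + ∫ y, ‖u' y‖ ^ 2) := by positivity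
  have key := double_bound (f := fun z : ES n × ES n => F1 z.1 z.2 * (starRingEnd ℂ) (F2 z.1 z.2))
    (hF1m.mul (Complex.continuous_conj.comp_aestronglyMeasurable hF2m)) hbm
    measure_closedBall_lt_top.ne (by
      intro s hs ξ
      rw [Metric.mem_closedBall, dist_eq_norm, not_le] at hs
      have : F2 s ξ = 0 := by
        simp only [F2, β2]
        simp [fun y => hDs0 q (s, y, ξ) hs]
      simp [this]) hM0 (by
      intro s
      refine ⟨fun ξ => ‖F1 s ξ‖ ^ 2 + ‖F2 s ξ‖ ^ 2, (hF1 s).1.add (hF2 s).1, fun ξ => ?_, ?_⟩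
      · simp only [norm_mul, RCLike.norm_conj]
        nlinarith [sq_nonneg (‖F1 s ξ‖ - ‖F2 s ξ‖), sq_nonneg (‖F1 s ξ‖), sq_nonneg (‖F2 s ξ‖)]
      · rw [integral_add (hF1 s).1 (hF2 s).1]
        have a1 := (hF1 s).2
        have a2 := (hF2 s).2
        have a3 : ∫ y, ‖orth s y * u y‖ ^ 2 ≤ ∫ y, ‖u y‖ ^ 2 :=
          integral_mono (hou2 s) hu2 (hou1 s)
        have a4 : C1 * ∫ y, ‖orth s y * u y‖ ^ 2 ≤ C1 * ∫ y, ‖u y‖ ^ 2 :=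
          mul_le_mul_of_nonneg_left a3 hC1.le
        refine (add_le_add (a1.trans a4) a2).trans ?_
        nlinarith)
  rw [Measure.addHaar_closedBall_center] at key
  refine (mul_le_mul_of_nonneg_left key hw).trans ?_
  rw [← hV]
  have : (C1 + C2) * ((∫ y, ‖u y‖ ^ 2) + ∫ y, ‖u' y‖ ^ 2) * V ≤
    (C1 + C2) * ((∫ y, ‖u y‖ ^ 2) + ∫ y, ‖u' y‖ ^ 2) * (V + 1) :=
    mul_le_mul_of_nonneg_left (by linarith) hM0
  refine (mul_le_mul_of_nonneg_left this hw).trans (le_of_eq ?_)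
  simp only [w]
  ring

end OrthEst

section LemmaA

variable {n : ℕ} {ι : Type*}

theorem shear_int {A : Type*} [RCLike A] {f g : ES n → A} (hf : Integrable f) (hg : Integrable g) :
    Integrable (fun p : ES n × ES n => f (p.1 - p.2) * g p.2) (volume.prod volume) :=
  (measurePreserving_sub_prod (volume : Measure (ES n)) volume).integrable_comp_of_integrable
    (hf.mul_prod hg)

theorem shear_eq {A : Type*} [RCLike A] {f g : ES n → A} (hf : Integrable f) (hg : Integrable g) :
    ∫ p : ES n × ES n, f (p.1 - p.2) * g p.2 ∂(volume.prod volume) = (∫ x, f x) * ∫ x, g x := by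
  rw [integral_prod_symm _ (shear_int hf hg)]
  simp only [integral_mul_const, integral_sub_right_eq_self (fun x => f x)]
  rw [integral_const_mul]

theorem exists_chi (n : ℕ) : ∃ χ : ES n → ℝ, ContDiff ℝ ∞ χ ∧ (∀ x, 2 < ‖x‖ → χ x = 0) ∧
    ∫ x, χ x ^ 2 = 1 := by
  let ch : ContDiffBump (0 : ES n) := ⟨1, 2, by norm_num, by norm_num⟩
  have hi : Integrable fun x => ch x ^ 2 := by
    refine Continuous.integrable_of_hasCompactSupport (ch.continuous.pow 2) ?_
    exact ch.hasCompactSupport.mono (fun x hx => by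
      intro h
      apply hx
      simp [h])
  have hpos : 0 < ∫ x, ch x ^ 2 := by
    rw [integral_pos_iff_support_of_nonneg (fun x => by positivity) hi]
    refine lt_of_lt_of_le (Metric.measure_ball_pos volume (0 : ES n) one_pos) (measure_mono ?_)
    intro x hx
    have : ch x = 1 := ch.one_of_mem_closedBall (Metric.ball_subset_closedBall hx)
    simp [this]
  refine ⟨fun x => (Real.sqrt (∫ x, ch x ^ 2))⁻¹ * ch x, contDiff_const.mul ch.contDiff,
    fun x hx => ?_, ?_⟩
  · have : ch x = 0 := ch.zero_of_le_dist (by simpa [ch] using hx.le)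
    simp [this]
  · simp only [mul_pow, inv_pow, Real.sq_sqrt hpos.le]
    rw [integral_const_mul, inv_mul_cancel₀ hpos.ne']

theorem qmp_fst : Measure.QuasiMeasurePreserving (fun z : ES n × ES n × ES n => (z.2.1, z.1))
    (volume.prod volume) (volume.prod volume) := by
  have h1 : Measure.QuasiMeasurePreserving
      (Prod.map id Prod.fst : ES n × ES n × ES n → ES n × ES n)
      (volume.prod (volume.prod volume)) (volume.prod volume) :=
    QuasiMeasurePreserving.prodMap (Measure.QuasiMeasurePreserving.id _)
      Measure.quasiMeasurePreserving_fst
  exact (Measure.measurePreserving_swap.quasiMeasurePreserving).comp h1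

theorem qmp_snd : Measure.QuasiMeasurePreserving (fun z : ES n × ES n × ES n => (z.2.2, z.1))
    (volume.prod volume) (volume.prod volume) := by
  have h1 : Measure.QuasiMeasurePreserving
      (Prod.map id Prod.snd : ES n × ES n × ES n → ES n × ES n)
      (volume.prod (volume.prod volume)) (volume.prod volume) :=
    QuasiMeasurePreserving.prodMap (Measure.QuasiMeasurePreserving.id _)
      Measure.quasiMeasurePreserving_snd
  exact (Measure.measurePreserving_swap.quasiMeasurePreserving).comp h1

/-- The basic oscillatory operator. -/
def Bop (φ : ES n × ES n → ℝ) (b : ES n × ES n → ℂ) (u : ES n → ℂ) (ξ : ES n) : ℂ :=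
  ∫ y, osc (φ (y, ξ)) * b (y, ξ) * u y

set_option maxHeartbeats 1000000 in
theorem lemmaA {k : ℕ} (hk : 3 * n + 2 ≤ k) {c0 : ℝ} {φ : ι → ES n × ES n → ℝ}
    (hφ : Phase k c0 φ) {b : ι → ES n × ES n → ℂ} (hb : Sy (fun _ => Set.univ) k b)
    (hK : ∀ i, ∃ K, IsCompact K ∧ ∀ y ξ, ξ ∉ K → b i (y, ξ) = 0) :
    ∃ C, 0 < C ∧ ∀ i (u : ES n → ℂ), Integrable u → (Integrable fun y => ‖u y‖ ^ 2) →
      ∫ ξ, ‖Bop (φ i) (b i) u ξ‖ ^ 2 ≤ C * ∫ y, ‖u y‖ ^ 2 := by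
  obtain ⟨χ, hχ, hχ0, hχ1⟩ := exists_chi n
  have hχc' : HasCompactSupport χ := HasCompactSupport.of_support_subset_isCompact
    (isCompact_closedBall (0 : ES n) 2) (fun x hx => by
      rw [mem_closedBall_zero_iff]; by_contra h; exact hx (hχ0 x (not_le.1 h)))
  have hχcont := hχ.continuous
  let X : ES n → ℂ := fun x => ((χ x : ℝ) : ℂ)
  have hXc : Continuous X := Complex.continuous_ofReal.comp hχ.continuous
  obtain ⟨Bχ, hBχ⟩ := hχc'.exists_bound_of_continuous hχ.continuous
  have hBχ0 : 0 ≤ Bχ := (norm_nonneg _).trans (hBχ 0)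
  obtain ⟨C, hC, hO⟩ := orth_est hk hφ hb hK (χ := X) (Complex.ofRealCLM.contDiff.comp hχ)
    (R := 2) (by norm_num) (fun x hx => by simp [X, hχ0 x hx])
  let f0 : ES n → ℝ := fun x => χ (-x) ^ 2
  have hf0 : Integrable f0 := by
    have : Integrable fun x => χ x ^ 2 := by
      refine Continuous.integrable_of_hasCompactSupport (hχ.continuous.pow 2) ?_
      exact hχc'.mono (fun x hx => by
        intro h
        apply hx
        simp [h])
    exact this.comp_neg
  have hf01 : ∫ x, f0 x = 1 := by
    rw [← hχ1]
    exact integral_neg_eq_self (fun x => χ x ^ 2) volume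
  have hw := integrable_decay n
  let w : ES n → ℝ := fun x => ((1 + ‖x‖)⁻¹) ^ (n + 1)
  have hw0 : ∀ x, 0 ≤ w x := fun x => by positivity
  let I := ∫ x, w x
  have hI : 0 ≤ I := integral_nonneg hw0
  obtain ⟨Bb, hBb0, hBb⟩ := hb.bound
  refine ⟨2 * C * I + 1, by positivity, fun i u hu hu2 => ?_⟩
  obtain ⟨K, hKc, hK0⟩ := hK i
  have hphc := (hφ.smooth i).continuous
  have hbc := (hb.smooth i).continuous
  let uu : ES n → ES n → ℂ := fun κ y => X (y - κ) * u y
  have huu : ∀ κ, Integrable (uu κ) := by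
    intro κ
    refine hu.bdd_mul (c := Bχ) ?_ (ae_of_all _ fun y => ?_)
    · exact (hXc.comp (by fun_prop)).aestronglyMeasurable
    · simpa [X] using hBχ (y - κ)
  have hsq : ∀ κ y, ‖uu κ y‖ ^ 2 = f0 (κ - y) * ‖u y‖ ^ 2 := by
    intro κ y
    simp [uu, X, f0, mul_pow]
  have huu2 : ∀ κ, Integrable fun y => ‖uu κ y‖ ^ 2 := by
    intro κ
    simp only [hsq]
    refine hu2.bdd_mul (c := Bχ ^ 2) ?_ (ae_of_all _ fun y => ?_)
    · exact Continuous.aestronglyMeasurable (by fun_prop)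
    · simp only [f0, norm_pow]
      exact pow_le_pow_left₀ (norm_nonneg _) (hBχ _) 2
  let a : ES n → ℝ := fun κ => ∫ y, ‖uu κ y‖ ^ 2
  have ha : Integrable a := by
    have := (shear_int hf0 hu2).integral_prod_left
    refine this.congr (ae_of_all _ fun κ => ?_)
    simp only [a, hsq]
  have ha1 : ∫ κ, a κ = ∫ y, ‖u y‖ ^ 2 := by
    have := shear_eq hf0 hu2
    rw [hf01, one_mul, integral_prod _ (shear_int hf0 hu2)] at this
    rw [← this]
    simp only [a, hsq]
  let F : ES n → ES n → ℂ := fun κ ξ => Floc X (φ i) (b i) κ (uu κ) ξ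
  have hFe : ∀ κ ξ, F κ ξ = ∫ y, ((f0 (κ - y) : ℝ) : ℂ) * (osc (φ i (y, ξ)) * b i (y, ξ) * u y) := by
    intro κ ξ
    simp only [F, Floc]
    refine integral_congr_ae (ae_of_all _ fun y => ?_)
    simp [uu, X, f0]
    ring
  have hgi : ∀ ξ, Integrable fun y => osc (φ i (y, ξ)) * b i (y, ξ) * u y := by
    intro ξ
    refine hu.bdd_mul (c := Bb) ?_ (ae_of_all _ fun y => ?_)
    · exact ((continuous_osc.comp (by fun_prop)).mul (by fun_prop)).aestronglyMeasurable
    · simpa [norm_osc] using hBb i (y, ξ) (Set.mem_univ _)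
  have hB : ∀ ξ, Bop (φ i) (b i) u ξ = ∫ κ, F κ ξ := by
    intro ξ
    have h1 := shear_int (hf0.ofReal (𝕜 := ℂ)) (hgi ξ)
    have h2 := integral_integral_swap (f := fun κ y => ((f0 (κ - y) : ℝ) : ℂ) *
      (osc (φ i (y, ξ)) * b i (y, ξ) * u y)) h1
    simp only [hFe]
    rw [h2]
    unfold Bop
    refine integral_congr_ae (ae_of_all _ fun y => ?_)
    simp only
    rw [integral_mul_const, integral_sub_right_eq_self (fun x => ((f0 x : ℝ) : ℂ)),
      integral_complex_ofReal, hf01]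
    simp
  let G : ES n → ℝ := fun κ => ∫ y, f0 (κ - y) * (Bb * ‖u y‖)
  have hG : Integrable G := (shear_int hf0 (hu.norm.const_mul Bb)).integral_prod_left
  have hFG : ∀ κ ξ, ‖F κ ξ‖ ≤ K.indicator (fun _ => (1 : ℝ)) ξ * G κ := by
    intro κ ξ
    by_cases hξ : ξ ∈ K
    · simp only [hξ, Set.indicator_of_mem, one_mul]
      rw [hFe]
      have hnn : ∀ y, ‖((f0 (κ - y) : ℝ) : ℂ) * (osc (φ i (y, ξ)) * b i (y, ξ) * u y)‖ ≤
        f0 (κ - y) * (Bb * ‖u y‖) := by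
        intro y
        rw [norm_mul, norm_mul, norm_mul, norm_osc, one_mul, Complex.norm_real,
          Real.norm_eq_abs, abs_of_nonneg (by positivity)]
        gcongr
        exact hBb _ _ (Set.mem_univ _)
      refine (norm_integral_le_integral_norm _).trans ?_
      refine integral_mono_of_nonneg (ae_of_all _ fun y => norm_nonneg _) ?_ (ae_of_all _ hnn)
      refine (hu.norm.const_mul Bb).bdd_mul (c := Bχ ^ 2) ?_ (ae_of_all _ fun y => ?_)
      · exact Continuous.aestronglyMeasurable (by fun_prop)
      · simp only [f0, norm_pow]
        exact pow_le_pow_left₀ (norm_nonneg _) (hBχ _) 2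
    · rw [hFe]
      simp [hK0 _ _ hξ, hξ]
  have hKi : Integrable (K.indicator fun _ => (1 : ℝ)) :=
    (integrable_indicator_iff hKc.measurableSet).2 (by simp [hKc.measure_lt_top])
  have hFm : AEStronglyMeasurable (fun z : ES n × ES n => F z.1 z.2) (volume.prod volume) := by
    have h1 : AEStronglyMeasurable (fun z : (ES n × ES n) × ES n =>
        ((f0 (z.1.1 - z.2) : ℝ) : ℂ) * (osc (φ i (z.2, z.1.2)) * b i (z.2, z.1.2) * u z.2))
        ((volume.prod volume).prod volume) := by
      refine AEStronglyMeasurable.mul ?_ (AEStronglyMeasurable.mul ?_ hu.1.comp_snd)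
      · exact (Complex.continuous_ofReal.comp (by fun_prop)).aestronglyMeasurable
      · exact ((continuous_osc.comp (by fun_prop)).mul (by fun_prop)).aestronglyMeasurable
    simp only [hFe]
    exact h1.integral_prod_right'
  have hI3 : Integrable (fun z : ES n × ES n × ES n => F z.2.1 z.1 * (starRingEnd ℂ) (F z.2.2 z.1))
      (volume.prod volume) := by
    refine (hKi.mul_prod (hG.mul_prod hG)).mono' ?_ (ae_of_all _ ?_)
    · refine AEStronglyMeasurable.mul ?_ (Complex.continuous_conj.comp_aestronglyMeasurable ?_)
      · exact hFm.comp_quasiMeasurePreserving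
          (f := fun z : ES n × ES n × ES n => (z.2.1, z.1)) qmp_fst
      · exact hFm.comp_quasiMeasurePreserving
          (f := fun z : ES n × ES n × ES n => (z.2.2, z.1)) qmp_snd
    · rintro ⟨ξ, κ, κ'⟩
      simp only [norm_mul, RCLike.norm_conj]
      have h1 := mul_le_mul (hFG κ ξ) (hFG κ' ξ) (norm_nonneg _) ((norm_nonneg _).trans (hFG κ ξ))
      refine h1.trans (le_of_eq ?_)
      by_cases hξ : ξ ∈ K <;> simp [hξ]
  have e1 : ((∫ ξ, ‖Bop (φ i) (b i) u ξ‖ ^ 2 : ℝ) : ℂ) =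
      ∫ p : ES n × ES n, ∫ ξ, F p.1 ξ * (starRingEnd ℂ) (F p.2 ξ) := by
    rw [integral_sq_eq]
    have h2 := integral_integral_swap (f := fun ξ (p : ES n × ES n) =>
      F p.1 ξ * (starRingEnd ℂ) (F p.2 ξ)) hI3
    rw [← h2]
    refine integral_congr_ae (ae_of_all _ fun ξ => ?_)
    simp only
    rw [hB, ← integral_conj, ← integral_prod_mul]
    rfl
  have hs1 := shear_int hw ha
  have hs2 : Integrable (fun p : ES n × ES n => w (p.1 - p.2) * a p.1) (volume.prod volume) := by
    refine hs1.swap.congr (ae_of_all _ fun p => ?_)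
    simp [w, norm_sub_rev]
  have e2 : ∫ p : ES n × ES n, w (p.1 - p.2) * a p.1 ∂(volume.prod volume) = I * ∫ x, a x := by
    rw [← integral_prod_swap]
    rw [← shear_eq hw ha]
    refine integral_congr_ae (ae_of_all _ fun p => ?_)
    simp [w, norm_sub_rev]
  have hI0 : 0 ≤ ∫ ξ, ‖Bop (φ i) (b i) u ξ‖ ^ 2 := integral_nonneg fun _ => by positivity
  have hu0 : 0 ≤ ∫ y, ‖u y‖ ^ 2 := integral_nonneg fun _ => by positivity
  have key : ∫ ξ, ‖Bop (φ i) (b i) u ξ‖ ^ 2 ≤ ∫ p : ES n × ES n, C * (w (p.1 - p.2) * a p.1 + w (p.1 - p.2) * a p.2) := by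
    rw [← abs_of_nonneg hI0, ← Real.norm_eq_abs, ← Complex.norm_real, e1]
    refine norm_integral_le_of_norm_le ((hs2.add hs1).const_mul C) (ae_of_all _ fun p => ?_)
    refine (hO i p.1 p.2 (uu p.1) (uu p.2) (huu _) (huu2 _) (huu _) (huu2 _)).trans (le_of_eq ?_)
    simp only [w, a]
    ring
  refine key.trans ?_
  rw [integral_const_mul]
  have e3 := integral_add hs2 hs1
  have e4 := shear_eq hw ha
  have e5 : ∫ p : ES n × ES n, w (p.1 - p.2) * a p.1 + w (p.1 - p.2) * a p.2 =
    I * (∫ x, a x) + I * ∫ x, a x := by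
    rw [← e2]; nth_rewrite 2 [e2]; rw [← e4]; exact e3
  rw [e5, ha1]
  nlinarith

end LemmaA

section Planch
open FourierTransform

set_option maxHeartbeats 1000000 in
lemma fourier_L2_eq {n : ℕ} {F : ES n → ℂ} (h1 : Integrable F) (h2 : MemLp F 2) :
    ∀ᵐ x, (𝓕 (h2.toLp F) : Lp ℂ 2 (volume : Measure (ES n))) x = 𝓕 F x := by
  have hcont : Continuous (𝓕 F) :=
    VectorFourier.fourierIntegral_continuous Real.continuous_fourierChar
      (by exact continuous_inner) h1
  refine ae_eq_of_integral_contDiff_smul_eq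
    ((Lp.memLp _).locallyIntegrable (by norm_num)) hcont.locallyIntegrable ?_
  intro g hg hgc
  have hgc' : HasCompactSupport (fun x => ((g x : ℝ) : ℂ)) := hgc.comp_left (g := fun t : ℝ => (t : ℂ)) Complex.ofReal_zero
  have hg' : ContDiff ℝ ∞ (fun x => ((g x : ℝ) : ℂ)) := ofRealCLM.contDiff.comp hg
  obtain ⟨G, hGx⟩ : ∃ G : 𝓢(ES n, ℂ), ∀ x, G x = ((g x : ℝ) : ℂ) :=
    ⟨hgc'.toSchwartzMap hg', fun x => rfl⟩
  have e := congrArg (fun D => D G) (Lp.fourier_toTemperedDistribution_eq (h2.toLp F))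
  simp only [TemperedDistribution.fourier_apply, Lp.toTemperedDistribution_apply] at e
  have e1 : ∫ x, g x • (𝓕 (h2.toLp F) : Lp ℂ 2 (volume : Measure (ES n))) x
      = ∫ x, G x • (𝓕 (h2.toLp F) : Lp ℂ 2 (volume : Measure (ES n))) x := by
    refine integral_congr_ae (ae_of_all _ fun x => ?_)
    simp [hGx]
  rw [e1, ← e]
  have e2 : ∫ x, (𝓕 G) x • (h2.toLp F) x = ∫ x, (𝓕 G) x • F x := by
    refine integral_congr_ae ?_
    filter_upwards [h2.coeFn_toLp] with x hx
    rw [hx]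
  rw [e2]
  have e3 := VectorFourier.integral_fourierIntegral_smul_eq_flip (L := innerₗ (ES n))
    (μ := volume) (ν := volume)
    (f := fun x => G x) (g := F) Real.continuous_fourierChar (by exact continuous_inner) G.integrable h1
  rw [flip_innerₗ] at e3
  have e4 : ∫ x, (𝓕 G) x • F x = ∫ x, G x • 𝓕 F x := e3
  rw [e4]
  refine integral_congr_ae (ae_of_all _ fun x => ?_)
  simp [hGx]

/-- the unnormalised (inverse) Fourier transform -/
def Tf {n : ℕ} (F : ES n → ℂ) (x : ES n) : ℂ := ∫ ξ, osc ⟪x, ξ⟫ * F ξ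

lemma Tf_eq {n : ℕ} (F : ES n → ℂ) (x : ES n) : Tf F x = 𝓕 F ((-(2 * π)⁻¹ : ℝ) • x) := by
  rw [Real.fourier_eq']
  unfold Tf osc
  refine integral_congr_ae (ae_of_all _ fun ξ => ?_)
  simp only [smul_eq_mul]
  congr 2
  rw [inner_smul_right, real_inner_comm]
  have : (π : ℝ) ≠ 0 := Real.pi_ne_zero
  rw [mul_comm]
  congr 2
  field_simp

theorem planch (n : ℕ) : ∃ C : ℝ, 0 < C ∧ ∀ F : ES n → ℂ, Integrable F → MemLp F 2 →
    ∫⁻ x, ‖Tf F x‖ₑ ^ 2 ≤ ENNReal.ofReal C * ∫⁻ x, ‖F x‖ₑ ^ 2 := by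
  set R : ℝ := (-(2 * π)⁻¹ : ℝ) with hR
  have hR0 : R ≠ 0 := by simp [hR, Real.pi_ne_zero]
  refine ⟨|(R ^ Module.finrank ℝ (ES n))⁻¹|, by positivity, fun F h1 h2 => le_of_eq ?_⟩
  have hcont : Continuous (𝓕 F) :=
    VectorFourier.fourierIntegral_continuous Real.continuous_fourierChar
      (by exact continuous_inner) h1
  have e1 : ∫⁻ x, ‖Tf F x‖ₑ ^ 2 = ∫⁻ x, ‖𝓕 F (R • x)‖ₑ ^ 2 := by simp only [Tf_eq]; rfl
  have e2 : ∫⁻ x, ‖𝓕 F (R • x)‖ₑ ^ 2 = ∫⁻ x, ‖𝓕 F x‖ₑ ^ 2 ∂(Measure.map (R • ·) volume) := by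
    rw [lintegral_map (by fun_prop) (by fun_prop)]
  rw [e1, e2, Measure.map_addHaar_smul _ hR0, lintegral_smul_measure, smul_eq_mul]
  congr 1
  have e3 : ∀ f : ES n → ℂ, ∫⁻ x, ‖f x‖ₑ ^ 2 = eLpNorm f 2 volume ^ (2:ℝ) := by
    intro f
    have := eLpNorm_nnreal_pow_eq_lintegral (f := f) (μ := volume) (p := 2) (by norm_num)
    simp only [NNReal.coe_ofNat] at this
    push_cast at this
    rw [this]
    simp
  rw [e3, e3]
  congr 1
  rw [← eLpNorm_congr_ae (fourier_L2_eq h1 h2)]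
  have h3 := Lp.norm_fourier_eq (h2.toLp F)
  rw [Lp.norm_def, Lp.norm_def] at h3
  have h4 := (ENNReal.toReal_eq_toReal_iff' (Lp.eLpNorm_ne_top _) (Lp.eLpNorm_ne_top _)).1 h3
  rw [h4]
  exact eLpNorm_congr_ae h2.coeFn_toLp

end Planch

section JapCalc
variable {n : ℕ} {ι : Type*}

lemma one_le_jap (x : ES n) : 1 ≤ jap x := by
  unfold jap
  rw [Real.one_le_sqrt]
  nlinarith [sq_nonneg ‖x‖]

lemma jap_pos (x : ES n) : 0 < jap x := zero_lt_one.trans_le (one_le_jap x)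

lemma jap_sq (x : ES n) : jap x ^ 2 = 1 + ‖x‖ ^ 2 := by
  unfold jap
  rw [Real.sq_sqrt (by positivity)]

lemma norm_le_jap (x : ES n) : ‖x‖ ≤ jap x := by
  refine abs_le_of_sq_le_sq' ?_ (jap_pos x).le |>.2
  rw [jap_sq]; linarith

lemma contDiff_jap : ContDiff ℝ ∞ (jap : ES n → ℝ) := by
  unfold jap
  refine ContDiff.sqrt (contDiff_const.add (contDiff_norm_sq ℝ)) fun x => ?_
  positivity

lemma continuous_jap : Continuous (jap : ES n → ℝ) := contDiff_jap.continuous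

lemma dLine_jap (v x : ES n) : dLine v jap x = ⟪x, v⟫ * (jap x)⁻¹ := by
  have h1 : ContDiff ℝ ∞ (jap : ES n → ℝ) := contDiff_jap
  have h2 : dLine v (fun x : ES n => jap x * jap x) x = dLine v jap x * jap x + jap x * dLine v jap x := by
    have := dLine_mul_fun h1 h1 v
    rw [this]
  have h3 : (fun x : ES n => jap x * jap x) = fun x => 1 + ‖x‖ ^ 2 := by
    funext x; rw [← sq, jap_sq]
  rw [h3] at h2
  have h4 : dLine v (fun x : ES n => 1 + ‖x‖ ^ 2) x = 2 * ⟪x, v⟫ := by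
    unfold dLine
    rw [fderiv_const_add, fderiv_norm_sq_apply]
    simp
  rw [h4] at h2
  have := jap_pos x
  field_simp
  linarith

lemma dLine_japinv (v x : ES n) : dLine v (fun x : ES n => (jap x)⁻¹) x =
    - ((jap x)⁻¹ * (jap x)⁻¹ * (⟪x, v⟫ * (jap x)⁻¹)) := by
  have h := dLine_inv (f := (jap : ES n → ℝ)) contDiff_jap (fun z => (jap_pos z).ne') v
  rw [h]
  simp only [dLine_jap]
  try ring

lemma contDiff_japinv : ContDiff ℝ ∞ (fun x : ES n => (jap x)⁻¹) :=
  contDiff_jap.inv fun x => (jap_pos x).ne'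

lemma Sy_jap (k : ℕ) : Sy (fun _ : ι => Set.univ) k (fun _ (x : ES n) => (jap x)⁻¹) ∧
    ∀ w : ES n, Sy (fun _ : ι => Set.univ) k (fun _ (x : ES n) => ⟪x, w⟫ * (jap x)⁻¹) := by
  have hb1 : ∃ C : ℝ, ∀ i : ι, ∀ z ∈ (Set.univ : Set (ES n)), ‖(jap z)⁻¹‖ ≤ C := by
    refine ⟨1, fun i z _ => ?_⟩
    rw [Real.norm_eq_abs, abs_of_pos (inv_pos.2 (jap_pos z))]
    exact inv_le_one_of_one_le₀ (one_le_jap z)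
  have hb2 : ∀ w : ES n, ∃ C : ℝ, ∀ i : ι, ∀ z ∈ (Set.univ : Set (ES n)), ‖⟪z, w⟫ * (jap z)⁻¹‖ ≤ C := by
    intro w
    refine ⟨‖w‖, fun i z _ => ?_⟩
    rw [norm_mul, norm_inv, Real.norm_eq_abs (jap z), abs_of_pos (jap_pos z), ← div_eq_mul_inv,
      div_le_iff₀ (jap_pos z), mul_comm]
    exact (norm_inner_le_norm z w).trans (mul_le_mul_of_nonneg_right (norm_le_jap z) (norm_nonneg _))
  have hs2 : ∀ w : ES n, ContDiff ℝ ∞ (fun x : ES n => ⟪x, w⟫ * (jap x)⁻¹) := by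
    intro w
    exact (contDiff_id.inner ℝ contDiff_const).mul contDiff_japinv
  induction k with
  | zero => exact ⟨⟨fun _ => contDiff_japinv, hb1⟩, fun w => ⟨fun _ => hs2 w, hb2 w⟩⟩
  | succ k ih =>
    obtain ⟨i1, i2⟩ := ih
    refine ⟨Sy.succ (fun _ => contDiff_japinv) hb1 fun v => ?_,
      fun w => Sy.succ (fun _ => hs2 w) (hb2 w) fun v => ?_⟩
    · exact ((i1.mul i1).mul (i2 v)).neg.congr fun i z => dLine_japinv v z
    · have hc : Sy (fun _ : ι => (Set.univ : Set (ES n))) k (fun (_ : ι) (_ : ES n) => (⟪v, w⟫ : ℝ)) :=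
        Sy.const k (C := ‖(⟪v, w⟫ : ℝ)‖) fun _ => le_rfl
      refine ((hc.mul i1).sub (((i2 w).mul i1).mul (i2 v))).congr fun i z => ?_
      have := dLine_mul_fun (f := fun x : ES n => (⟪x, w⟫ : ℝ)) (g := fun x : ES n => (jap x)⁻¹)
        (contDiff_id.inner ℝ contDiff_const) contDiff_japinv v
      rw [this]
      simp only [dLine_japinv]
      have e : dLine v (fun x : ES n => (⟪x, w⟫ : ℝ)) z = ⟪v, w⟫ := by
        have := dLine_clm (F := ES n) (innerSL ℝ w) (f := fun x : ES n => x) contDiff_id v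
        simp only [innerSL_apply_apply] at this
        simp only [real_inner_comm w]
        rw [this]
        simp [dLine]
      rw [e]
      ring

lemma Sy_jap1 (k : ℕ) : Sy (fun _ : ι => Set.univ) k
    (fun _ (z : ES n × ES n) => (jap z.1)⁻¹) := by
  have := ((Sy_jap (ι := ι) (n := n) k).1).affine (fun _ : ι => (Set.univ : Set (ES n × ES n))) id (fun _ => 0)
    (ContinuousLinearMap.fst ℝ (ES n) (ES n)) (by simp)
  simpa using this

/-- Rapidly decaying functions. -/
structure Nice (u : ES n → ℂ) : Prop where
  meas : AEStronglyMeasurable u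
  dec : ∀ N : ℕ, ∃ C : ℝ, ∀ y, jap y ^ N * ‖u y‖ ≤ C

lemma Nice.mul_bdd {u : ES n → ℂ} (hu : Nice u) {g : ES n → ℂ} (hg : AEStronglyMeasurable g)
    {j : ℕ} (hb : ∀ y, ‖g y‖ ≤ jap y ^ j) : Nice (fun y => g y * u y) := by
  refine ⟨hg.mul hu.meas, fun N => ?_⟩
  obtain ⟨C, hC⟩ := hu.dec (N + j)
  refine ⟨C, fun y => le_trans ?_ (hC y)⟩
  rw [norm_mul, pow_add, mul_assoc]
  have := jap_pos y
  gcongr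
  exact hb y

lemma integrable_jap : ∃ N : ℕ, Integrable fun y : ES n => (jap y ^ N)⁻¹ := by
  refine ⟨2 * (n + 1), ?_⟩
  have h := integrable_rpow_neg_one_add_norm_sq (E := ES n) (μ := volume) (r := 2 * (n + 1))
    (by simp; linarith)
  refine h.congr (ae_of_all _ fun y => ?_)
  simp only
  rw [pow_mul, jap_sq, show (-(2 * ((n : ℝ) + 1)) / 2) = -((n + 1 : ℕ) : ℝ) by push_cast; ring,
    Real.rpow_neg (by positivity), Real.rpow_natCast]

lemma Nice.integrable {u : ES n → ℂ} (hu : Nice u) : Integrable u := by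
  obtain ⟨N, hN⟩ := integrable_jap (n := n)
  obtain ⟨C, hC⟩ := hu.dec N
  refine (hN.const_mul C).mono' hu.meas (ae_of_all _ fun y => ?_)
  rw [← div_eq_mul_inv, le_div_iff₀ (pow_pos (jap_pos y) _), mul_comm]
  exact hC y

lemma Nice.integrable_sq {u : ES n → ℂ} (hu : Nice u) : Integrable fun y => ‖u y‖ ^ 2 := by
  obtain ⟨C, hC⟩ := hu.dec 0
  refine (hu.integrable.norm.const_mul C).mono' (hu.meas.norm.pow 2) (ae_of_all _ fun y => ?_)
  have := hC y
  simp only [pow_zero, one_mul] at this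
  rw [norm_pow, norm_norm, sq]
  gcongr

end JapCalc

section Kern
variable {n : ℕ} {ι : Type*}

/-- the amplitude vanishes for the frequency outside a compact set -/
def CK (b : ES n × ES n → ℂ) : Prop := ∃ K, IsCompact K ∧ ∀ y ξ, ξ ∉ K → b (y, ξ) = 0

lemma CK.dLine {b : ES n × ES n → ℂ} (h : CK b) (v : ES n × ES n) : CK (dLine v b) := by
  obtain ⟨K, hK, h⟩ := h
  refine ⟨K, hK, fun y ξ hξ => ?_⟩
  have : b =ᶠ[nhds (y, ξ)] fun _ => 0 := by
    have ho : IsOpen {z : ES n × ES n | z.2 ∉ K} := hK.isClosed.isOpen_compl.preimage continuous_snd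
    filter_upwards [ho.mem_nhds hξ] with z hz
    exact h z.1 z.2 hz
  unfold _root_.dLine
  rw [this.fderiv_eq]
  simp

lemma CK.mul {b : ES n × ES n → ℂ} (h : CK b) (g : ES n × ES n → ℂ) : CK (fun z => g z * b z) := by
  obtain ⟨K, hK, h⟩ := h
  exact ⟨K, hK, fun y ξ hξ => by simp [h y ξ hξ]⟩

lemma CK.add {b c : ES n × ES n → ℂ} (h : CK b) (h' : CK c) : CK (fun z => b z + c z) := by
  obtain ⟨K, hK, h⟩ := h
  obtain ⟨K', hK', h'⟩ := h'
  refine ⟨K ∪ K', hK.union hK', fun y ξ hξ => ?_⟩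
  simp only [Set.mem_union, not_or] at hξ
  simp [h y ξ hξ.1, h' y ξ hξ.2]

lemma CK.sum {J : Type*} (S : Finset J) {b : J → ES n × ES n → ℂ} (h : ∀ j ∈ S, CK (b j)) :
    CK (fun z => ∑ j ∈ S, b j z) := by
  classical
  induction S using Finset.induction_on with
  | empty => exact ⟨∅, isCompact_empty, by simp⟩
  | insert a S ha ih =>
    simp_rw [Finset.sum_insert ha]
    exact (h a (by simp)).add (ih fun j hj => h j (by simp [hj]))

/-- kernel -/
def ker (φ : ES n × ES n → ℝ) (b : ES n × ES n → ℂ) (x y : ES n) : ℂ :=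
  ∫ ξ, osc (⟪x, ξ⟫ + φ (y, ξ)) * b (y, ξ)

/-- operator -/
def Tk (φ : ES n × ES n → ℝ) (b : ES n × ES n → ℂ) (u : ES n → ℂ) (x : ES n) : ℂ :=
  ∫ y, ker φ b x y * u y

lemma ker_integrable {φ : ES n × ES n → ℝ} {b : ES n × ES n → ℂ} (hφ : Continuous φ)
    (hb : Continuous b) (hK : CK b) (x y : ES n) :
    Integrable fun ξ => osc (⟪x, ξ⟫ + φ (y, ξ)) * b (y, ξ) := by
  obtain ⟨K, hK, h⟩ := hK
  have := continuous_osc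
  refine Continuous.integrable_of_hasCompactSupport (by fun_prop) ?_
  exact HasCompactSupport.intro hK fun ξ hξ => by simp [h y ξ hξ]

lemma ker_ibp {φ : ES n × ES n → ℝ} {b : ES n × ES n → ℂ} (hφ : ContDiff ℝ ∞ φ)
    (hb : ContDiff ℝ ∞ b) (hK : CK b) (x y v : ES n) :
    ((⟪x, v⟫ : ℝ) : ℂ) * ker φ b x y = I * ker φ (dLine (0, v) b) x y
      - ker φ (fun z => ((dLine ((0, v) : ES n × ES n) φ z : ℝ) : ℂ) * b z) x y := by
  have hK' := hK
  obtain ⟨K, hKc, h⟩ := hK'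
  have h1 := ibp (W := ES n × ES n) (ContinuousLinearMap.inr ℝ (ES n) (ES n)) (y, 0)
    (Ψ := fun z => ⟪x, z.2⟫ + φ z) ((contDiff_const.inner ℝ contDiff_snd).add hφ) hb (by
      refine hKc.of_isClosed_subset ((isClosed_tsupport _).preimage (by fun_prop)) ?_
      intro ξ hξ
      by_contra hn
      have : b =ᶠ[nhds (y, ξ)] fun _ => 0 := by
        have ho : IsOpen {z : ES n × ES n | z.2 ∉ K} :=
          hKc.isClosed.isOpen_compl.preimage continuous_snd
        filter_upwards [ho.mem_nhds hn] with z hz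
        exact h z.1 z.2 hz
      have h3 : ((y, 0) : ES n × ES n) + ContinuousLinearMap.inr ℝ (ES n) (ES n) ξ = (y, ξ) := by simp
      rw [Set.mem_preimage, h3] at hξ
      exact (notMem_tsupport_iff_eventuallyEq.2 this) hξ) v
  have e : ∀ z, dLine (0, v) (fun z : ES n × ES n => ⟪x, z.2⟫ + φ z) z = ⟪x, v⟫ + dLine (0, v) φ z := by
    intro z
    have h2 := dLine_add_fun (f := fun z : ES n × ES n => (⟪x, z.2⟫ : ℝ)) (g := φ) (contDiff_const.inner ℝ contDiff_snd) hφ (0, v)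
    rw [h2]
    simp only [add_left_inj]
    have := dLine_clm ((innerSL ℝ x).comp (ContinuousLinearMap.snd ℝ (ES n) (ES n)))
      (f := fun z : ES n × ES n => z) contDiff_id (0, v)
    simp only [ContinuousLinearMap.comp_apply, innerSL_apply_apply, ContinuousLinearMap.coe_snd'] at this
    rw [this]
    simp [dLine]
  simp only [ContinuousLinearMap.inr_apply, Prod.mk_add_mk, add_zero, zero_add, e] at h1
  have hφc := hφ.continuous
  have hbc := hb.continuous
  have hd : Continuous (dLine ((0, v) : ES n × ES n) φ) := (contDiff_dLine hφ _).continuous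
  have i1 := ker_integrable hφc hbc hK x y
  have i2 := ker_integrable (b := fun z => ((dLine ((0, v) : ES n × ES n) φ z : ℝ) : ℂ) * b z)
    hφc (by fun_prop) (hK.mul _) x y
  have h4 : ∫ ξ, osc (⟪x, ξ⟫ + φ (y, ξ)) *
      (I * ((⟪x, v⟫ + dLine ((0, v) : ES n × ES n) φ (y, ξ) : ℝ) : ℂ) * b (y, ξ)) =
      I * (((⟪x, v⟫ : ℝ) : ℂ) * ker φ b x y
        + ker φ (fun z => ((dLine ((0, v) : ES n × ES n) φ z : ℝ) : ℂ) * b z) x y) := by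
    unfold ker
    rw [← integral_const_mul, ← integral_add (i1.const_mul _) i2, ← integral_const_mul]
    refine integral_congr_ae (ae_of_all _ fun ξ => ?_)
    simp only [ofReal_add]
    ring
  rw [h4] at h1
  have h5 : ker φ (dLine (0, v) b) x y = -(I * (((⟪x, v⟫ : ℝ) : ℂ) * ker φ b x y
        + ker φ (fun z => ((dLine ((0, v) : ES n × ES n) φ z : ℝ) : ℂ) * b z) x y)) := h1
  rw [h5]
  linear_combination (((⟪x, v⟫ : ℝ) : ℂ) * ker φ b x y
        + ker φ (fun z => ((dLine ((0, v) : ES n × ES n) φ z : ℝ) : ℂ) * b z) x y) * I_mul_I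

end Kern

section LemB
variable {n : ℕ} {ι : Type*}

lemma Bop_props {φ : ES n × ES n → ℝ} {b : ES n × ES n → ℂ} (hφ : Continuous φ)
    (hb : Continuous b) {B : ℝ} (hB : ∀ z, ‖b z‖ ≤ B) (hK : CK b) {u : ES n → ℂ} (hu : Integrable u) :
    Integrable (fun z : ES n × ES n => osc (φ (z.1, z.2)) * b (z.1, z.2) * u z.1) (volume.prod volume) ∧
    Integrable (Bop φ b u) ∧ Integrable (fun ξ => ‖Bop φ b u ξ‖ ^ 2) := by
  obtain ⟨K, hKc, h⟩ := hK
  have hosc := continuous_osc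
  have hB0 : 0 ≤ B := (norm_nonneg _).trans (hB 0)
  have hKi : ∀ c : ℝ, Integrable (K.indicator fun _ => c) := fun c =>
    (integrable_indicator_iff hKc.measurableSet).2 (by simp [hKc.measure_lt_top])
  have hi : Integrable (fun z : ES n × ES n => osc (φ (z.1, z.2)) * b (z.1, z.2) * u z.1)
      (volume.prod volume) := by
    refine (hu.norm.mul_prod (hKi B)).mono' ?_ (ae_of_all _ ?_)
    · exact AEStronglyMeasurable.mul (by fun_prop) hu.1.comp_fst
    · rintro ⟨y, ξ⟩
      simp only [norm_mul, norm_osc, one_mul]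
      by_cases hξ : ξ ∈ K
      · simp only [hξ, Set.indicator_of_mem]
        rw [mul_comm]
        exact mul_le_mul_of_nonneg_left (hB _) (norm_nonneg _)
      · simp [hξ, h y ξ hξ]
  have hF : Integrable (Bop φ b u) := hi.integral_prod_right
  refine ⟨hi, hF, ?_⟩
  have hFB : ∀ ξ, ‖Bop φ b u ξ‖ ≤ B * ∫ y, ‖u y‖ := by
    intro ξ
    refine (norm_integral_le_integral_norm _).trans ?_
    rw [← integral_const_mul]
    refine integral_mono_of_nonneg (ae_of_all _ fun y => norm_nonneg _) (hu.norm.const_mul _)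
      (ae_of_all _ fun y => ?_)
    simp only [norm_mul, norm_osc, one_mul]
    exact mul_le_mul_of_nonneg_right (hB _) (norm_nonneg _)
  refine (hF.norm.const_mul (B * ∫ y, ‖u y‖)).mono' (hF.1.norm.pow 2) (ae_of_all _ fun ξ => ?_)
  rw [norm_pow, norm_norm, sq]
  exact mul_le_mul_of_nonneg_right (hFB ξ) (norm_nonneg _)

lemma Tk_fub {φ : ES n × ES n → ℝ} {b : ES n × ES n → ℂ} (hφ : Continuous φ)
    (hb : Continuous b) {B : ℝ} (hB : ∀ z, ‖b z‖ ≤ B) (hK : CK b) {u : ES n → ℂ} (hu : Integrable u)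
    (x : ES n) : Integrable (fun y => ker φ b x y * u y) ∧ Tk φ b u x = Tf (Bop φ b u) x := by
  have hosc := continuous_osc
  have h1 := (Bop_props (φ := fun z => ⟪x, z.2⟫ + φ z) (by fun_prop) hb hB hK hu).1
  have e1 : ∀ y, ker φ b x y * u y = ∫ ξ, osc (⟪x, ξ⟫ + φ (y, ξ)) * b (y, ξ) * u y := fun y => by
    unfold ker; rw [integral_mul_const]
  refine ⟨?_, ?_⟩
  · simp only [e1]
    exact h1.integral_prod_left
  · unfold Tk Tf Bop
    simp only [e1]
    have h2 := integral_integral_swap (f := fun y ξ => osc (⟪x, ξ⟫ + φ (y, ξ)) * b (y, ξ) * u y) h1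
    rw [h2]
    refine integral_congr_ae (ae_of_all _ fun ξ => ?_)
    simp only
    rw [← integral_const_mul]
    refine integral_congr_ae (ae_of_all _ fun y => ?_)
    simp only [osc_add]
    ring

lemma Tf_cont {F : ES n → ℂ} (hF : Integrable F) : Continuous (Tf F) := by
  have hcont : Continuous (FourierTransform.fourier F) :=
    VectorFourier.fourierIntegral_continuous Real.continuous_fourierChar
      (by exact continuous_inner) hF
  have : Tf F = fun x => FourierTransform.fourier F ((-(2 * π)⁻¹ : ℝ) • x) := by
    funext x; exact Tf_eq F x
  rw [this]
  fun_prop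

lemma Tk_cont {φ : ES n × ES n → ℝ} {b : ES n × ES n → ℂ} (hφ : Continuous φ)
    (hb : Continuous b) {B : ℝ} (hB : ∀ z, ‖b z‖ ≤ B) (hK : CK b) {u : ES n → ℂ} (hu : Integrable u) :
    Continuous (Tk φ b u) := by
  have : Tk φ b u = Tf (Bop φ b u) := by
    funext x; exact (Tk_fub hφ hb hB hK hu x).2
  rw [this]
  exact Tf_cont (Bop_props hφ hb hB hK hu).2.1

lemma sq_lint {f : ES n → ℂ} (hf : Integrable fun x => ‖f x‖ ^ 2) :
    ∫⁻ x, ‖f x‖ₑ ^ 2 = ENNReal.ofReal (∫ x, ‖f x‖ ^ 2) := by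
  rw [ofReal_integral_eq_lintegral_ofReal hf (ae_of_all _ fun x => by positivity)]
  refine lintegral_congr fun x => ?_
  rw [ENNReal.ofReal_pow (norm_nonneg _), ofReal_norm_eq_enorm]

/-- weighted square norm -/
def Wt (w : ES n → ℝ) (f : ES n → ℂ) : ℝ≥0∞ := ∫⁻ x, ENNReal.ofReal (w x * ‖f x‖ ^ 2)

lemma Wt_one (f : ES n → ℂ) : Wt (fun _ => 1) f = ∫⁻ x, ‖f x‖ₑ ^ 2 := by
  refine lintegral_congr fun x => ?_
  rw [one_mul, ENNReal.ofReal_pow (norm_nonneg _), ofReal_norm_eq_enorm]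

theorem L2bound {k : ℕ} (hk : 3 * n + 2 ≤ k) {c0 : ℝ} {φ : ι → ES n × ES n → ℝ}
    (hφ : Phase k c0 φ) {b : ι → ES n × ES n → ℂ} (hb : Sy (fun _ => Set.univ) k b)
    (hK : ∀ i, CK (b i)) :
    ∃ C : ℝ, 0 < C ∧ ∀ i (u : ES n → ℂ), Nice u →
      Wt (fun _ => 1) (Tk (φ i) (b i) u) ≤ ENNReal.ofReal C * Wt (fun _ => 1) u := by
  obtain ⟨C, hC, h⟩ := lemmaA hk hφ hb hK
  obtain ⟨D, hD, hP⟩ := planch n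
  obtain ⟨B, _, hB⟩ := hb.bound
  refine ⟨D * C, by positivity, fun i u hu => ?_⟩
  have hφc := (hφ.smooth i).continuous
  have hbc := (hb.smooth i).continuous
  have hB' : ∀ z, ‖b i z‖ ≤ B := fun z => hB i z (Set.mem_univ _)
  obtain ⟨-, h2, h3⟩ := Bop_props hφc hbc hB' (hK i) hu.integrable
  have e : Tk (φ i) (b i) u = Tf (Bop (φ i) (b i) u) := by
    funext x; exact (Tk_fub hφc hbc hB' (hK i) hu.integrable x).2
  rw [e, Wt_one, Wt_one]
  refine (hP _ h2 ((memLp_two_iff_integrable_sq_norm h2.1).2 h3)).trans ?_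
  rw [sq_lint h3, sq_lint hu.integrable_sq, ENNReal.ofReal_mul hD.le, mul_assoc,
    ← ENNReal.ofReal_mul hC.le]
  gcongr
  exact h i u hu.integrable hu.integrable_sq

/-- growth condition for the gradient of the phase -/
def Grow (k : ℕ) (φ : ι → ES n × ES n → ℝ) : Prop := ∀ w : ES n, Sy (fun _ => Set.univ) k
  (fun i z => (jap z.1)⁻¹ * dLine ((0, w) : ES n × ES n) (φ i) z)

lemma ker_sub {φ : ES n × ES n → ℝ} {b c : ES n × ES n → ℂ} (hφ : Continuous φ)
    (hb : Continuous b) (hK : CK b) (hc : Continuous c) (hK' : CK c) (x y : ES n) (p q : ℂ)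
    (d : ES n × ES n → ℂ) (hd : ∀ ξ, d (y, ξ) = p * b (y, ξ) + q * c (y, ξ)) :
    ker φ d x y = p * ker φ b x y + q * ker φ c x y := by
  unfold ker
  rw [← integral_const_mul, ← integral_const_mul, ← integral_add
    ((ker_integrable hφ hb hK x y).const_mul _) ((ker_integrable hφ hc hK' x y).const_mul _)]
  refine integral_congr_ae (ae_of_all _ fun ξ => ?_)
  simp only [hd]
  ring

lemma wt_step {w : ES n → ℝ} (hw : Continuous w) (hw0 : ∀ x, 0 ≤ w x) {J : Type*} (S : Finset J)
    {F : J → ES n → ℂ} (hF : ∀ j ∈ S, Continuous (F j)) {w' : ES n → ℝ} {G : ES n → ℂ} {D : ℝ}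
    (hD : 0 ≤ D)
    (h : ∀ x, w' x * ‖G x‖ ^ 2 ≤ D * ∑ j ∈ S, w x * ‖F j x‖ ^ 2) :
    Wt w' G ≤ ENNReal.ofReal D * ∑ j ∈ S, Wt w (F j) := by
  unfold Wt
  have hc : ∀ j ∈ S, Measurable fun x => ENNReal.ofReal (w x * ‖F j x‖ ^ 2) := fun j hj =>
    (ENNReal.continuous_ofReal.comp (hw.mul ((hF j hj).norm.pow 2))).measurable
  rw [← lintegral_finsetSum _ hc, ← lintegral_const_mul _ (Finset.measurable_fun_sum _ hc)]
  refine lintegral_mono fun x => ?_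
  refine (ENNReal.ofReal_le_ofReal (h x)).trans ?_
  rw [ENNReal.ofReal_mul hD, ENNReal.ofReal_sum_of_nonneg]
  intro j _
  have := hw0 x
  positivity

lemma Nice.jap {u : ES n → ℂ} (hu : Nice u) : Nice fun y => ((jap y : ℝ) : ℂ) * u y :=
  hu.mul_bdd (j := 1) (Complex.continuous_ofReal.comp continuous_jap).aestronglyMeasurable
    fun y => by rw [Complex.norm_real, Real.norm_eq_abs, abs_of_pos (jap_pos y), pow_one]

lemma Nice.japinv {u : ES n → ℂ} (hu : Nice u) : Nice fun y => (((_root_.jap y)⁻¹ : ℝ) : ℂ) * u y :=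
  hu.mul_bdd (j := 0) (Complex.continuous_ofReal.comp
      (contDiff_japinv (n := n)).continuous).aestronglyMeasurable
    fun y => by
      rw [Complex.norm_real, Real.norm_eq_abs, abs_of_pos (inv_pos.2 (jap_pos y)), pow_zero]
      exact inv_le_one_of_one_le₀ (one_le_jap y)

set_option maxHeartbeats 1000000 in
theorem lemmaB {c0 : ℝ} {φ : ι → ES n × ES n → ℝ} (N : ℕ) :
    Phase (3 * n + 2 + N) c0 φ → Grow (3 * n + 2 + N) φ →
    ∀ {b : ι → ES n × ES n → ℂ}, Sy (fun _ => Set.univ) (3 * n + 2 + N) b → (∀ i, CK (b i)) →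
    ∃ C : ℝ, 0 < C ∧ ∀ i (u : ES n → ℂ), Nice u →
      Wt (fun x => jap x ^ (2 * N)) (Tk (φ i) (b i) u) ≤
        ENNReal.ofReal C * Wt (fun x => jap x ^ (2 * N)) u := by
  induction N with
  | zero =>
    intro hφ hg b hb hK
    simpa using L2bound (by omega) hφ hb hK
  | succ N ih =>
    intro hφ hg b hb hK
    have ih' := @ih (hφ.mono (by omega)) (fun w => (hg w).mono (by omega))
    set c : Fin n → ι → ES n × ES n → ℂ := fun j i z =>
      I * ((((jap z.1)⁻¹ : ℝ) : ℂ) * dLine ((0, bv j) : ES n × ES n) (b i) z) -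
        (((jap z.1)⁻¹ * dLine ((0, bv j) : ES n × ES n) (φ i) z : ℝ) : ℂ) * b i z with hc
    have hcS : ∀ j, Sy (fun _ => Set.univ) (3 * n + 2 + N) (c j) := by
      intro j
      have h1 : Sy (fun _ : ι => Set.univ) (3 * n + 2 + N) (fun (_ : ι) (_ : ES n × ES n) => I) :=
        Sy.const _ (C := 1) (by simp)
      exact (h1.mul ((Sy_jap1 _).ofReal.mul (hb.d _))).sub
        (((hg (bv j)).mono (by omega)).ofReal.mul (hb.mono (by omega)))
    have hcK : ∀ j i, CK (c j i) := by
      intro j i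
      have h1 := (((hK i).dLine (0, bv j)).mul (fun z => I * (((jap z.1)⁻¹ : ℝ) : ℂ))).add
        ((hK i).mul fun z => -(((jap z.1)⁻¹ * dLine ((0, bv j) : ES n × ES n) (φ i) z : ℝ) : ℂ))
      refine cast (congrArg CK ?_) h1
      funext z
      simp only [hc]
      ring
    obtain ⟨C0, hC0, h0⟩ := ih' (hb.mono (by omega)) hK
    choose D hD hD' using fun j => ih' (hcS j) (hcK j)
    have hDs : 0 ≤ ∑ j, D j := Finset.sum_nonneg fun j _ => (hD j).le
    refine ⟨C0 + ∑ j, D j, by positivity, fun i u hu => ?_⟩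
    obtain ⟨B, _, hB⟩ := hb.bound
    have hB' : ∀ z, ‖b i z‖ ≤ B := fun z => hB i z (Set.mem_univ _)
    have hφc := (hφ.smooth i).continuous
    have hbc := (hb.smooth i).continuous
    have hTc := Tk_cont hφc hbc hB' (hK i) hu.integrable
    have key : ∀ j x, ((x j : ℝ) : ℂ) * Tk (φ i) (b i) u x =
        Tk (φ i) (c j i) (fun y => ((jap y : ℝ) : ℂ) * u y) x := by
      intro j x
      unfold Tk
      rw [← integral_const_mul]
      refine integral_congr_ae (ae_of_all _ fun y => ?_)
      simp only
      have e1 := ker_ibp (hφ.smooth i) (hb.smooth i) (hK i) x y (bv j)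
      have hd : Continuous (dLine ((0, bv j) : ES n × ES n) (φ i)) :=
        (contDiff_dLine (hφ.smooth i) _).continuous
      have e2 := ker_sub (φ := φ i) hφc (contDiff_dLine (hb.smooth i) (0, bv j)).continuous
        ((hK i).dLine (0, bv j))
        (c := fun z => ((dLine ((0, bv j) : ES n × ES n) (φ i) z : ℝ) : ℂ) * b i z)
        (by fun_prop) ((hK i).mul _) x y (I * (((jap y)⁻¹ : ℝ) : ℂ)) (-(((jap y)⁻¹ : ℝ) : ℂ)) (c j i)
        (fun ξ => by simp only [hc]; push_cast; ring)
      have e3 : (⟪x, bv j⟫ : ℝ) = x j := by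
        simp [bv, EuclideanSpace.inner_single_right]
      rw [e3] at e1
      have hj : ((jap y : ℝ) : ℂ) ≠ 0 := by exact_mod_cast (jap_pos y).ne'
      rw [e2, ← mul_assoc, e1]
      push_cast
      field_simp
      ring
    have hst := wt_step (w := fun x => jap x ^ (2 * N)) (w' := fun x => jap x ^ (2 * (N + 1)))
      (G := Tk (φ i) (b i) u) (D := 1)
      (continuous_jap.pow _) (fun x => pow_nonneg (jap_pos x).le _)
      (Finset.univ : Finset (Option (Fin n)))
      (F := fun o => o.elim (Tk (φ i) (b i) u) fun j x => ((x j : ℝ) : ℂ) * Tk (φ i) (b i) u x)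
      (by
        intro o _
        cases o with
        | none => exact hTc
        | some j => simp only [Option.elim]; fun_prop) zero_le_one (by
        intro x
        rw [Fintype.sum_option]
        simp only [Option.elim, norm_mul, Complex.norm_real, mul_pow, Real.norm_eq_abs, sq_abs]
        rw [← Finset.mul_sum, ← Finset.sum_mul, ← EuclideanSpace.real_norm_sq_eq, mul_add, pow_add,
          mul_one, jap_sq]
        apply le_of_eq
        ring)
    refine hst.trans ?_
    rw [ENNReal.ofReal_one, one_mul, Fintype.sum_option]
    simp only [Option.elim]
    have hfun : ∀ j, (fun x => ((x j : ℝ) : ℂ) * Tk (φ i) (b i) u x) =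
      Tk (φ i) (c j i) (fun y => ((jap y : ℝ) : ℂ) * u y) := fun j => funext (key j)
    simp only [hfun]
    have hm1 : Wt (fun x => jap x ^ (2 * N)) u ≤ Wt (fun x => jap x ^ (2 * (N + 1))) u := by
      refine lintegral_mono fun x => ENNReal.ofReal_le_ofReal ?_
      exact mul_le_mul_of_nonneg_right (pow_le_pow_right₀ (one_le_jap x) (by omega)) (by positivity)
    have hm2 : Wt (fun x => jap x ^ (2 * N)) (fun y => ((jap y : ℝ) : ℂ) * u y) =
        Wt (fun x => jap x ^ (2 * (N + 1))) u := by
      refine lintegral_congr fun x => ?_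
      simp only [norm_mul, Complex.norm_real, mul_pow, Real.norm_eq_abs, sq_abs]
      congr 1
      ring
    rw [ENNReal.ofReal_add hC0.le hDs, ENNReal.ofReal_sum_of_nonneg fun j _ => (hD j).le, add_mul,
      Finset.sum_mul]
    refine add_le_add ((h0 i u hu).trans (by gcongr)) (Finset.sum_le_sum fun j _ => ?_)
    rw [← hm2]
    exact hD' j i _ hu.jap

end LemB

section LemC
variable {n : ℕ} {ι : Type*}

lemma ker_sum {φ : ES n × ES n → ℝ} {J : Type*} (S : Finset J) {b : J → ES n × ES n → ℂ}
    (hφ : Continuous φ) (hb : ∀ j ∈ S, Continuous (b j)) (hK : ∀ j ∈ S, CK (b j)) (x y : ES n) :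
    ker φ (fun z => ∑ j ∈ S, b j z) x y = ∑ j ∈ S, ker φ (b j) x y := by
  unfold ker
  rw [← integral_finsetSum _ fun j hj => ker_integrable hφ (hb j hj) (hK j hj) x y]
  refine integral_congr_ae (ae_of_all _ fun ξ => ?_)
  simp only [Finset.mul_sum]

/-- the normalised square of the gradient -/
def qf (φ : ES n × ES n → ℝ) (z : ES n × ES n) : ℝ :=
  (jap z.1)⁻¹ * (jap z.1)⁻¹ + ∑ j, ((jap z.1)⁻¹ * dLine ((0, bv j) : ES n × ES n) φ z) *
    ((jap z.1)⁻¹ * dLine ((0, bv j) : ES n × ES n) φ z)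

lemma qf_pos (φ : ES n × ES n → ℝ) (z : ES n × ES n) : 0 < qf φ z := by
  unfold qf
  have := inv_pos.2 (jap_pos z.1)
  have h : 0 ≤ ∑ j, ((jap z.1)⁻¹ * dLine ((0, bv j) : ES n × ES n) φ z) *
    ((jap z.1)⁻¹ * dLine ((0, bv j) : ES n × ES n) φ z) :=
    Finset.sum_nonneg fun j _ => mul_self_nonneg _
  positivity

lemma qf_low {k : ℕ} {c0 : ℝ} {φ : ι → ES n × ES n → ℝ} (hφ : Phase k c0 φ) (hg : Grow k φ) :
    ∃ c : ℝ, 0 < c ∧ ∀ i z, c ≤ qf (φ i) z := by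
  choose G hG0 hG using fun j : Fin n => (hg (bv j)).bound
  have hc0 := hφ.pos
  have hGs : 0 ≤ ∑ j, G j ^ 2 := Finset.sum_nonneg fun j _ => sq_nonneg _
  set M : ℝ := 1 + (2 + 2 * ∑ j, G j ^ 2) / c0 with hM
  have hM0 : 0 < M := by positivity
  refine ⟨M⁻¹, by positivity, fun i z => ?_⟩
  obtain ⟨y, ξ⟩ := z
  set S := ∑ j, dLine ((0, bv j) : ES n × ES n) (φ i) (y, ξ) ^ 2 with hS
  have hS0 : 0 ≤ S := Finset.sum_nonneg fun j _ => sq_nonneg _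
  have h1 := hφ.low1 i y 0 ξ
  have hz : jap (0 : ES n) = 1 := by simp [jap]
  have h2 : c0 * ‖y‖ ^ 2 ≤ 2 * S + 2 * ∑ j, G j ^ 2 := by
    rw [sub_zero] at h1
    refine h1.trans ?_
    rw [hS, Finset.mul_sum, Finset.mul_sum, ← Finset.sum_add_distrib]
    refine Finset.sum_le_sum fun j _ => ?_
    have h3 := hG j i (0, ξ) (Set.mem_univ _)
    simp only [hz, inv_one, one_mul, Real.norm_eq_abs] at h3
    have h4 := sq_le_sq' (abs_le.1 h3).1 (abs_le.1 h3).2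
    nlinarith [sq_nonneg (dLine ((0, bv j) : ES n × ES n) (φ i) (y, ξ) +
      dLine ((0, bv j) : ES n × ES n) (φ i) (0, ξ))]
  have h5 : ‖y‖ ^ 2 ≤ (2 * S + 2 * ∑ j, G j ^ 2) / c0 := by
    rw [le_div_iff₀ hc0]; linarith
  have h6 : jap y ^ 2 ≤ M * (1 + S) := by
    rw [jap_sq, hM]
    have : (2 * S + 2 * ∑ j, G j ^ 2) / c0 ≤ (2 + 2 * ∑ j, G j ^ 2) / c0 * (1 + S) := by
      rw [div_mul_eq_mul_div]
      gcongr
      nlinarith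
    nlinarith
  have h7 : qf (φ i) (y, ξ) = (1 + S) / jap y ^ 2 := by
    unfold qf
    rw [hS, add_div, Finset.sum_div]
    have := jap_pos y
    congr 1
    · simp only; field_simp
    · refine Finset.sum_congr rfl fun j _ => ?_
      simp only; field_simp
  rw [h7, le_div_iff₀ (pow_pos (jap_pos y) 2), inv_mul_le_iff₀ hM0]
  exact h6

lemma Sy_q {k : ℕ} {c0 : ℝ} {φ : ι → ES n × ES n → ℝ} (hφ : Phase k c0 φ) (hg : Grow k φ) :
    Sy (fun _ => Set.univ) k (fun i z => (qf (φ i) z)⁻¹) := by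
  obtain ⟨c, hc, h⟩ := qf_low hφ hg
  refine Sy.inv hc ?_ (fun i z => (qf_pos _ z).ne') fun i z _ => ?_
  · exact ((Sy_jap1 k).mul (Sy_jap1 k)).add (Sy.sum _ fun j _ => (hg (bv j)).mul (hg (bv j)))
  · rw [Real.norm_eq_abs, abs_of_pos (qf_pos _ z)]
    exact h i z

set_option maxHeartbeats 1000000 in
theorem lemmaC {c0 : ℝ} {φ : ι → ES n × ES n → ℝ} (N : ℕ) :
    Phase (3 * n + 2 + N) c0 φ → Grow (3 * n + 2 + N) φ →
    ∀ {b : ι → ES n × ES n → ℂ}, Sy (fun _ => Set.univ) (3 * n + 2 + N) b → (∀ i, CK (b i)) →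
    ∃ C : ℝ, 0 < C ∧ ∀ i (u : ES n → ℂ), Nice u →
      Wt (fun x => (jap x ^ (2 * N))⁻¹) (Tk (φ i) (b i) u) ≤
        ENNReal.ofReal C * Wt (fun x => (jap x ^ (2 * N))⁻¹) u := by
  induction N with
  | zero =>
    intro hφ hg b hb hK
    simpa using L2bound (by omega) hφ hb hK
  | succ N ih =>
    intro hφ hg b hb hK
    have ih' := @ih (hφ.mono (by omega)) (fun w => (hg w).mono (by omega))
    have hq := Sy_q hφ hg
    set e : ι → ES n × ES n → ℂ := fun i z =>
      (((jap z.1)⁻¹ * (qf (φ i) z)⁻¹ : ℝ) : ℂ) * b i z with he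
    set c : Fin n → ι → ES n × ES n → ℂ := fun j i z =>
      ((((jap z.1)⁻¹ * dLine ((0, bv j) : ES n × ES n) (φ i) z) * (qf (φ i) z)⁻¹ : ℝ) : ℂ) * b i z with hc
    set d : ι → ES n × ES n → ℂ := fun i z =>
      1 * e i z + I * ∑ j, dLine ((0, bv j) : ES n × ES n) (c j i) z with hd
    have heS : Sy (fun _ => Set.univ) (3 * n + 2 + (N + 1)) e :=
      ((Sy_jap1 _).mul hq).ofReal.mul hb
    have hcS : ∀ j, Sy (fun _ => Set.univ) (3 * n + 2 + (N + 1)) (c j) := fun j =>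
      ((hg (bv j)).mul hq).ofReal.mul hb
    have hdS : Sy (fun _ => Set.univ) (3 * n + 2 + N) d := by
      have h1 : Sy (fun _ : ι => Set.univ) (3 * n + 2 + N) (fun (_ : ι) (_ : ES n × ES n) => I) :=
        Sy.const _ (C := 1) (by simp)
      have h2 : Sy (fun _ : ι => Set.univ) (3 * n + 2 + N) (fun (_ : ι) (_ : ES n × ES n) => (1 : ℂ)) :=
        Sy.const _ (C := 1) (by simp)
      exact (h2.mul (heS.mono (by omega))).add (h1.mul (Sy.sum _ fun j _ => (hcS j).d _))
    have heK : ∀ i, CK (e i) := fun i => (hK i).mul _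
    have hcK : ∀ j i, CK (c j i) := fun j i => (hK i).mul _
    have hsK : ∀ i, CK (fun z => ∑ j, dLine ((0, bv j) : ES n × ES n) (c j i) z) := fun i =>
      CK.sum _ fun j _ => (hcK j i).dLine _
    have hdK : ∀ i, CK (d i) := fun i => ((heK i).mul _).add ((hsK i).mul _)
    obtain ⟨C0, hC0, h0⟩ := ih' hdS hdK
    choose D hD hD' using fun j => ih' ((hcS j).mono (by omega)) (hcK j)
    have hDs : 0 ≤ ∑ j, D j := Finset.sum_nonneg fun j _ => (hD j).le
    refine ⟨(n + 1) * (C0 + ∑ j, D j), by positivity, fun i u hu => ?_⟩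
    obtain ⟨Bd, _, hBd⟩ := hdS.bound
    choose Bc hBc0 hBc using fun j => (hcS j).bound
    have hφc := (hφ.smooth i).continuous
    have hbc := (hb.smooth i).continuous
    have hu' := hu.japinv
    set ũ : ES n → ℂ := fun y => (((jap y)⁻¹ : ℝ) : ℂ) * u y with hũ
    have hTd := Tk_fub hφc (hdS.smooth i).continuous (fun z => hBd i z (Set.mem_univ _)) (hdK i) hu'.integrable
    have hTc := fun j => Tk_fub hφc ((hcS j).smooth i).continuous (fun z => hBc j i z (Set.mem_univ _))
      (hcK j i) hu'.integrable
    have kk : ∀ x y, ker (φ i) (b i) x y * u y = ker (φ i) (d i) x y * ũ y -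
        ∑ j, ((x j : ℝ) : ℂ) * (ker (φ i) (c j i) x y * ũ y) := by
      intro x y
      have hdc : ∀ j : Fin n, Continuous (dLine ((0, bv j) : ES n × ES n) (φ i)) := fun j =>
        (contDiff_dLine (hφ.smooth i) _).continuous
      have hcc : ∀ j, Continuous (c j i) := fun j => ((hcS j).smooth i).continuous
      have e1 : ∀ j, ((x j : ℝ) : ℂ) * ker (φ i) (c j i) x y =
          I * ker (φ i) (dLine ((0, bv j) : ES n × ES n) (c j i)) x y -
          ker (φ i) (fun z => ((dLine ((0, bv j) : ES n × ES n) (φ i) z : ℝ) : ℂ) * c j i z) x y := by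
        intro j
        have := ker_ibp (hφ.smooth i) ((hcS j).smooth i) (hcK j i) x y (bv j)
        have e3 : (⟪x, bv j⟫ : ℝ) = x j := by
          simp [bv, EuclideanSpace.inner_single_right]
        rwa [e3] at this
      have hsc : Continuous (fun z => ∑ j, dLine ((0, bv j) : ES n × ES n) (c j i) z) :=
        continuous_finsetSum _ fun j _ => (contDiff_dLine ((hcS j).smooth i) _).continuous
      have e2 : ker (φ i) (d i) x y = 1 * ker (φ i) (e i) x y +
          I * ker (φ i) (fun z => ∑ j, dLine ((0, bv j) : ES n × ES n) (c j i) z) x y :=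
        ker_sub hφc (heS.smooth i).continuous (heK i) hsc (hsK i) x y 1 I (d i) (fun ξ => rfl)
      have e3 := ker_sum (φ := φ i) Finset.univ
        (b := fun j => dLine ((0, bv j) : ES n × ES n) (c j i)) hφc
        (fun j _ => (contDiff_dLine ((hcS j).smooth i) _).continuous) (fun j _ => (hcK j i).dLine _) x y
      have e4 := ker_sum (φ := φ i) Finset.univ
        (b := fun j z => ((dLine ((0, bv j) : ES n × ES n) (φ i) z : ℝ) : ℂ) * c j i z) hφc
        (fun j _ => (Complex.continuous_ofReal.comp (hdc j)).mul (hcc j)) (fun j _ => (hcK j i).mul _) x y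
      have e5 : ker (φ i) (fun z => ∑ j, ((dLine ((0, bv j) : ES n × ES n) (φ i) z : ℝ) : ℂ) * c j i z) x y
          = ((jap y : ℝ) : ℂ) * ker (φ i) (b i) x y + (-1) * ker (φ i) (e i) x y := by
        refine ker_sub hφc hbc (hK i) (heS.smooth i).continuous (heK i) x y _ _ _ fun ξ => ?_
        have hq0 := qf_pos (φ i) (y, ξ)
        have hj0 := jap_pos y
        have hr : ∑ j, dLine ((0, bv j) : ES n × ES n) (φ i) (y, ξ) *
            (((jap y)⁻¹ * dLine ((0, bv j) : ES n × ES n) (φ i) (y, ξ)) * (qf (φ i) (y, ξ))⁻¹)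
            = jap y - (jap y)⁻¹ * (qf (φ i) (y, ξ))⁻¹ := by
          have hqq : qf (φ i) (y, ξ) = (jap y)⁻¹ * (jap y)⁻¹ + ∑ j, ((jap y)⁻¹ * dLine ((0, bv j) : ES n × ES n) (φ i) (y, ξ)) *
              ((jap y)⁻¹ * dLine ((0, bv j) : ES n × ES n) (φ i) (y, ξ)) := rfl
          have h1 : ∑ j, dLine ((0, bv j) : ES n × ES n) (φ i) (y, ξ) *
            (((jap y)⁻¹ * dLine ((0, bv j) : ES n × ES n) (φ i) (y, ξ)) * (qf (φ i) (y, ξ))⁻¹)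
            = jap y * (∑ j, ((jap y)⁻¹ * dLine ((0, bv j) : ES n × ES n) (φ i) (y, ξ)) *
              ((jap y)⁻¹ * dLine ((0, bv j) : ES n × ES n) (φ i) (y, ξ))) * (qf (φ i) (y, ξ))⁻¹ := by
            rw [Finset.mul_sum, Finset.sum_mul]
            refine Finset.sum_congr rfl fun j _ => ?_
            field_simp
          have h2 : (∑ j, ((jap y)⁻¹ * dLine ((0, bv j) : ES n × ES n) (φ i) (y, ξ)) *
              ((jap y)⁻¹ * dLine ((0, bv j) : ES n × ES n) (φ i) (y, ξ))) =
              qf (φ i) (y, ξ) - (jap y)⁻¹ * (jap y)⁻¹ := by rw [hqq]; ring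
          rw [h1, h2]
          field_simp
        have h2 := congrArg (fun t : ℝ => (t : ℂ) * b i (y, ξ)) hr
        simp only [hc, he]
        rw [show ((jap y : ℝ) : ℂ) * b i (y, ξ) + -1 * ((((jap y)⁻¹ * (qf (φ i) (y, ξ))⁻¹ : ℝ) : ℂ) * b i (y, ξ))
          = ((jap y - (jap y)⁻¹ * (qf (φ i) (y, ξ))⁻¹ : ℝ) : ℂ) * b i (y, ξ) by push_cast; ring, ← h2]
        push_cast
        rw [Finset.sum_mul]
        refine Finset.sum_congr rfl fun j _ => ?_
        ring
      have hj : ((jap y : ℝ) : ℂ) ≠ 0 := by exact_mod_cast (jap_pos y).ne'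
      have e6 : ∑ j, ((x j : ℝ) : ℂ) * (ker (φ i) (c j i) x y * ũ y) =
          (∑ j, ((x j : ℝ) : ℂ) * ker (φ i) (c j i) x y) * ũ y := by
        rw [Finset.sum_mul]
        exact Finset.sum_congr rfl fun j _ => by ring
      rw [e6]
      simp only [e1]
      rw [Finset.sum_sub_distrib, ← Finset.mul_sum, ← e4, ← e3, e5, e2]
      simp only [hũ]
      push_cast
      field_simp
      ring
    have key : ∀ x, Tk (φ i) (b i) u x = Tk (φ i) (d i) ũ x -
        ∑ j, ((x j : ℝ) : ℂ) * Tk (φ i) (c j i) ũ x := by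
      intro x
      unfold Tk
      simp only [kk, ← integral_const_mul]
      have hI : ∀ j ∈ (Finset.univ : Finset (Fin n)), Integrable fun y =>
        ((x j : ℝ) : ℂ) * (ker (φ i) (c j i) x y * ũ y) := fun j _ => (hTc j x).1.const_mul _
      rw [integral_sub (hTd x).1 (integrable_finsetSum _ hI), integral_finsetSum _ hI]
    have hst := wt_step (w := fun x => (jap x ^ (2 * N))⁻¹) (w' := fun x => (jap x ^ (2 * (N + 1)))⁻¹)
      (G := Tk (φ i) (b i) u) (D := n + 1)
      ((continuous_jap.pow _).inv₀ fun x => (pow_pos (jap_pos x) _).ne')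
      (fun x => inv_nonneg.2 (pow_nonneg (jap_pos x).le _))
      (Finset.univ : Finset (Option (Fin n)))
      (F := fun o => o.elim (Tk (φ i) (d i) ũ) fun j => Tk (φ i) (c j i) ũ)
      (by
        intro o _
        cases o with
        | none => exact Tk_cont hφc (hdS.smooth i).continuous (fun z => hBd i z (Set.mem_univ _)) (hdK i) hu'.integrable
        | some j => exact Tk_cont hφc ((hcS j).smooth i).continuous (fun z => hBc j i z (Set.mem_univ _))
                      (hcK j i) hu'.integrable) (by positivity) (by
        intro x
        have hjx := jap_pos x
        have hn : ‖Tk (φ i) (b i) u x‖ ≤ jap x * ∑ o : Option (Fin n),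
            ‖o.elim (Tk (φ i) (d i) ũ) (fun j => Tk (φ i) (c j i) ũ) x‖ := by
          rw [key, Fintype.sum_option, mul_add]
          refine (norm_sub_le _ _).trans (add_le_add ?_ ?_)
          · exact le_mul_of_one_le_left (norm_nonneg _) (one_le_jap x)
          · refine (norm_sum_le _ _).trans ?_
            rw [Finset.mul_sum]
            refine Finset.sum_le_sum fun j _ => ?_
            rw [norm_mul, Complex.norm_real]
            refine mul_le_mul_of_nonneg_right ?_ (norm_nonneg _)
            exact (PiLp.norm_apply_le x j).trans (norm_le_jap x)
        have hsq := sq_sum_le_card_mul_sum_sq (s := (Finset.univ : Finset (Option (Fin n))))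
          (f := fun o => ‖o.elim (Tk (φ i) (d i) ũ) (fun j => Tk (φ i) (c j i) ũ) x‖)
        rw [Finset.card_univ, Fintype.card_option, Fintype.card_fin] at hsq
        push_cast at hsq
        rw [← Finset.mul_sum]
        have h3 : ‖Tk (φ i) (b i) u x‖ ^ 2 ≤ jap x ^ 2 * ((n + 1) * ∑ o : Option (Fin n),
            ‖o.elim (Tk (φ i) (d i) ũ) (fun j => Tk (φ i) (c j i) ũ) x‖ ^ 2) := by
          refine (pow_le_pow_left₀ (norm_nonneg _) hn 2).trans ?_
          rw [mul_pow]
          gcongr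
        rw [inv_mul_le_iff₀ (by positivity)]
        refine h3.trans (le_of_eq ?_)
        rw [mul_add, pow_add, mul_one]
        field_simp)
    refine hst.trans ?_
    rw [Fintype.sum_option]
    simp only [Option.elim]
    have hm2 : Wt (fun x => (jap x ^ (2 * N))⁻¹) ũ =
        Wt (fun x => (jap x ^ (2 * (N + 1)))⁻¹) u := by
      refine lintegral_congr fun x => ?_
      have := jap_pos x
      simp only [hũ, norm_mul, Complex.norm_real, mul_pow, Real.norm_eq_abs, sq_abs]
      congr 1
      rw [mul_add, pow_add, mul_one]
      field_simp
    rw [ENNReal.ofReal_mul (by positivity), mul_assoc, ENNReal.ofReal_add hC0.le hDs,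
      ENNReal.ofReal_sum_of_nonneg fun j _ => (hD j).le, add_mul, Finset.sum_mul, ← hm2]
    gcongr with j _
    · exact h0 i _ hu'
    · exact hD' j i _ hu'

end LemC

section StepD
variable {n : ℕ} {ι : Type*}

lemma cs_lint {μ : Measure (ES n)} {g : ES n → ℝ≥0∞} (hg : AEMeasurable g μ) :
    (∫⁻ s, g s ∂μ) ^ 2 ≤ μ Set.univ * ∫⁻ s, g s ^ 2 ∂μ := by
  have h := ENNReal.lintegral_mul_le_Lp_mul_Lq μ (p := 2) (q := 2)
    (by constructor <;> norm_num) (f := fun _ => 1) (g := g) aemeasurable_const hg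
  simp only [Pi.mul_apply, one_mul, ENNReal.one_rpow, lintegral_const] at h
  have h2 := ENNReal.rpow_le_rpow h (z := 2) (by norm_num)
  rw [ENNReal.mul_rpow_of_nonneg _ _ (by norm_num), ← ENNReal.rpow_mul, ← ENNReal.rpow_mul] at h2
  norm_num at h2
  exact h2

lemma Tk_prod {φ : ES n × ES n → ℝ} {b : ES n × ES n → ℂ} (hφ : Continuous φ)
    (hb : Continuous b) {B : ℝ} (hB : ∀ z, ‖b z‖ ≤ B) (hK : CK b) {u : ES n → ℂ} (hu : Integrable u)
    (x : ES n) : Tk φ b u x = ∫ z : ES n × ES n, osc (⟪x, z.2⟫ + φ z) * b z * u z.1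
      ∂(volume.prod volume) := by
  have hosc := continuous_osc
  have h1 := (Bop_props (φ := fun z => ⟪x, z.2⟫ + φ z) (by fun_prop) hb hB hK hu).1
  have h2 := integral_prod _ h1
  simp only at h2
  rw [h2]
  unfold Tk ker
  refine integral_congr_ae (ae_of_all _ fun y => ?_)
  simp only
  rw [integral_mul_const]

/-- amplitude slices -/
def slc (c : ES n × (ES n × ES n) → ℂ) (s : ES n) : ES n × ES n → ℂ :=
  fun v => dList (dirs1 n (ES n × ES n)) c (s, v)

lemma dList_zero {c : ES n × (ES n × ES n) → ℂ} {K : Set (ES n × (ES n × ES n))} (hK : IsClosed K)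
    (hc : ∀ z, z ∉ K → c z = 0) (l : List (ES n × (ES n × ES n))) :
    ∀ z, z ∉ K → dList l c z = 0 := by
  intro z hz
  by_contra h
  have h1 : z ∈ tsupport c := tsupport_dList l c (subset_tsupport _ h)
  have h2 : tsupport c ⊆ K := closure_minimal (fun w hw => by
    by_contra h3; exact hw (hc w h3)) hK
  exact hz (h2 h1)

lemma slc_CK {c : ES n × (ES n × ES n) → ℂ} {K : Set (ES n)} (hK : IsCompact K)
    (hc : ∀ z y ξ, ξ ∉ K → c (z, y, ξ) = 0) (s y ξ : ES n) (h : ξ ∉ K) : slc c s (y, ξ) = 0 := by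
  refine dList_zero (K := {z | z.2.2 ∈ K}) (hK.isClosed.preimage (by fun_prop)) ?_ _ _ h
  rintro ⟨z, y, ξ⟩ hz
  exact hc z y ξ hz

lemma slc_Q {c : ES n × (ES n × ES n) → ℂ} {Q : Set (ES n)} (hQ : IsCompact Q)
    (hc : ∀ z v, z ∉ Q → c (z, v) = 0) (s : ES n) (v : ES n × ES n) (h : s ∉ Q) : slc c s v = 0 := by
  refine dList_zero (K := {z | z.1 ∈ Q}) (hQ.isClosed.preimage (by fun_prop)) ?_ _ _ h
  rintro ⟨z, v⟩ hz
  exact hc z v hz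

set_option maxHeartbeats 1000000 in
lemma stepD1 {φ : ES n × ES n → ℝ} (hφ : Continuous φ) {c : ES n × (ES n × ES n) → ℂ}
    (hc : ContDiff ℝ ∞ c) {Q K : Set (ES n)} (hQ : IsCompact Q) (hK : IsCompact K)
    (hcQ : ∀ z v, z ∉ Q → c (z, v) = 0) (hcK : ∀ z y ξ, ξ ∉ K → c (z, y, ξ) = 0)
    {B : ℝ} (hB : ∀ s v, ‖slc c s v‖ ≤ B) {u : ES n → ℂ} (hu : Integrable u) (x p : ES n) :
    ∫ ξ, ∫ y, osc (⟪x, ξ⟫ + φ (y, ξ)) * c (p, y, ξ) * u y =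
      ∫ s, orth s p * Tk φ (slc c s) u x := by
  have hosc := continuous_osc
  have hcc := hc.continuous
  have hsc : Continuous fun q : ES n × (ES n × ES n) => slc c q.1 q.2 :=
    (contDiff_dList _ hc).continuous
  have hsc' : ∀ s, Continuous (slc c s) := fun s => hsc.comp (f := fun v => (s, v)) (by fun_prop)
  have hCK : ∀ s, CK (slc c s) := fun s => ⟨K, hK, fun y ξ h => slc_CK hK hcK s y ξ h⟩
  have hB0 : 0 ≤ B := (norm_nonneg _).trans (hB 0 0)
  have hKi : ∀ c : ℝ, Integrable (K.indicator fun _ => c) := fun c =>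
    (integrable_indicator_iff hK.measurableSet).2 (by simp [hK.measure_lt_top])
  have hQi : ∀ c : ℝ, Integrable (Q.indicator fun _ => c) := fun c =>
    (integrable_indicator_iff hQ.measurableSet).2 (by simp [hQ.measure_lt_top])
  have hI : Integrable (fun q : ES n × (ES n × ES n) =>
      orth q.1 p * (osc (⟪x, q.2.2⟫ + φ q.2) * slc c q.1 q.2 * u q.2.1))
      (volume.prod (volume.prod volume)) := by
    refine ((hQi B).mul_prod (hu.norm.mul_prod (hKi 1))).mono' ?_ (ae_of_all _ ?_)
    · have m1 : Measurable fun q : ES n × (ES n × ES n) => orth q.1 p :=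
        measurable_orth.comp (f := fun q : ES n × (ES n × ES n) => (q.1, p)) (by fun_prop)
      refine m1.aestronglyMeasurable.mul (AEStronglyMeasurable.mul ?_ ?_)
      · exact Continuous.aestronglyMeasurable (by fun_prop)
      · exact (hu.1.comp_fst (ν := volume)).comp_snd
    · rintro ⟨s, y, ξ⟩
      simp only [norm_mul, norm_osc, one_mul]
      by_cases hs : s ∈ Q
      · by_cases hξ : ξ ∈ K
        · simp only [hs, hξ, Set.indicator_of_mem, mul_one]
          have h1 := norm_orth_le s p
          have h2 := hB s (y, ξ)
          calc ‖orth s p‖ * (‖slc c s (y, ξ)‖ * ‖u y‖) ≤ 1 * (B * ‖u y‖) := by gcongr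
            _ = _ := one_mul _
        · simp [slc_CK hK hcK s y ξ hξ, hξ]
      · simp [slc_Q hQ hcQ s (y, ξ) hs, hs]
  have e1 : ∀ s, orth s p * Tk φ (slc c s) u x = ∫ z : ES n × ES n,
      orth s p * (osc (⟪x, z.2⟫ + φ z) * slc c s z * u z.1) ∂(volume.prod volume) := by
    intro s
    rw [Tk_prod hφ (hsc' s) (hB s) (hCK s) hu, integral_const_mul]
  simp only [e1]
  have e2 := integral_integral_swap (f := fun s (z : ES n × ES n) =>
    orth s p * (osc (⟪x, z.2⟫ + φ z) * slc c s z * u z.1)) hI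
  rw [e2]
  have e3 : ∀ z : ES n × ES n, ∫ s, orth s p * (osc (⟪x, z.2⟫ + φ z) * slc c s z * u z.1) =
      osc (⟪x, z.2⟫ + φ z) * c (p, z) * u z.1 := by
    intro z
    rw [ftc hc hQ hcQ p z, ← integral_const_mul, ← integral_mul_const]
    refine integral_congr_ae (ae_of_all _ fun s => ?_)
    simp only [slc]
    ring
  have hI2 := hI.integral_prod_right
  simp only [e3] at hI2 ⊢
  have e4 := integral_prod_symm _ hI2
  rw [e4]

end StepD

section StepD2
variable {n : ℕ} {ι : Type*}

lemma Wt_mono {w w' : ES n → ℝ} {f g : ES n → ℂ} {k : ℝ} (hk : 0 ≤ k)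
    (h : ∀ x, w x * ‖f x‖ ^ 2 ≤ k * (w' x * ‖g x‖ ^ 2)) : Wt w f ≤ ENNReal.ofReal k * Wt w' g := by
  unfold Wt
  rw [← lintegral_const_mul' _ _ ENNReal.ofReal_ne_top]
  refine lintegral_mono fun x => ?_
  rw [← ENNReal.ofReal_mul hk]
  exact ENNReal.ofReal_le_ofReal (h x)

lemma meas_T {P : Type*} [TopologicalSpace P] [SecondCountableTopology P] [MeasurableSpace P]
    [BorelSpace P] (μ : Measure P) [SFinite μ]
    {φ : ES n × ES n → ℝ} (hφ : Continuous φ) {c : ES n × (ES n × ES n) → ℂ}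
    (hc : ContDiff ℝ ∞ c) {K : Set (ES n)} (hK : IsCompact K)
    (hcK : ∀ z y ξ, ξ ∉ K → c (z, y, ξ) = 0)
    {B : ℝ} (hB : ∀ s v, ‖slc c s v‖ ≤ B) {u : ES n → ℂ} (hu : Integrable u)
    {X S : P → ES n} (hX : Continuous X) (hS : Continuous S) :
    AEStronglyMeasurable (fun q => Tk φ (slc c (S q)) u (X q)) μ := by
  have hosc := continuous_osc
  have hcc := hc.continuous
  have hsc : Continuous fun q : ES n × (ES n × ES n) => slc c q.1 q.2 :=
    (contDiff_dList _ hc).continuous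
  have hsc' : ∀ s, Continuous (slc c s) := fun s => hsc.comp (f := fun v => (s, v)) (by fun_prop)
  have hCK : ∀ s, CK (slc c s) := fun s => ⟨K, hK, fun y ξ h => slc_CK hK hcK s y ξ h⟩
  simp only [fun q => Tk_prod hφ (hsc' (S q)) (hB (S q)) (hCK (S q)) hu (X q)]
  have h : AEStronglyMeasurable (fun q : P × (ES n × ES n) =>
      osc (⟪X q.1, q.2.2⟫ + φ q.2) * slc c (S q.1) q.2 * u q.2.1)
      (μ.prod (volume.prod volume)) := by
    refine AEStronglyMeasurable.mul ?_ ?_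
    · have : Continuous fun q : P × (ES n × ES n) => slc c (S q.1) q.2 :=
        hsc.comp (f := fun q : P × (ES n × ES n) => (S q.1, q.2)) (by fun_prop)
      exact Continuous.aestronglyMeasurable (by fun_prop)
    · exact (hu.1.comp_fst (ν := volume)).comp_snd
  exact h.integral_prod_right'

lemma stepD2 {φ : ES n × ES n → ℝ} (hφ : Continuous φ) {c : ES n × (ES n × ES n) → ℂ}
    (hc : ContDiff ℝ ∞ c) {Q K : Set (ES n)} (hQ : IsCompact Q) (hK : IsCompact K)
    (hcQ : ∀ z v, z ∉ Q → c (z, v) = 0) (hcK : ∀ z y ξ, ξ ∉ K → c (z, y, ξ) = 0)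
    {B : ℝ} (hB : ∀ s v, ‖slc c s v‖ ≤ B) {u : ES n → ℂ} (hu : Integrable u) (p : ES n → ES n)
    (E : Set (ES n)) {D : ℝ≥0∞} (hD : ∀ s, ∫⁻ x in E, ‖Tk φ (slc c s) u x‖ₑ ^ 2 ≤ D) :
    ∫⁻ x in E, ‖∫ ξ, ∫ y, osc (⟪x, ξ⟫ + φ (y, ξ)) * c (p x, y, ξ) * u y‖ₑ ^ 2 ≤
      volume Q * (volume Q * D) := by
  have h1 : ∀ x, ‖∫ ξ, ∫ y, osc (⟪x, ξ⟫ + φ (y, ξ)) * c (p x, y, ξ) * u y‖ₑ ^ 2 ≤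
      volume Q * ∫⁻ s in Q, ‖Tk φ (slc c s) u x‖ₑ ^ 2 := by
    intro x
    rw [stepD1 hφ hc hQ hK hcQ hcK hB hu]
    have hm : AEMeasurable (fun s => ‖Tk φ (slc c s) u x‖ₑ) (volume.restrict Q) :=
      (meas_T (volume.restrict Q) hφ hc hK hcK hB hu (X := fun _ => x) (S := id) continuous_const
        continuous_id).enorm
    have h2 := cs_lint hm
    rw [Measure.restrict_apply_univ] at h2
    refine le_trans ?_ h2
    gcongr
    refine (enorm_integral_le_lintegral_enorm _).trans ?_
    rw [← lintegral_indicator hQ.measurableSet]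
    refine lintegral_mono fun s => ?_
    by_cases hs : s ∈ Q
    · simp only [hs, Set.indicator_of_mem]
      rw [enorm_mul]
      have : ‖orth s (p x)‖ₑ ≤ 1 := by
        rw [← ofReal_norm_eq_enorm, ← ENNReal.ofReal_one]
        exact ENNReal.ofReal_le_ofReal (norm_orth_le s (p x))
      calc _ ≤ 1 * ‖Tk φ (slc c s) u x‖ₑ := by gcongr
        _ = _ := one_mul _
    · have : ∀ v, slc c s v = 0 := fun v => slc_Q hQ hcQ s v hs
      simp [Tk, ker, this]
  calc _ ≤ ∫⁻ x in E, volume Q * ∫⁻ s in Q, ‖Tk φ (slc c s) u x‖ₑ ^ 2 := lintegral_mono h1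
    _ = volume Q * ∫⁻ x in E, ∫⁻ s in Q, ‖Tk φ (slc c s) u x‖ₑ ^ 2 :=
      lintegral_const_mul' _ _ hQ.measure_lt_top.ne
    _ = volume Q * ∫⁻ s in Q, ∫⁻ x in E, ‖Tk φ (slc c s) u x‖ₑ ^ 2 := by
      rw [lintegral_lintegral_swap]
      exact ((meas_T ((volume.restrict E).prod (volume.restrict Q)) hφ hc hK hcK hB hu (X := Prod.fst)
        (S := Prod.snd) continuous_fst continuous_snd).enorm.pow_const 2)
    _ ≤ volume Q * ∫⁻ s in Q, D := by gcongr; exact hD _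
    _ = _ := by rw [setLIntegral_const, mul_comm D]

/-- the shell weight -/
def om (N : ℕ) (R : ℝ) (y : ES n) : ℝ := min ((jap y / R) ^ (2 * N)) ((R / jap y) ^ (2 * N))

lemma om_nonneg (N : ℕ) {R : ℝ} (hR : 0 < R) (y : ES n) : 0 ≤ om N R y := by
  have := jap_pos y
  exact le_min (by positivity) (by positivity)

lemma stepD3 {N : ℕ} {φ : ES n × ES n → ℝ} (hφ : Continuous φ) {b : ES n × ES n → ℂ}
    (hb : Continuous b) {B : ℝ} (hB : ∀ z, ‖b z‖ ≤ B) (hK : CK b) {C1 C2 : ℝ} (h1 : 0 ≤ C1) (h2 : 0 ≤ C2)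
    (hC1 : ∀ u, Nice u → Wt (fun x => jap x ^ (2 * N)) (Tk φ b u) ≤
      ENNReal.ofReal C1 * Wt (fun x => jap x ^ (2 * N)) u)
    (hC2 : ∀ u, Nice u → Wt (fun x => (jap x ^ (2 * N))⁻¹) (Tk φ b u) ≤
      ENNReal.ofReal C2 * Wt (fun x => (jap x ^ (2 * N))⁻¹) u)
    {R : ℝ} (hR : 0 < R) {u : ES n → ℂ} (hu : Nice u) :
    ∫⁻ x in {x | R ≤ jap x ∧ jap x < 2 * R}, ‖Tk φ b u x‖ₑ ^ 2 ≤
      ENNReal.ofReal (2 * (C1 + 4 ^ N * C2)) * Wt (om N R) u := by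
  have mS : MeasurableSet {y : ES n | jap y < R} := continuous_jap.measurable measurableSet_Iio
  have hfun : ∀ S : Set (ES n), MeasurableSet S → Nice (fun y => S.indicator (fun _ => (1:ℂ)) y * u y) := by
    intro S hS
    refine hu.mul_bdd (j := 0) ((measurable_const.indicator hS).aestronglyMeasurable) fun y => ?_
    by_cases h : y ∈ S <;> simp [h]
  set S := {y : ES n | jap y < R}
  have n1 := hfun S mS
  have n2 := hfun Sᶜ mS.compl
  set u1 := fun y => S.indicator (fun _ => (1:ℂ)) y * u y with hu1
  set u2 := fun y => Sᶜ.indicator (fun _ => (1:ℂ)) y * u y with hu2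
  have hadd : ∀ x, Tk φ b u x = Tk φ b u1 x + Tk φ b u2 x := by
    intro x
    unfold Tk
    rw [← integral_add (Tk_fub hφ hb hB hK n1.integrable x).1 (Tk_fub hφ hb hB hK n2.integrable x).1]
    refine integral_congr_ae (ae_of_all _ fun y => ?_)
    simp only [hu1, hu2]
    by_cases h : y ∈ S <;> simp [h]
  have mE : MeasurableSet {x : ES n | R ≤ jap x ∧ jap x < 2 * R} :=
    (measurableSet_le measurable_const continuous_jap.measurable).inter
      (measurableSet_lt continuous_jap.measurable measurable_const)
  -- first piece
  have p1 : ∫⁻ x in {x | R ≤ jap x ∧ jap x < 2 * R}, ‖Tk φ b u1 x‖ₑ ^ 2 ≤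
      ENNReal.ofReal C1 * Wt (om N R) u := by
    calc _ ≤ ∫⁻ x in {x | R ≤ jap x ∧ jap x < 2 * R},
          ENNReal.ofReal (R ^ (2 * N))⁻¹ * ENNReal.ofReal (jap x ^ (2 * N) * ‖Tk φ b u1 x‖ ^ 2) := by
          refine setLIntegral_mono' mE fun x hx => ?_
          rw [← ENNReal.ofReal_mul (by positivity), ← ofReal_norm_eq_enorm,
            ← ENNReal.ofReal_pow (norm_nonneg _)]
          refine ENNReal.ofReal_le_ofReal ?_
          rw [← mul_assoc]
          refine le_mul_of_one_le_left (by positivity) ?_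
          rw [inv_mul_eq_div, one_le_div (by positivity)]
          exact pow_le_pow_left₀ hR.le hx.1 _
      _ ≤ ∫⁻ x, ENNReal.ofReal (R ^ (2 * N))⁻¹ * ENNReal.ofReal (jap x ^ (2 * N) * ‖Tk φ b u1 x‖ ^ 2) :=
          setLIntegral_le_lintegral _ _
      _ = ENNReal.ofReal (R ^ (2 * N))⁻¹ * Wt (fun x => jap x ^ (2 * N)) (Tk φ b u1) :=
          lintegral_const_mul' _ _ ENNReal.ofReal_ne_top
      _ ≤ ENNReal.ofReal (R ^ (2 * N))⁻¹ * (ENNReal.ofReal C1 * Wt (fun x => jap x ^ (2 * N)) u1) := by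
          gcongr; exact hC1 _ n1
      _ ≤ ENNReal.ofReal (R ^ (2 * N))⁻¹ * (ENNReal.ofReal C1 *
          (ENNReal.ofReal (R ^ (2 * N)) * Wt (om N R) u)) := by
          gcongr
          refine Wt_mono (by positivity) fun x => ?_
          simp only [hu1]
          have hj := jap_pos x
          by_cases h : x ∈ S
          · have h' : jap x < R := h
            simp only [h, Set.indicator_of_mem, one_mul, ← mul_assoc]
            gcongr
            unfold om
            rw [min_eq_left]
            · rw [div_pow]; field_simp; exact le_rfl
            · refine pow_le_pow_left₀ (by positivity) ?_ _
              exact ((div_le_one hR).2 h'.le).trans ((one_le_div hj).2 h'.le)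
          · have := om_nonneg N hR x
            simp only [h, Set.indicator_of_notMem, not_false_eq_true, zero_mul, norm_zero]
            simp only [ne_eq, OfNat.ofNat_ne_zero, not_false_eq_true, zero_pow, mul_zero]
            positivity
      _ = _ := by
          have : ENNReal.ofReal (R ^ (2 * N))⁻¹ * ENNReal.ofReal (R ^ (2 * N)) = 1 := by
            rw [← ENNReal.ofReal_mul (by positivity), inv_mul_cancel₀ (by positivity), ENNReal.ofReal_one]
          rw [mul_left_comm, ← mul_assoc (ENNReal.ofReal (R ^ (2 * N))⁻¹), this, one_mul]
  have p2 : ∫⁻ x in {x | R ≤ jap x ∧ jap x < 2 * R}, ‖Tk φ b u2 x‖ₑ ^ 2 ≤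
      ENNReal.ofReal (4 ^ N * C2) * Wt (om N R) u := by
    calc _ ≤ ∫⁻ x in {x | R ≤ jap x ∧ jap x < 2 * R},
          ENNReal.ofReal ((2 * R) ^ (2 * N)) * ENNReal.ofReal ((jap x ^ (2 * N))⁻¹ * ‖Tk φ b u2 x‖ ^ 2) := by
          refine setLIntegral_mono' mE fun x hx => ?_
          rw [← ENNReal.ofReal_mul (by positivity), ← ofReal_norm_eq_enorm,
            ← ENNReal.ofReal_pow (norm_nonneg _)]
          refine ENNReal.ofReal_le_ofReal ?_
          rw [← mul_assoc]
          refine le_mul_of_one_le_left (by positivity) ?_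
          have hj := jap_pos x
          rw [← div_eq_mul_inv, one_le_div (by positivity)]
          exact pow_le_pow_left₀ hj.le hx.2.le _
      _ ≤ ∫⁻ x, ENNReal.ofReal ((2 * R) ^ (2 * N)) * ENNReal.ofReal ((jap x ^ (2 * N))⁻¹ * ‖Tk φ b u2 x‖ ^ 2) :=
          setLIntegral_le_lintegral _ _
      _ = ENNReal.ofReal ((2 * R) ^ (2 * N)) * Wt (fun x => (jap x ^ (2 * N))⁻¹) (Tk φ b u2) :=
          lintegral_const_mul' _ _ ENNReal.ofReal_ne_top
      _ ≤ ENNReal.ofReal ((2 * R) ^ (2 * N)) * (ENNReal.ofReal C2 * Wt (fun x => (jap x ^ (2 * N))⁻¹) u2) := by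
          gcongr; exact hC2 _ n2
      _ ≤ ENNReal.ofReal ((2 * R) ^ (2 * N)) * (ENNReal.ofReal C2 *
          (ENNReal.ofReal (R ^ (2 * N))⁻¹ * Wt (om N R) u)) := by
          gcongr
          refine Wt_mono (by positivity) fun x => ?_
          simp only [hu2]
          have hj := jap_pos x
          by_cases h : x ∈ S
          · have := om_nonneg N hR x
            have h' : x ∉ Sᶜ := by simpa using h
            simp only [h', Set.indicator_of_notMem, not_false_eq_true, zero_mul, norm_zero]
            simp only [ne_eq, OfNat.ofNat_ne_zero, not_false_eq_true, zero_pow, mul_zero]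
            positivity
          · have h' : R ≤ jap x := not_lt.1 h
            have h3 : x ∈ Sᶜ := h
            simp only [h3, Set.indicator_of_mem, one_mul, ← mul_assoc]
            gcongr
            unfold om
            rw [min_eq_right]
            · rw [div_pow]; field_simp; exact le_rfl
            · refine pow_le_pow_left₀ (by positivity) ?_ _
              exact ((div_le_one hj).2 h').trans ((one_le_div hR).2 h')
      _ = _ := by
          have : ENNReal.ofReal ((2 * R) ^ (2 * N)) * ENNReal.ofReal (R ^ (2 * N))⁻¹ =
              ENNReal.ofReal (4 ^ N) := by
            rw [← ENNReal.ofReal_mul (by positivity), mul_pow, mul_assoc, mul_inv_cancel₀ (by positivity),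
              mul_one, pow_mul]
            norm_num
          rw [mul_left_comm, ← mul_assoc (ENNReal.ofReal ((2 * R) ^ (2 * N))), this, ← mul_assoc,
            ← ENNReal.ofReal_mul h2, mul_comm C2]
  have mT := (Tk_cont hφ hb hB hK n1.integrable)
  calc _ ≤ ∫⁻ x in {x | R ≤ jap x ∧ jap x < 2 * R},
        (2 * ‖Tk φ b u1 x‖ₑ ^ 2 + 2 * ‖Tk φ b u2 x‖ₑ ^ 2) := by
        refine lintegral_mono fun x => ?_
        simp only [← ofReal_norm_eq_enorm]
        rw [← ENNReal.ofReal_pow (norm_nonneg _), ← ENNReal.ofReal_pow (norm_nonneg _),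
          ← ENNReal.ofReal_pow (norm_nonneg _), ← ENNReal.ofReal_ofNat, ← ENNReal.ofReal_mul (by norm_num),
          ← ENNReal.ofReal_mul (by norm_num), ← ENNReal.ofReal_add (by positivity) (by positivity)]
        refine ENNReal.ofReal_le_ofReal ?_
        rw [hadd]
        have h := norm_add_le (Tk φ b u1 x) (Tk φ b u2 x)
        have h0 := norm_nonneg (Tk φ b u1 x + Tk φ b u2 x)
        nlinarith [sq_nonneg (‖Tk φ b u1 x‖ - ‖Tk φ b u2 x‖)]
    _ = 2 * (∫⁻ x in {x | R ≤ jap x ∧ jap x < 2 * R}, ‖Tk φ b u1 x‖ₑ ^ 2) +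
        2 * (∫⁻ x in {x | R ≤ jap x ∧ jap x < 2 * R}, ‖Tk φ b u2 x‖ₑ ^ 2) := by
        rw [lintegral_add_left, lintegral_const_mul' _ _ (by simp), lintegral_const_mul' _ _ (by simp)]
        exact (mT.enorm.measurable.pow_const 2).const_mul 2
    _ ≤ 2 * (ENNReal.ofReal C1 * Wt (om N R) u) + 2 * (ENNReal.ofReal (4 ^ N * C2) * Wt (om N R) u) := by
        gcongr
    _ = _ := by
        rw [ENNReal.ofReal_mul (p := 2) (by norm_num), ENNReal.ofReal_add h1 (by positivity), ENNReal.ofReal_ofNat]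
        ring

end StepD2

section StepD4
variable {n : ℕ} {ι : Type*}


lemma om_term1 {N : ℕ} {m : ℝ} (hN : |m| + 1 ≤ N) {R : ℝ} (hR : 0 < R) (y : ES n) (h : R ≤ jap y) :
    R ^ (2 * m) * om N R y ≤ jap y ^ (2 * m) * (R / jap y) ^ 2 := by
  have hj := jap_pos y
  have hr : 0 < R / jap y := by positivity
  have e : R ^ (2 * m) = jap y ^ (2 * m) * (R / jap y) ^ (2 * m) := by
    rw [← Real.mul_rpow hj.le hr.le, mul_div_cancel₀ _ hj.ne']
  rw [e, mul_assoc]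
  refine mul_le_mul_of_nonneg_left ?_ (by positivity)
  calc (R / jap y) ^ (2 * m) * om N R y ≤ (R / jap y) ^ (2 * m) * (R / jap y) ^ (2 * N) := by
        gcongr; exact min_le_right _ _
    _ = (R / jap y) ^ (2 * m + ((2 * N : ℕ) : ℝ)) := by
        rw [Real.rpow_add hr, Real.rpow_natCast]
    _ ≤ (R / jap y) ^ ((2 : ℕ) : ℝ) := by
        refine Real.rpow_le_rpow_of_exponent_ge hr ((div_le_one hj).2 h) ?_
        push_cast
        linarith [neg_abs_le m]
    _ = _ := Real.rpow_natCast _ _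

lemma om_term2 {N : ℕ} {m : ℝ} (hN : |m| + 1 ≤ N) {R : ℝ} (hR : 0 < R) (y : ES n) (h : jap y ≤ R) :
    R ^ (2 * m) * om N R y ≤ jap y ^ (2 * m) * (jap y / R) ^ 2 := by
  have hj := jap_pos y
  have hr : 0 < jap y / R := by positivity
  have e : R ^ (2 * m) = jap y ^ (2 * m) * (jap y / R) ^ (-(2 * m)) := by
    rw [Real.rpow_neg hr.le, Real.div_rpow hj.le hR.le]
    field_simp
  rw [e, mul_assoc]
  refine mul_le_mul_of_nonneg_left ?_ (by positivity)
  calc (jap y / R) ^ (-(2 * m)) * om N R y ≤ (jap y / R) ^ (-(2 * m)) * (jap y / R) ^ (2 * N) := by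
        gcongr; exact min_le_left _ _
    _ = (jap y / R) ^ (-(2 * m) + ((2 * N : ℕ) : ℝ)) := by
        rw [Real.rpow_add hr, Real.rpow_natCast]
    _ ≤ (jap y / R) ^ ((2 : ℕ) : ℝ) := by
        refine Real.rpow_le_rpow_of_exponent_ge hr ((div_le_one hR).2 h) ?_
        push_cast
        linarith [le_abs_self m]
    _ = _ := Real.rpow_natCast _ _

lemma om_sum {N : ℕ} {m : ℝ} (hN : |m| + 1 ≤ N) (y : ES n) :
    ∑' j : ℕ, ENNReal.ofReal (((2:ℝ) ^ j) ^ (2 * m) * om N (2 ^ j) y) ≤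
      ENNReal.ofReal (8 / 3) * ENNReal.ofReal (jap y ^ (2 * m)) := by
  have hj := jap_pos y
  obtain ⟨J, hJ1, hJ2⟩ := exists_nat_pow_near (one_le_jap y) (by norm_num : (1:ℝ) < 2)
  have hgeo : HasSum (fun j : ℕ => ((1/4 : ℝ)) ^ j) (4/3) := by
    have := hasSum_geometric_of_lt_one (r := (1/4:ℝ)) (by norm_num) (by norm_num)
    convert this using 1; norm_num
  have hG : ∑' j : ℕ, ENNReal.ofReal ((1/4 : ℝ) ^ j) = ENNReal.ofReal (4/3) := by
    rw [← ENNReal.ofReal_tsum_of_nonneg (fun j => by positivity) hgeo.summable, hgeo.tsum_eq]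
  obtain ⟨T, hTd⟩ : ∃ T, T = jap y ^ (2 * m) := ⟨_, rfl⟩
  have hT : 0 ≤ T := by rw [hTd]; positivity
  rw [← hTd]
  rw [← (ENNReal.summable (f := fun j : ℕ => ENNReal.ofReal (((2:ℝ) ^ (j + (J + 1))) ^ (2 * m) * om N (2 ^ (j + (J + 1))) y))).sum_add_tsum_nat_add' (f := fun j : ℕ => ENNReal.ofReal (((2:ℝ) ^ j) ^ (2 * m) * om N (2 ^ j) y)) (k := J + 1)]
  have a1 : ∑ j ∈ Finset.range (J + 1), ENNReal.ofReal (((2:ℝ) ^ j) ^ (2 * m) * om N (2 ^ j) y) ≤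
      ENNReal.ofReal (4/3) * ENNReal.ofReal T := by
    calc _ ≤ ∑ j ∈ Finset.range (J + 1), ENNReal.ofReal ((1/4) ^ (J - j)) * ENNReal.ofReal T := by
          refine Finset.sum_le_sum fun j hj' => ?_
          have hjJ : j ≤ J := Nat.lt_succ_iff.1 (Finset.mem_range.1 hj')
          rw [← ENNReal.ofReal_mul (by positivity)]
          refine ENNReal.ofReal_le_ofReal ?_
          have h1 : (2:ℝ) ^ j ≤ jap y := (pow_le_pow_right₀ (by norm_num) hjJ).trans hJ1
          refine (om_term1 hN (by positivity) y h1).trans ?_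
          rw [mul_comm, ← hTd]
          refine mul_le_mul_of_nonneg_right ?_ hT
          calc ((2:ℝ) ^ j / jap y) ^ 2 ≤ ((2:ℝ) ^ j / 2 ^ J) ^ 2 := by gcongr
            _ = (1/4) ^ (J - j) := by
              have : (2:ℝ) ^ J = 2 ^ j * 2 ^ (J - j) := by rw [← pow_add]; congr 1; omega
              rw [this, div_mul_cancel_left₀ (by positivity), ← inv_pow, ← pow_mul, mul_comm, pow_mul]
              norm_num
      _ = (∑ j ∈ Finset.range (J + 1), ENNReal.ofReal ((1/4) ^ j)) * ENNReal.ofReal T := by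
          rw [Finset.sum_mul, ← Finset.sum_range_reflect (fun j => ENNReal.ofReal ((1/4) ^ j) * ENNReal.ofReal T)]
          refine Finset.sum_congr rfl fun j hj' => ?_
          have e : J + 1 - 1 - j = J - j := by omega
          rw [e]
      _ ≤ _ := by
          rw [← hG]
          gcongr
          exact ENNReal.sum_le_tsum _
  have a2 : ∑' j : ℕ, ENNReal.ofReal (((2:ℝ) ^ (j + (J + 1))) ^ (2 * m) * om N (2 ^ (j + (J + 1))) y) ≤
      ENNReal.ofReal (4/3) * ENNReal.ofReal T := by
    rw [← hG, ← ENNReal.tsum_mul_right]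
    refine ENNReal.tsum_le_tsum fun j => ?_
    rw [← ENNReal.ofReal_mul (by positivity)]
    refine ENNReal.ofReal_le_ofReal ?_
    have h1 : jap y ≤ (2:ℝ) ^ (j + (J + 1)) :=
      hJ2.le.trans (pow_le_pow_right₀ (by norm_num) (by omega))
    refine (om_term2 hN (by positivity) y h1).trans ?_
    rw [mul_comm, ← hTd]
    refine mul_le_mul_of_nonneg_right ?_ hT
    calc (jap y / (2:ℝ) ^ (j + (J + 1))) ^ 2 ≤ ((2:ℝ) ^ (J + 1) / 2 ^ (j + (J + 1))) ^ 2 := by gcongr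
      _ = (1/4) ^ j := by
        rw [pow_add 2 j, mul_comm, div_mul_cancel_left₀ (by positivity), ← inv_pow, ← pow_mul,
          mul_comm, pow_mul]
        norm_num
  refine (add_le_add a1 a2).trans (le_of_eq ?_)
  rw [← add_mul, ← ENNReal.ofReal_add (by norm_num) (by norm_num)]
  norm_num

lemma rpow_shell (m : ℝ) {R t : ℝ} (hR : 0 < R) (h1 : R ≤ t) (h2 : t ≤ 2 * R) :
    t ^ (2 * m) ≤ 4 ^ |m| * R ^ (2 * m) := by
  have ht : 0 < t := hR.trans_le h1
  have e : t ^ (2 * m) = R ^ (2 * m) * (t / R) ^ (2 * m) := by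
    rw [← Real.mul_rpow hR.le (by positivity), mul_div_cancel₀ _ hR.ne']
  rw [e, mul_comm]
  refine mul_le_mul_of_nonneg_right ?_ (by positivity)
  have h3 : 1 ≤ t / R := (one_le_div hR).2 h1
  have h4 : t / R ≤ 2 := (div_le_iff₀ hR).2 h2
  calc (t / R) ^ (2 * m) ≤ (t / R) ^ (2 * |m|) :=
        Real.rpow_le_rpow_of_exponent_le h3 (by linarith [le_abs_self m])
    _ ≤ 2 ^ (2 * |m|) := Real.rpow_le_rpow (by positivity) h4 (by positivity)
    _ = 4 ^ |m| := by rw [Real.rpow_mul (by norm_num)]; norm_num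

set_option maxHeartbeats 1000000 in
theorem stepD {N : ℕ} {m c0 : ℝ} (hN : |m| + 1 ≤ N) {φ : ι → ES n × ES n → ℝ}
    (hφ : Phase (3 * n + 2 + N) c0 φ) (hg : Grow (3 * n + 2 + N) φ)
    {A : ι × ℕ → ES n × (ES n × ES n) → ℂ} (hA : Sy (fun _ => Set.univ) (3 * n + 2 + N + n) A)
    {Q : Set (ES n)} (hQ : IsCompact Q) (hAQ : ∀ p z v, z ∉ Q → A p (z, v) = 0)
    (hAK : ∀ p, ∃ K, IsCompact K ∧ ∀ z y ξ, ξ ∉ K → A p (z, y, ξ) = 0) :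
    ∃ C, 0 < C ∧ ∀ i, ∀ a : ES n × (ES n × ES n) → ℂ,
      (∀ (j : ℕ) x, 2 ^ j ≤ jap x → jap x < 2 ^ (j + 1) → ∀ v, a (x, v) = A (i, j) (((2:ℝ) ^ j)⁻¹ • x, v)) →
      ∀ u, Nice u → Wt (fun x => jap x ^ (2 * m))
        (fun x => ∫ ξ, ∫ y, osc (⟪x, ξ⟫ + φ i (y, ξ)) * a (x, y, ξ) * u y) ≤
        ENNReal.ofReal C * Wt (fun x => jap x ^ (2 * m)) u := by
  -- slices
  have hlen : (dirs1 n (ES n × ES n)).length = n := by simp [dirs1]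
  have hS : Sy (fun _ : ι × ℕ × ES n => (Set.univ : Set (ES n × ES n))) (3 * n + 2 + N)
      (fun q => slc (A (q.1, q.2.1)) q.2.2) := by
    have h1 : Sy (fun _ => Set.univ) (3 * n + 2 + N)
        (fun p => dList (dirs1 n (ES n × ES n)) (A p)) := Sy.dList _ (by rw [hlen]; exact hA)
    have h2 := h1.affine (fun _ : ι × ℕ × ES n => (Set.univ : Set (ES n × ES n)))
      (fun q => (q.1, q.2.1)) (fun q => (q.2.2, 0)) (ContinuousLinearMap.inr ℝ (ES n) (ES n × ES n)) (by simp)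
    refine h2.congr fun q z => ?_
    simp [slc]
  choose K hK hKA using hAK
  have hCK : ∀ q : ι × ℕ × ES n, CK (slc (A (q.1, q.2.1)) q.2.2) := fun q =>
    ⟨K (q.1, q.2.1), hK _, fun y ξ h => slc_CK (hK _) (hKA _) _ y ξ h⟩
  have hφ' := hφ.reindex (fun q : ι × ℕ × ES n => q.1)
  have hg' : Grow (3 * n + 2 + N) (fun q : ι × ℕ × ES n => φ q.1) :=
    fun w => (hg w).reindex (fun q : ι × ℕ × ES n => q.1)
  obtain ⟨C1, h1, hC1⟩ := lemmaB N hφ' hg' hS hCK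
  obtain ⟨C2, h2, hC2⟩ := lemmaC N hφ' hg' hS hCK
  obtain ⟨B, hB0, hB⟩ := hS.bound
  set D := 2 * (C1 + 4 ^ N * C2)
  have hD : 0 < D := by positivity
  set V := (volume Q).toReal
  have hV : volume Q = ENNReal.ofReal V := (ENNReal.ofReal_toReal hQ.measure_lt_top.ne).symm
  have hV0 : 0 ≤ V := ENNReal.toReal_nonneg
  refine ⟨4 ^ |m| * (V * (V * D)) * (8 / 3) + 1, by positivity, fun i a ha u hu => ?_⟩
  set F := fun x => ∫ ξ, ∫ y, osc (⟪x, ξ⟫ + φ i (y, ξ)) * a (x, y, ξ) * u y with hF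
  have hφc := (hφ.smooth i).continuous
  let E : ℕ → Set (ES n) := fun j => {x | (2:ℝ) ^ j ≤ jap x ∧ jap x < 2 * 2 ^ j}
  have mE : ∀ j, MeasurableSet (E j) := fun j =>
    (measurableSet_le measurable_const continuous_jap.measurable).inter
      (measurableSet_lt continuous_jap.measurable measurable_const)
  have hcov : (⋃ j, E j) = Set.univ := by
    refine Set.eq_univ_of_forall fun x => ?_
    obtain ⟨J, hJ1, hJ2⟩ := exists_nat_pow_near (one_le_jap x) (by norm_num : (1:ℝ) < 2)
    exact Set.mem_iUnion.2 ⟨J, hJ1, by rw [pow_succ] at hJ2; linarith⟩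
  have hj : ∀ j, ∫⁻ x in E j, ‖F x‖ₑ ^ 2 ≤
      ENNReal.ofReal (V * (V * D)) * Wt (om N (2 ^ j)) u := by
    intro j
    have hcs : Continuous (A (i, j)) := (hA.smooth _).continuous
    have e : ∫⁻ x in E j, ‖F x‖ₑ ^ 2 = ∫⁻ x in E j, ‖∫ ξ, ∫ y, osc (⟪x, ξ⟫ + φ i (y, ξ)) *
        A (i, j) (((2:ℝ) ^ j)⁻¹ • x, y, ξ) * u y‖ₑ ^ 2 := by
      refine setLIntegral_congr_fun (mE j) fun x hx => ?_
      simp only [hF]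
      simp only [fun v => ha j x hx.1 (by rw [pow_succ]; linarith [hx.2]) v]
    rw [e]
    refine (stepD2 hφc (hA.smooth (i, j)) hQ (hK _) (hAQ _) (hKA _) (B := B)
      (fun s v => hB (i, j, s) v trivial) hu.integrable (fun x => ((2:ℝ) ^ j)⁻¹ • x) (E j)
      (D := ENNReal.ofReal D * Wt (om N (2 ^ j)) u) fun s => ?_).trans ?_
    · exact stepD3 hφc (hS.smooth (i, j, s)).continuous (fun z => hB (i, j, s) z trivial)
        (hCK (i, j, s)) h1.le h2.le (hC1 (i, j, s)) (hC2 (i, j, s)) (by positivity) hu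
    · rw [hV, ENNReal.ofReal_mul hV0, ENNReal.ofReal_mul hV0]
      simp only [mul_assoc]
      exact le_rfl
  have hfin : Wt (fun x => jap x ^ (2 * m)) F ≤
      ENNReal.ofReal (4 ^ |m| * (V * (V * D))) * ∑' j : ℕ, ENNReal.ofReal (((2:ℝ) ^ j) ^ (2 * m)) *
        Wt (om N (2 ^ j)) u := by
    calc Wt (fun x => jap x ^ (2 * m)) F
        = ∫⁻ x in ⋃ j, E j, ENNReal.ofReal (jap x ^ (2 * m) * ‖F x‖ ^ 2) := by
          rw [hcov, Measure.restrict_univ]; rfl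
      _ ≤ ∑' j, ∫⁻ x in E j, ENNReal.ofReal (jap x ^ (2 * m) * ‖F x‖ ^ 2) := lintegral_iUnion_le _ _
      _ ≤ ∑' j : ℕ, ENNReal.ofReal (4 ^ |m| * ((2:ℝ) ^ j) ^ (2 * m)) * ∫⁻ x in E j, ‖F x‖ₑ ^ 2 := by
          refine ENNReal.tsum_le_tsum fun j => ?_
          rw [← lintegral_const_mul' _ _ ENNReal.ofReal_ne_top]
          refine setLIntegral_mono' (mE j) fun x hx => ?_
          rw [← ofReal_norm_eq_enorm, ← ENNReal.ofReal_pow (norm_nonneg _),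
            ← ENNReal.ofReal_mul (by positivity)]
          refine ENNReal.ofReal_le_ofReal ?_
          gcongr
          exact rpow_shell m (by positivity) hx.1 hx.2.le
      _ ≤ ∑' j : ℕ, ENNReal.ofReal (4 ^ |m| * ((2:ℝ) ^ j) ^ (2 * m)) *
          (ENNReal.ofReal (V * (V * D)) * Wt (om N (2 ^ j)) u) := by
          gcongr with j; exact hj j
      _ = _ := by
          rw [← ENNReal.tsum_mul_left]
          refine tsum_congr fun j => ?_
          rw [ENNReal.ofReal_mul (by positivity), ENNReal.ofReal_mul (p := 4 ^ |m|) (by positivity)]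
          ring
  have hsw : ∑' j : ℕ, ENNReal.ofReal (((2:ℝ) ^ j) ^ (2 * m)) * Wt (om N (2 ^ j)) u ≤
      ENNReal.ofReal (8 / 3) * Wt (fun x => jap x ^ (2 * m)) u := by
    have hjm : Measurable (jap : ES n → ℝ) := continuous_jap.measurable
    calc _ = ∑' j : ℕ, ∫⁻ y, ENNReal.ofReal (((2:ℝ) ^ j) ^ (2 * m) * om N (2 ^ j) y) *
          ENNReal.ofReal (‖u y‖ ^ 2) := by
          refine tsum_congr fun j => ?_
          unfold Wt
          rw [← lintegral_const_mul' _ _ ENNReal.ofReal_ne_top]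
          refine lintegral_congr fun y => ?_
          have := om_nonneg N (R := 2 ^ j) (by positivity) y
          rw [← ENNReal.ofReal_mul (by positivity), ← ENNReal.ofReal_mul (by positivity), mul_assoc]
      _ = ∫⁻ y, ∑' j : ℕ, ENNReal.ofReal (((2:ℝ) ^ j) ^ (2 * m) * om N (2 ^ j) y) *
          ENNReal.ofReal (‖u y‖ ^ 2) := by
          rw [lintegral_tsum]
          intro j
          refine AEMeasurable.mul (f := fun y => ENNReal.ofReal (((2:ℝ) ^ j) ^ (2 * m) * om N (2 ^ j) y)) (Measurable.aemeasurable ?_) ?_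
          · unfold om; fun_prop
          · exact (hu.meas.norm.aemeasurable.pow_const 2).ennreal_ofReal
      _ ≤ ∫⁻ y, ENNReal.ofReal (8 / 3) * ENNReal.ofReal (jap y ^ (2 * m) * ‖u y‖ ^ 2) := by
          refine lintegral_mono fun y => ?_
          simp only
          have := jap_pos y
          rw [ENNReal.tsum_mul_right, ENNReal.ofReal_mul (p := jap y ^ (2 * m)) (by positivity), ← mul_assoc]
          gcongr
          exact om_sum hN y
      _ = _ := by rw [lintegral_const_mul' _ _ ENNReal.ofReal_ne_top]; rfl
  calc _ ≤ _ := hfin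
    _ ≤ ENNReal.ofReal (4 ^ |m| * (V * (V * D))) * (ENNReal.ofReal (8 / 3) *
        Wt (fun x => jap x ^ (2 * m)) u) := by gcongr
    _ ≤ _ := by
      rw [← mul_assoc, ← ENNReal.ofReal_mul (by positivity)]
      gcongr
      linarith

end StepD4

section StepE
variable {n : ℕ} {ι : Type*}

/-- cutoff on the line -/
def cutg : ContDiffBump (5 / 2 : ℝ) := ⟨3 / 2, 9 / 4, by norm_num, by norm_num⟩

/-- cutoff in the small parameter -/
def cutc : ContDiffBump (0 : ℝ) := ⟨1, 2, by norm_num, by norm_num⟩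

lemma cutg_one {t : ℝ} (h1 : 1 ≤ t) (h2 : t ≤ 4) : cutg t = 1 := by
  refine cutg.one_of_mem_closedBall ?_
  rw [Metric.mem_closedBall, Real.dist_eq, abs_le]
  have : cutg.rIn = 3 / 2 := rfl
  rw [this]
  constructor <;> linarith

lemma cutg_zero {t : ℝ} (h : cutg t ≠ 0) : 1 / 4 ≤ t ∧ t ≤ 19 / 4 := by
  have h1 : t ∈ Function.support (cutg : ℝ → ℝ) := h
  rw [cutg.support_eq, Metric.mem_ball, Real.dist_eq, abs_lt] at h1
  have : cutg.rOut = 9 / 4 := rfl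
  rw [this] at h1
  constructor <;> linarith [h1.1, h1.2]

/-- closed annulus sets -/
def ann (n : ℕ) (j : ℕ) : Set (ES n × (ES n × ES n)) :=
  {z | 1 / 4 ≤ ((4:ℝ) ^ j)⁻¹ + ‖z.1‖ ^ 2 ∧ ((4:ℝ) ^ j)⁻¹ + ‖z.1‖ ^ 2 ≤ 19 / 4}

lemma ann_closed (j : ℕ) : IsClosed (ann n j) := by
  have h : Continuous fun z : ES n × (ES n × ES n) => ((4:ℝ) ^ j)⁻¹ + ‖z.1‖ ^ 2 := by fun_prop
  exact (isClosed_le continuous_const h).inter (isClosed_le h continuous_const)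

lemma Sy_cut (k : ℕ) (s : ι × ℕ → Set (ES n × (ES n × ES n))) : Sy s k
    (fun (p : ι × ℕ) (z : ES n × (ES n × ES n)) => cutg (((4:ℝ) ^ p.2)⁻¹ + ‖z.1‖ ^ 2)) := by
  have hs : ContDiff ℝ ∞ (fun q : ℝ × ES n => cutg (q.1 + ‖q.2‖ ^ 2) * cutc q.1) := by
    refine ContDiff.mul (cutg.contDiff.comp (contDiff_fst.add ?_)) (cutc.contDiff.comp contDiff_fst)
    exact (contDiff_norm_sq ℝ).comp contDiff_snd
  have hc : HasCompactSupport (fun q : ℝ × ES n => cutg (q.1 + ‖q.2‖ ^ 2) * cutc q.1) := by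
    refine HasCompactSupport.intro (K := Metric.closedBall 0 2 ×ˢ Metric.closedBall 0 3)
      ((isCompact_closedBall _ _).prod (isCompact_closedBall _ _)) ?_
    rintro ⟨e, z⟩ hq
    by_contra h
    apply hq
    have h1 : cutg (e + ‖z‖ ^ 2) ≠ 0 := fun h0 => h (by simp [h0])
    have h2 : cutc e ≠ 0 := fun h0 => h (by simp [h0])
    have h3 := cutg_zero h1
    have h4 : e ∈ Function.support (cutc : ℝ → ℝ) := h2
    rw [cutc.support_eq, Metric.mem_ball, Real.dist_eq, abs_lt] at h4
    have : cutc.rOut = 2 := rfl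
    rw [this] at h4
    refine ⟨?_, ?_⟩
    · rw [Metric.mem_closedBall, Real.dist_eq, abs_le]; constructor <;> linarith [h4.1, h4.2]
    · rw [Metric.mem_closedBall, dist_zero_right]
      nlinarith [h4.1, h4.2, h3.2, norm_nonneg z]
  have h := (Sy.of_compact (fun _ : Unit => (Set.univ : Set (ℝ × ES n))) k hs hc).affine s (fun _ => ())
    (fun p => (((4:ℝ) ^ p.2)⁻¹, 0))
    ((ContinuousLinearMap.inr ℝ ℝ (ES n)).comp (ContinuousLinearMap.fst ℝ (ES n) (ES n × ES n)))
    (by simp)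
  refine h.congr fun p z => ?_
  have h1 : cutc ((4:ℝ) ^ p.2)⁻¹ = 1 := by
    refine cutc.one_of_mem_closedBall ?_
    have : cutc.rIn = 1 := rfl
    rw [this, Metric.mem_closedBall, dist_zero_right, Real.norm_eq_abs, abs_of_pos (by positivity)]
    exact inv_le_one_of_one_le₀ (one_le_pow₀ (by norm_num))
  simp [h1]

theorem stepE {N : ℕ} {m c0 : ℝ} (hN : |m| + 1 ≤ N) {φ : ι → ES n × ES n → ℝ}
    (hφ : Phase (3 * n + 2 + N) c0 φ) (hg : Grow (3 * n + 2 + N) φ)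
    {a : ι → ES n × (ES n × ES n) → ℂ}
    (ha : Sy (fun p : ι × ℕ => ann n p.2) (3 * n + 2 + N + n)
      (fun p z => a p.1 ((2:ℝ) ^ p.2 • z.1, z.2)))
    (haK : ∀ i, ∃ K, IsCompact K ∧ ∀ x y ξ, ξ ∉ K → a i (x, y, ξ) = 0) :
    ∃ C, 0 < C ∧ ∀ i, ∀ u, Nice u → Wt (fun x => jap x ^ (2 * m))
        (fun x => ∫ ξ, ∫ y, osc (⟪x, ξ⟫ + φ i (y, ξ)) * a i (x, y, ξ) * u y) ≤
        ENNReal.ofReal C * Wt (fun x => jap x ^ (2 * m)) u := by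
  have hA0 := (ha.mul (Sy_cut (ι := ι) _ _).ofReal)
  have hA := hA0.extend (fun p => closure_minimal (fun z hz => by
    have h1 : cutg (((4:ℝ) ^ p.2)⁻¹ + ‖z.1‖ ^ 2) ≠ 0 := fun h0 => hz (by simp [h0])
    exact cutg_zero h1) (ann_closed p.2))
  have hz1 : ∀ (p : ι × ℕ) (z : ES n) (v : ES n × ES n), z ∉ Metric.closedBall (0 : ES n) 3 →
      (fun (p : ι × ℕ) (z : ES n × (ES n × ES n)) => a p.1 ((2:ℝ) ^ p.2 • z.1, z.2) * ((cutg (((4:ℝ) ^ p.2)⁻¹ + ‖z.1‖ ^ 2) : ℝ) : ℂ)) p (z, v) = 0 := by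
    intro p z v hz
    have h1 : cutg (((4:ℝ) ^ p.2)⁻¹ + ‖z‖ ^ 2) = 0 := by
      by_contra h0
      apply hz
      have := cutg_zero h0
      have h5 : 0 < ((4:ℝ) ^ p.2)⁻¹ := by positivity
      rw [Metric.mem_closedBall, dist_zero_right]
      nlinarith [norm_nonneg z, this.2]
    simp [h1]
  have hz2 : ∀ p : ι × ℕ, ∃ K, IsCompact K ∧ ∀ z y ξ : ES n, ξ ∉ K →
      (fun (p : ι × ℕ) (z : ES n × (ES n × ES n)) => a p.1 ((2:ℝ) ^ p.2 • z.1, z.2) * ((cutg (((4:ℝ) ^ p.2)⁻¹ + ‖z.1‖ ^ 2) : ℝ) : ℂ)) p (z, y, ξ) = 0 := by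
    intro p
    obtain ⟨K, hK, h⟩ := haK p.1
    exact ⟨K, hK, fun z y ξ hξ => by simp [h _ y ξ hξ]⟩
  obtain ⟨C, hC, h⟩ := stepD hN hφ hg hA (Q := Metric.closedBall 0 3) (isCompact_closedBall _ _) hz1 hz2
  · refine ⟨C, hC, fun i u hu => h i (a i) ?_ u hu⟩
    intro j x h1 h2 v
    have e : ((4:ℝ) ^ j)⁻¹ + ‖((2:ℝ) ^ j)⁻¹ • x‖ ^ 2 = (jap x / 2 ^ j) ^ 2 := by
      rw [norm_smul, mul_pow, div_pow, jap_sq, norm_inv, norm_pow, inv_pow, ← pow_mul, mul_comm j, pow_mul]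
      norm_num
      field_simp
      rw [← pow_mul, mul_comm j, pow_mul]; norm_num
    simp only
    have h3 : (1:ℝ) ≤ jap x / 2 ^ j := (one_le_div (by positivity)).2 h1
    have h4 : jap x / 2 ^ j ≤ 2 := (div_le_iff₀ (by positivity)).2 (by rw [pow_succ] at h2; linarith)
    rw [e, cutg_one (by nlinarith) (by nlinarith), smul_smul, mul_inv_cancel₀ (by positivity), one_smul]
    simp

end StepE

section Conv
variable {n : ℕ} {ι : Type*} {W F : Type*} [NormedAddCommGroup W] [NormedSpace ℝ W]
    [NormedAddCommGroup F] [NormedSpace ℝ F]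

lemma contDiff_iter (v : W) (k : ℕ) : ∀ {f : W → F}, ContDiff ℝ ∞ f → ContDiff ℝ ∞ ((dLine v)^[k] f) := by
  induction k with
  | zero => intro f hf; exact hf
  | succ k ih => intro f hf; exact ih (contDiff_dLine hf v)

lemma iter_comm (v w : W) (k : ℕ) : ∀ {f : W → F}, ContDiff ℝ ∞ f →
    (dLine v)^[k] (dLine w f) = dLine w ((dLine v)^[k] f) := by
  induction k with
  | zero => intro f hf; rfl
  | succ k ih =>
    intro f hf
    simp only [Function.iterate_succ, Function.comp_apply]
    rw [dLine_comm hf v w, ih (contDiff_dLine hf v)]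

/-- partial fold -/
def mfold (d : Fin n → W) (L : List (Fin n)) (α : Fin n → ℕ) (g : W → F) : W → F :=
  ((L.map fun i => (dLine (d i) (F := F))^[α i]).foldr (· ∘ ·) id) g

lemma mfold_cons (d : Fin n → W) (i : Fin n) (L : List (Fin n)) (α : Fin n → ℕ) (g : W → F) :
    mfold d (i :: L) α g = (dLine (d i))^[α i] (mfold d L α g) := rfl

lemma mderiv_eq (d : Fin n → W) (α : Fin n → ℕ) (g : W → F) :
    mderiv d α g = mfold d (List.finRange n) α g := by
  unfold mderiv mfold
  rw [List.ofFn_eq_map]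

lemma contDiff_mfold (d : Fin n → W) (L : List (Fin n)) (α : Fin n → ℕ) {f : W → F} (hf : ContDiff ℝ ∞ f) :
    ContDiff ℝ ∞ (mfold d L α f) := by
  induction L with
  | nil => exact hf
  | cons i L ih => rw [mfold_cons]; exact contDiff_iter _ _ ih

lemma mfold_comm (d : Fin n → W) (L : List (Fin n)) (α : Fin n → ℕ) {f : W → F} (hf : ContDiff ℝ ∞ f)
    (w : W) : mfold d L α (dLine w f) = dLine w (mfold d L α f) := by
  induction L with
  | nil => rfl
  | cons i L ih => rw [mfold_cons, mfold_cons, ih, iter_comm _ _ _ (contDiff_mfold d L α hf)]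

lemma mfold_congr (d : Fin n → W) (L : List (Fin n)) {α β : Fin n → ℕ} (h : ∀ i ∈ L, α i = β i) (f : W → F) :
    mfold d L α f = mfold d L β f := by
  induction L with
  | nil => rfl
  | cons i L ih =>
    rw [mfold_cons, mfold_cons, ih (fun j hj => h j (List.mem_cons_of_mem _ hj)), h i (by simp)]

lemma mfold_single (d : Fin n → W) (L : List (Fin n)) (hL : L.Nodup) (α : Fin n → ℕ) {f : W → F}
    (hf : ContDiff ℝ ∞ f) (i : Fin n) (hi : i ∈ L) :
    mfold d L α (dLine (d i) f) = mfold d L (α + Pi.single i 1) f := by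
  induction L with
  | nil => simp at hi
  | cons j L ih =>
    rw [List.nodup_cons] at hL
    rw [mfold_cons, mfold_cons]
    by_cases hij : i = j
    · subst hij
      rw [mfold_comm d L α hf, mfold_congr d L (β := α + Pi.single i 1) (α := α)]
      · simp
      · intro k hk
        have : k ≠ i := fun h => hL.1 (h ▸ hk)
        simp [this]
    · rw [ih hL.2 (by simpa [hij] using hi)]
      have : j ≠ i := fun h => hij h.symm
      simp [this]

lemma contDiff_mderiv (d : Fin n → W) (α : Fin n → ℕ) {f : W → F} (hf : ContDiff ℝ ∞ f) :
    ContDiff ℝ ∞ (mderiv d α f) := by rw [mderiv_eq]; exact contDiff_mfold d _ α hf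

lemma mderiv_comm (d : Fin n → W) (α : Fin n → ℕ) {f : W → F} (hf : ContDiff ℝ ∞ f) (w : W) :
    mderiv d α (dLine w f) = dLine w (mderiv d α f) := by
  rw [mderiv_eq, mderiv_eq]; exact mfold_comm d _ α hf w

lemma mderiv_single (d : Fin n → W) (α : Fin n → ℕ) {f : W → F} (hf : ContDiff ℝ ∞ f) (i : Fin n) :
    mderiv d α (dLine (d i) f) = mderiv d (α + Pi.single i 1) f := by
  rw [mderiv_eq, mderiv_eq]
  exact mfold_single d _ (List.nodup_finRange n) α hf i (List.mem_finRange i)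

lemma mderiv_zero (d : Fin n → W) (f : W → F) : mderiv d 0 f = f := by
  rw [mderiv_eq]
  generalize List.finRange n = L
  induction L with
  | nil => rfl
  | cons i L ih => rw [mfold_cons, ih]; rfl

lemma mdeg_zero : mdeg (0 : Fin n → ℕ) = 0 := by simp [mdeg]

lemma mdeg_single (α : Fin n → ℕ) (i : Fin n) : mdeg (α + Pi.single i 1) = mdeg α + 1 := by
  simp [mdeg, Finset.sum_add_distrib]

lemma list1 (d : Fin n → W) (l : List (Fin n)) : ∃ α : Fin n → ℕ, mdeg α = l.length ∧
    ∀ f : W → F, ContDiff ℝ ∞ f → dList (l.map d) f = mderiv d α f := by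
  induction l with
  | nil => exact ⟨0, mdeg_zero, fun f _ => (mderiv_zero d f).symm⟩
  | cons i l ih =>
    obtain ⟨α, h1, h2⟩ := ih
    refine ⟨α + Pi.single i 1, by rw [mdeg_single, h1]; rfl, fun f hf => ?_⟩
    rw [← mderiv_single d α hf i, ← h2 _ (contDiff_dLine hf _)]
    rfl

lemma list2 (d1 d2 : Fin n → W) (l : List (Fin n ⊕ Fin n)) : ∃ α β : Fin n → ℕ,
    mdeg α ≤ l.length ∧ mdeg β ≤ l.length ∧
    ∀ f : W → F, ContDiff ℝ ∞ f → dList (l.map (Sum.elim d1 d2)) f = mderiv d1 α (mderiv d2 β f) := by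
  induction l with
  | nil => exact ⟨0, 0, by simp [mdeg_zero], by simp [mdeg_zero], fun f _ => by
      rw [mderiv_zero, mderiv_zero]; rfl⟩
  | cons i l ih =>
    obtain ⟨α, β, h1, h3, h2⟩ := ih
    rcases i with i | i
    · refine ⟨α + Pi.single i 1, β, by rw [mdeg_single]; simpa using h1, by simp; omega, fun f hf => ?_⟩
      rw [← mderiv_single d1 α (contDiff_mderiv d2 β hf) i, ← mderiv_comm d2 β hf,
        ← h2 _ (contDiff_dLine hf _)]
      rfl
    · refine ⟨α, β + Pi.single i 1, by simp; omega, by rw [mdeg_single]; simpa using h3, fun f hf => ?_⟩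
      rw [← mderiv_single d2 β hf i, ← h2 _ (contDiff_dLine hf _)]
      rfl

lemma list3 (d1 d2 d3 : Fin n → W) (l : List (Fin n ⊕ (Fin n ⊕ Fin n))) : ∃ α β γ : Fin n → ℕ,
    mdeg α = l.countP Sum.isLeft ∧ mdeg β ≤ l.length ∧ mdeg γ ≤ l.length ∧
    ∀ f : W → F, ContDiff ℝ ∞ f → dList (l.map (Sum.elim d1 (Sum.elim d2 d3))) f =
      mderiv d1 α (mderiv d2 β (mderiv d3 γ f)) := by
  induction l with
  | nil => exact ⟨0, 0, 0, by simp [mdeg_zero], by simp [mdeg_zero], by simp [mdeg_zero], fun f _ => by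
      rw [mderiv_zero, mderiv_zero, mderiv_zero]; rfl⟩
  | cons i l ih =>
    obtain ⟨α, β, γ, h1, h3, h4, h2⟩ := ih
    rcases i with i | i | i
    · refine ⟨α + Pi.single i 1, β, γ, by rw [mdeg_single, h1, List.countP_cons_of_pos rfl], (h3.trans (by simp)), (h4.trans (by simp)),
        fun f hf => ?_⟩
      rw [← mderiv_single d1 α (contDiff_mderiv d2 β (contDiff_mderiv d3 γ hf)) i,
        ← mderiv_comm d2 β (contDiff_mderiv d3 γ hf), ← mderiv_comm d3 γ hf,
        ← h2 _ (contDiff_dLine hf _)]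
      rfl
    · refine ⟨α, β + Pi.single i 1, γ, by simp [h1], by rw [mdeg_single]; simpa using h3,
        by simp; omega, fun f hf => ?_⟩
      rw [← mderiv_single d2 β (contDiff_mderiv d3 γ hf) i, ← mderiv_comm d3 γ hf,
        ← h2 _ (contDiff_dLine hf _)]
      rfl
    · refine ⟨α, β, γ + Pi.single i 1, by simp [h1], by simp; omega, by rw [mdeg_single]; simpa using h4,
        fun f hf => ?_⟩
      rw [← mderiv_single d3 γ hf i, ← h2 _ (contDiff_dLine hf _)]
      rfl

lemma dLine_sum_smul {J : Type*} [Fintype J] (e : J → W) (c : J → ℝ) (f : W → F) (z : W) :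
    dLine (∑ j, c j • e j) f z = ∑ j, c j • dLine (e j) f z := by
  simp [dLine]

lemma Sy_of_lists {J : Type*} [Fintype J] (e : J → W) (hspan : ∀ v, ∃ c : J → ℝ, v = ∑ j, c j • e j)
    {s : ι → Set W} (k : ℕ) : ∀ {f : ι → W → F}, (∀ i, ContDiff ℝ ∞ (f i)) →
    (∀ l : List J, l.length ≤ k → ∃ C : ℝ, ∀ i, ∀ z ∈ s i, ‖dList (l.map e) (f i) z‖ ≤ C) → Sy s k f := by
  induction k with
  | zero => intro f hf h; exact ⟨hf, h [] (by simp)⟩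
  | succ k ih =>
    intro f hf h
    refine Sy.succ hf (h [] (by simp)) fun v => ?_
    obtain ⟨c, hc⟩ := hspan v
    have h1 : ∀ j, Sy s k (fun i => dLine (e j) (f i)) := fun j =>
      ih (fun i => contDiff_dLine (hf i) _) fun l hl => h (j :: l) (by simpa using hl)
    have h2 := Sy.sum Finset.univ (fun j _ => (h1 j).clm (c j • ContinuousLinearMap.id ℝ F))
    refine h2.congr fun i z => ?_
    rw [hc, dLine_sum_smul]
    simp

lemma dList_comm (l : List W) (w : W) : ∀ {f : W → F}, ContDiff ℝ ∞ f →
    dList l (dLine w f) = dLine w (dList l f) := by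
  induction l with
  | nil => intro f hf; rfl
  | cons v l ih =>
    intro f hf
    change dList l (dLine v (dLine w f)) = dLine w (dList l (dLine v f))
    rw [dLine_comm hf, ih (contDiff_dLine hf v)]

lemma dList_smul (l : List W) (r : ℝ) : ∀ {f : W → F}, ContDiff ℝ ∞ f →
    dList l (fun z => r • f z) = fun z => r • dList l f z := by
  induction l with
  | nil => intro f hf; rfl
  | cons v l ih =>
    intro f hf
    have h := dLine_clm (r • ContinuousLinearMap.id ℝ F) hf v
    have h' : dLine v (fun z => r • f z) = fun z => r • dLine v f z := by simpa using h
    change dList l (dLine v (fun z => r • f z)) = _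
    rw [h', ih (contDiff_dLine hf v)]
    rfl

lemma span2 (v : ES n × ES n) : ∃ c : Fin n ⊕ Fin n → ℝ, v = ∑ j, c j • Sum.elim dX dY j := by
  refine ⟨Sum.elim (fun i => v.1 i) (fun i => v.2 i), ?_⟩
  rw [Fintype.sum_sum_type]
  have h1 := es_sum v.1
  have h2 := es_sum v.2
  refine Prod.ext ?_ ?_
  · rw [Prod.fst_add, Prod.fst_sum, Prod.fst_sum]; simpa [dX, dY] using h1
  · rw [Prod.snd_add, Prod.snd_sum, Prod.snd_sum]; simpa [dX, dY] using h2

lemma span3 (v : ES n × (ES n × ES n)) : ∃ c : Fin n ⊕ (Fin n ⊕ Fin n) → ℝ,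
    v = ∑ j, c j • Sum.elim d3X (Sum.elim d3Y d3Xi) j := by
  refine ⟨Sum.elim (fun i => v.1 i) (Sum.elim (fun i => v.2.1 i) (fun i => v.2.2 i)), ?_⟩
  rw [Fintype.sum_sum_type, Fintype.sum_sum_type]
  have h1 := es_sum v.1
  have h2 := es_sum v.2.1
  have h3 := es_sum v.2.2
  refine Prod.ext ?_ (Prod.ext ?_ ?_)
  · simp only [Prod.fst_add, Prod.fst_sum]; simpa [d3X, d3Y, d3Xi] using h1
  · simp only [Prod.fst_add, Prod.snd_add, Prod.snd_sum, Prod.fst_sum]; simpa [d3X, d3Y, d3Xi] using h2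
  · simp only [Prod.snd_add, Prod.snd_sum]; simpa [d3X, d3Y, d3Xi] using h3

/-- bounds on the mixed Hessian give a symbol family -/
lemma mixed_Sy {N : ℕ} {A : ℝ} {φ : ι → ES n × ES n → ℝ} (hφ : ∀ i, ContDiff ℝ ∞ (φ i))
    (h : ∀ q, ∀ i j : Fin n, ∀ α β : Fin n → ℕ, mdeg α ≤ N → mdeg β ≤ N →
          ∀ z, |mderiv dX α (mderiv dY β (mixedHessXY (φ q) i j)) z| ≤ A) (i j : Fin n) :
    Sy (fun _ => Set.univ) N (fun q => mixedHessXY (φ q) i j) := by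
  have hs : ∀ q, ContDiff ℝ ∞ (mixedHessXY (φ q) i j) := fun q =>
    contDiff_dLine (contDiff_dLine (hφ q) _) _
  refine Sy_of_lists (Sum.elim dX dY) span2 N hs fun l hl => ⟨A, fun q z _ => ?_⟩
  obtain ⟨α, β, h1, h2, h3⟩ := list2 (F := ℝ) (dX (n := n)) dY l
  rw [h3 _ (hs q)]
  exact h q i j α β (h1.trans hl) (h2.trans hl) z

lemma mixed_Sy' {N : ℕ} {φ : ι → ES n × ES n → ℝ} (hφ : ∀ i, ContDiff ℝ ∞ (φ i))
    (h : ∀ i j, Sy (fun _ => Set.univ) N (fun q => mixedHessXY (φ q) i j)) (v w : ES n) :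
    Sy (fun _ => Set.univ) N (fun q => dLine ((v, 0) : ES n × ES n) (dLine ((0, w) : ES n × ES n) (φ q))) := by
  have h2 := Sy.sum Finset.univ (fun i _ => Sy.sum Finset.univ (fun j _ =>
    (h i j).clm ((v i * w j) • ContinuousLinearMap.id ℝ ℝ)))
  refine h2.congr fun q z => ?_
  have e1 : ((0, w) : ES n × ES n) = ∑ j, w j • dY j := by
    refine Prod.ext ?_ ?_
    · rw [Prod.fst_sum]; simp [dY]
    · rw [Prod.snd_sum]; simpa [dY] using es_sum w
  have e2 : ((v, 0) : ES n × ES n) = ∑ j, v j • dX j := by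
    refine Prod.ext ?_ ?_
    · rw [Prod.fst_sum]; simpa [dX] using es_sum v
    · rw [Prod.snd_sum]; simp [dX]
  rw [e2, dLine_sum_smul]
  refine Finset.sum_congr rfl fun i _ => ?_
  have hcd := contDiff_dLine (hφ q) (dX (n := n) i)
  rw [dLine_comm (hφ q), e1, dLine_sum_smul, Finset.smul_sum]
  refine Finset.sum_congr rfl fun j _ => ?_
  simp only [mixedHessXY, ContinuousLinearMap.smul_apply, ContinuousLinearMap.id_apply, smul_eq_mul]
  rw [dLine_comm (hφ q)]
  ring

lemma grow_Sy {M : ℕ} {A : ℝ} {φ : ι → ES n × ES n → ℝ} (hφ : ∀ i, ContDiff ℝ ∞ (φ i))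
    (hm : ∀ i j, Sy (fun _ => Set.univ) M (fun q => mixedHessXY (φ q) i j))
    (h : ∀ q, ∀ α : Fin n → ℕ, 1 ≤ mdeg α → mdeg α ≤ M → ∀ z : ES n × ES n,
            |mderiv dY α (φ q) z| ≤ A * jap z.1) (k : ℕ) : ∀ (j : Fin n) (l : List (Fin n)),
    l.length + 1 + k ≤ M → Sy (fun _ => Set.univ) k
      (fun q z => (jap z.1)⁻¹ * dList (List.map dY (j :: l)) (φ q) z) := by
  have hj1 : ContDiff ℝ ∞ fun z : ES n × ES n => (jap z.1)⁻¹ := contDiff_japinv.comp contDiff_fst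
  have hsm : ∀ q l, ContDiff ℝ ∞ (dList l (φ q)) := fun q l => contDiff_dList l (hφ q)
  have hb : ∀ (j : Fin n) (l : List (Fin n)), l.length + 1 ≤ M → ∃ C : ℝ, ∀ q, ∀ z ∈ Set.univ,
      ‖(jap (Prod.fst z))⁻¹ * dList (List.map dY (j :: l)) (φ q) z‖ ≤ C := by
    intro j l hl
    refine ⟨A, fun q z _ => ?_⟩
    obtain ⟨α, h1, h2⟩ := list1 (F := ℝ) (dY (n := n)) (j :: l)
    have hj := jap_pos z.1
    rw [h2 _ (hφ q), norm_mul, Real.norm_eq_abs, Real.norm_eq_abs, abs_of_pos (by positivity),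
      inv_mul_le_iff₀ hj, mul_comm]
    refine h q α ?_ ?_ z
    · rw [h1]; simp
    · rw [h1]; simpa using hl
  induction k with
  | zero =>
    intro j l hl
    exact ⟨fun q => hj1.mul (hsm q _), hb j l hl⟩
  | succ k ih =>
    intro j l hl
    refine Sy.succ (fun q => hj1.mul (hsm q _)) (hb j l (by omega)) fun v => ?_
    obtain ⟨c, hc⟩ := span2 v
    have key : ∀ J : Fin n ⊕ Fin n, Sy (fun _ => Set.univ) k (fun q => dLine (Sum.elim dX dY J)
        (fun z : ES n × ES n => (jap z.1)⁻¹ * dList (List.map dY (j :: l)) (φ q) z)) := by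
      intro J
      have hpj : ∀ v : ES n × ES n, ∀ z, dLine v (fun z : ES n × ES n => (jap z.1)⁻¹) z =
          - ((jap z.1)⁻¹ * (jap z.1)⁻¹ * (⟪z.1, v.1⟫ * (jap z.1)⁻¹)) := by
        intro v z
        have := dLine_affine (f := fun x : ES n => (jap x)⁻¹) contDiff_japinv
          (ContinuousLinearMap.fst ℝ (ES n) (ES n)) 0 v
        simp only [ContinuousLinearMap.coe_fst', zero_add] at this
        rw [this]
        exact dLine_japinv _ _
      rcases J with J | J
      · obtain ⟨-, s2⟩ := Sy_jap (ι := ι) (n := n) k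
        have s2' := ((s2 (bv J)).affine (fun _ : ι => (Set.univ : Set (ES n × ES n))) id (fun _ => 0)
          (ContinuousLinearMap.fst ℝ (ES n) (ES n)) (by simp))
        have s1 := Sy_jap1 (ι := ι) (n := n) k
        have t1 := (((s1.mul s2').mul (ih j l (by omega))).neg)
        have t2 : Sy (fun _ => Set.univ) k (fun q => dList (List.map dY l) (mixedHessXY (φ q) J j)) :=
          Sy.dList _ ((hm J j).mono (by simp; omega))
        refine (t1.add (s1.mul t2)).congr fun q z => ?_
        rw [dLine_mul_fun hj1 (hsm q _)]
        simp only [hpj]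
        have e : dLine (Sum.elim dX dY (Sum.inl J)) (dList (List.map dY (j :: l)) (φ q)) =
            dList (List.map dY l) (mixedHessXY (φ q) J j) := by
          rw [← dList_comm _ _ (hφ q)]
          change dList (List.map dY l) (dLine (dY j) (dLine (dX J) (φ q))) = _
          rw [dLine_comm (hφ q)]; rfl
        rw [e]
        simp only [Sum.elim_inl, dX, ContinuousLinearMap.coe_fst', zero_add]
        ring
      · refine (ih J (j :: l) (by simp; omega)).congr fun q z => ?_
        rw [dLine_mul_fun hj1 (hsm q _)]
        simp only [hpj]
        have e : dLine (Sum.elim dX dY (Sum.inr J)) (dList (List.map dY (j :: l)) (φ q)) =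
            dList (List.map dY (J :: j :: l)) (φ q) := by
          rw [← dList_comm _ _ (hφ q)]; rfl
        rw [e]
        simp [dY]
    have h2 := Sy.sum Finset.univ (fun j _ => (key j).clm (c j • ContinuousLinearMap.id ℝ ℝ))
    refine h2.congr fun i z => ?_
    rw [hc, dLine_sum_smul]
    simp

lemma grow_of {M k : ℕ} (hk : 1 + k ≤ M) {A : ℝ} {φ : ι → ES n × ES n → ℝ} (hφ : ∀ i, ContDiff ℝ ∞ (φ i))
    (hm : ∀ i j, Sy (fun _ => Set.univ) M (fun q => mixedHessXY (φ q) i j))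
    (h : ∀ q, ∀ α : Fin n → ℕ, 1 ≤ mdeg α → mdeg α ≤ M → ∀ z : ES n × ES n,
            |mderiv dY α (φ q) z| ≤ A * jap z.1) : Grow k φ := by
  intro w
  have h2 := Sy.sum Finset.univ (fun j _ => (grow_Sy hφ hm h k j [] (by simpa using hk)).clm
    (w j • ContinuousLinearMap.id ℝ ℝ))
  refine h2.congr fun q z => ?_
  have e1 : ((0, w) : ES n × ES n) = ∑ j, w j • dY j := by
    refine Prod.ext ?_ ?_
    · rw [Prod.fst_sum]; simp [dY]
    · rw [Prod.snd_sum]; simpa [dY] using es_sum w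
  rw [e1, dLine_sum_smul, Finset.mul_sum]
  refine Finset.sum_congr rfl fun j _ => ?_
  simp only [ContinuousLinearMap.smul_apply, ContinuousLinearMap.id_apply, smul_eq_mul, List.map_cons,
    List.map_nil, dList]
  ring

end Conv

section Conv2
variable {n : ℕ} {ι : Type*}

lemma scale_list (r : ℝ) (l : List (Fin n ⊕ (Fin n ⊕ Fin n))) : ∀ {f : ES n × (ES n × ES n) → ℂ},
    ContDiff ℝ ∞ f → dList (l.map (Sum.elim d3X (Sum.elim d3Y d3Xi))) (fun z => f (r • z.1, z.2)) =
      fun z => r ^ (l.countP Sum.isLeft) •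
        dList (l.map (Sum.elim d3X (Sum.elim d3Y d3Xi))) f (r • z.1, z.2) := by
  let L : ES n × (ES n × ES n) →L[ℝ] ES n × (ES n × ES n) :=
    (r • ContinuousLinearMap.fst ℝ (ES n) (ES n × ES n)).prod (ContinuousLinearMap.snd ℝ (ES n) (ES n × ES n))
  have hL : ∀ z, L z = (r • z.1, z.2) := fun z => rfl
  have hd : ∀ (v : ES n × (ES n × ES n)) (f : ES n × (ES n × ES n) → ℂ), ContDiff ℝ ∞ f →
      dLine v (fun z => f (r • z.1, z.2)) = fun z => dLine (r • v.1, v.2) f (r • z.1, z.2) := by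
    intro v f hf
    have h := dLine_affine hf L 0 v
    simpa [hL] using h
  induction l with
  | nil => intro f hf; simp [dList]
  | cons s l ih =>
    intro f hf
    change dList _ (dLine _ _) = fun z => _ • dList _ (dLine _ f) _
    rw [hd _ f hf]
    rcases s with s | s | s
    · have e : ∀ z, dLine (r • (Sum.elim d3X (Sum.elim d3Y d3Xi) (Sum.inl s) : ES n × (ES n × ES n)).1,
          (Sum.elim d3X (Sum.elim d3Y d3Xi) (Sum.inl s) : ES n × (ES n × ES n)).2) f z =
          r • dLine (Sum.elim d3X (Sum.elim d3Y d3Xi) (Sum.inl s)) f z := by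
        intro z
        have : ((r • (Sum.elim d3X (Sum.elim d3Y d3Xi) (Sum.inl s) : ES n × (ES n × ES n)).1,
          (Sum.elim d3X (Sum.elim d3Y d3Xi) (Sum.inl s) : ES n × (ES n × ES n)).2) : ES n × (ES n × ES n)) =
          r • d3X s := by simp [d3X]
        rw [this]
        simp [dLine]
      simp only [e]
      rw [dList_smul _ _ (f := fun z : ES n × (ES n × ES n) => dLine (Sum.elim d3X (Sum.elim d3Y d3Xi) (Sum.inl s)) f (r • z.1, z.2))
        ((contDiff_dLine hf _).comp L.contDiff), ih (contDiff_dLine hf _),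
        List.countP_cons_of_pos rfl]
      funext z
      rw [smul_smul, pow_succ']
    · simp only [Sum.elim_inr, Sum.elim_inl]
      have : (r • (d3Y s : ES n × (ES n × ES n)).1, (d3Y s : ES n × (ES n × ES n)).2) = d3Y s := by
        simp [d3Y]
      rw [this, ih (contDiff_dLine hf _), List.countP_cons_of_neg (by simp)]
    · simp only [Sum.elim_inr]
      have : (r • (d3Xi s : ES n × (ES n × ES n)).1, (d3Xi s : ES n × (ES n × ES n)).2) = d3Xi s := by
        simp [d3Xi]
      rw [this, ih (contDiff_dLine hf _), List.countP_cons_of_neg (by simp)]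

lemma ampl_Sy {N : ℕ} {A : ℝ} {a : ι → ES n × (ES n × ES n) → ℂ} (ha : ∀ i, ContDiff ℝ ∞ (a i))
    (h : ∀ q, ∀ α β γ : Fin n → ℕ, mdeg α ≤ N → mdeg β ≤ N → mdeg γ ≤ N →
          ∀ x y ξ, ‖mderiv d3X α (mderiv d3Y β (mderiv d3Xi γ (a q))) (x, y, ξ)‖ ≤
            A * jap x ^ (-(mdeg α : ℝ))) :
    Sy (fun p : ι × ℕ => ann n p.2) N (fun p z => a p.1 ((2:ℝ) ^ p.2 • z.1, z.2)) := by
  refine Sy_of_lists (Sum.elim d3X (Sum.elim d3Y d3Xi)) span3 N ?_ fun l hl => ?_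
  · intro p
    have h1 : ContDiff ℝ ∞ (fun z : ES n × (ES n × ES n) => ((2:ℝ) ^ p.2 • z.1, z.2)) :=
      (contDiff_fst.const_smul _).prodMk contDiff_snd
    exact (ha p.1).comp h1
  · obtain ⟨α, β, γ, h1, h2, h3, h4⟩ := list3 (F := ℂ) (d3X (n := n)) d3Y d3Xi l
    refine ⟨|A| * 2 ^ (l.countP Sum.isLeft), ?_⟩
    rintro ⟨q, j⟩ ⟨x, y, ξ⟩ hz
    have hα : mdeg α ≤ N := by rw [h1]; exact List.countP_le_length.trans hl
    rw [scale_list _ _ (ha q), h4 _ (ha q)]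
    simp only
    have h5 := h q α β γ hα (h2.trans hl) (h3.trans hl) ((2:ℝ) ^ j • x) y ξ
    have hj := jap_pos ((2:ℝ) ^ j • x)
    rw [norm_smul, norm_pow, norm_pow, Real.norm_ofNat, ← h1]
    rw [Real.rpow_neg hj.le, Real.rpow_natCast] at h5
    have hlow : (2:ℝ) ^ j ≤ 2 * jap ((2:ℝ) ^ j • x) := by
      have hz1 : 1 / 4 ≤ ((4:ℝ) ^ j)⁻¹ + ‖x‖ ^ 2 := hz.1
      have e : (2 * jap ((2:ℝ) ^ j • x)) ^ 2 = (2 ^ j) ^ 2 * (4 * (((4:ℝ) ^ j)⁻¹ + ‖x‖ ^ 2)) := by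
        rw [mul_pow, jap_sq, norm_smul, norm_pow, Real.norm_ofNat]
        have : (4:ℝ) ^ j = (2 ^ j) ^ 2 := by rw [← pow_mul, mul_comm, pow_mul]; norm_num
        rw [this]
        field_simp
        ring
      refine (sq_le_sq₀ (by positivity) (by positivity)).1 ?_
      rw [e]
      exact le_mul_of_one_le_right (by positivity) (by linarith)
    calc ((2:ℝ) ^ j) ^ mdeg α * ‖mderiv d3X α (mderiv d3Y β (mderiv d3Xi γ (a q))) ((2:ℝ) ^ j • x, y, ξ)‖
        ≤ ((2:ℝ) ^ j) ^ mdeg α * (|A| * (jap ((2:ℝ) ^ j • x) ^ mdeg α)⁻¹) := by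
          gcongr
          refine h5.trans ?_
          gcongr
          exact le_abs_self A
      _ = |A| * (((2:ℝ) ^ j) / jap ((2:ℝ) ^ j • x)) ^ mdeg α := by
          rw [div_pow]; ring
      _ ≤ |A| * 2 ^ mdeg α := by
          gcongr
          exact (div_le_iff₀ hj).2 hlow

lemma mat_bound (n : ℕ) (A C₀ : ℝ) (hC : 0 < C₀) : ∃ M : ℝ, 0 < M ∧ ∀ H : Matrix (Fin n) (Fin n) ℝ,
    (∀ i j, |H i j| ≤ A) → C₀ ≤ |H.det| → ∀ v : Fin n → ℝ,
      ∑ i, v i ^ 2 ≤ M ^ 2 * ∑ i, (H.mulVec v) i ^ 2 := by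
  have hcomp : IsCompact {H : Matrix (Fin n) (Fin n) ℝ | ∀ i j, H i j ∈ Set.Icc (-A) A} := by
    have := isCompact_univ_pi (X := fun _ : Fin n => Fin n → ℝ)
      (s := fun _ => Set.pi Set.univ fun _ => Set.Icc (-A) A) (fun i => isCompact_univ_pi fun j => isCompact_Icc)
    have e : {H : Matrix (Fin n) (Fin n) ℝ | ∀ i j, H i j ∈ Set.Icc (-A) A} =
        (Set.pi Set.univ fun _ : Fin n => Set.pi Set.univ fun _ : Fin n => Set.Icc (-A) A) :=
      Set.ext fun H => ⟨fun h i _ j _ => h i j, fun h i j => h i trivial j trivial⟩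
    rw [e]
    exact this
  have hb : ∀ i j, ∃ B : ℝ, ∀ H ∈ {H : Matrix (Fin n) (Fin n) ℝ | ∀ i j, H i j ∈ Set.Icc (-A) A},
      ‖H.adjugate i j‖ ≤ B := fun i j => hcomp.exists_bound_of_continuousOn
        (Continuous.continuousOn ((continuous_id.matrix_adjugate).matrix_elem i j))
  choose B hB using hb
  set S := ∑ i, ∑ j, B i j ^ 2
  have hS : 0 ≤ S := Finset.sum_nonneg fun i _ => Finset.sum_nonneg fun j _ => sq_nonneg _
  refine ⟨(Real.sqrt S + 1) / C₀, by positivity, fun H hH hdet v => ?_⟩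
  have hmem : H ∈ {H : Matrix (Fin n) (Fin n) ℝ | ∀ i j, H i j ∈ Set.Icc (-A) A} :=
    fun i j => abs_le.1 (hH i j)
  have e : H.adjugate.mulVec (H.mulVec v) = H.det • v := by
    rw [Matrix.mulVec_mulVec, Matrix.adjugate_mul, Matrix.smul_mulVec, Matrix.one_mulVec]
  set w := H.mulVec v
  have hW : 0 ≤ ∑ j, w j ^ 2 := Finset.sum_nonneg fun j _ => sq_nonneg _
  have h1 : ∀ i, (H.det * v i) ^ 2 ≤ (∑ j, B i j ^ 2) * ∑ j, w j ^ 2 := by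
    intro i
    have h2 : H.det * v i = ∑ j, H.adjugate i j * w j := by
      have := congrFun e i
      simp only [Pi.smul_apply, smul_eq_mul] at this
      rw [← this]; rfl
    rw [h2]
    refine (Finset.sum_mul_sq_le_sq_mul_sq _ _ _).trans ?_
    refine mul_le_mul_of_nonneg_right (Finset.sum_le_sum fun j _ => ?_) hW
    exact sq_le_sq.2 ((hB i j H hmem).trans (le_abs_self _))
  have h3 : C₀ ^ 2 * ∑ i, v i ^ 2 ≤ S * ∑ j, w j ^ 2 := by
    rw [Finset.mul_sum, Finset.sum_mul]
    refine Finset.sum_le_sum fun i _ => le_trans ?_ (h1 i)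
    rw [mul_pow]
    gcongr ?_ * _
    rw [← sq_abs H.det]
    gcongr
  have h4 : S ≤ (Real.sqrt S + 1) ^ 2 := by
    have := Real.sq_sqrt hS
    nlinarith [Real.sqrt_nonneg S]
  rw [div_pow, div_mul_eq_mul_div, le_div_iff₀ (by positivity), mul_comm]
  exact h3.trans (by gcongr)

/-- lower bound for a gradient-type map with invertible Jacobian -/
lemma grad_low {M : ℝ} (hM : 0 < M) {f : Fin n → ES n → ℝ} (hf : ∀ j, ContDiff ℝ ∞ (f j))
    (h : ∀ z (v : ES n), ∑ i, v i ^ 2 ≤ M ^ 2 * ∑ j, (dLine v (f j) z) ^ 2) (x y : ES n) :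
    (M ^ 2)⁻¹ * ‖x - y‖ ^ 2 ≤ ∑ j, (f j x - f j y) ^ 2 := by
  let F : ES n → ES n := fun z => WithLp.toLp 2 (fun j => f j z)
  have hF : ContDiff ℝ ∞ F := contDiff_euclidean.2 fun j => hf j
  have hd : ∀ z v j, (fderiv ℝ F z v) j = dLine v (f j) z := by
    intro z v j
    have h1 := ((cd_diff hF z).hasFDerivAt)
    have h2 := (EuclideanSpace.proj j : ES n →L[ℝ] ℝ).hasFDerivAt.comp z h1
    have h3 : fderiv ℝ (f j) z = _ := h2.fderiv
    unfold dLine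
    rw [h3]
    rfl
  have key : ‖x - y‖ ≤ M * ‖F x - F y‖ := by
    refine hadamard_lower hF hM.le (fun z v => ?_) y x
    refine (sq_le_sq₀ (by positivity) (by positivity)).1 ?_
    rw [mul_pow, EuclideanSpace.norm_sq_eq, EuclideanSpace.norm_sq_eq]
    simp only [hd, Real.norm_eq_abs, sq_abs]
    exact h z v
  have e : ∑ j, (f j x - f j y) ^ 2 = ‖F x - F y‖ ^ 2 := by
    rw [EuclideanSpace.norm_sq_eq]
    simp [F]
  rw [e, inv_mul_le_iff₀ (by positivity), ← mul_pow]
  gcongr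

lemma phase_of (n : ℕ) (A C₀ : ℝ) (hC : 0 < C₀) : ∃ c0 : ℝ, 0 < c0 ∧ ∀ {ι : Type} {k : ℕ}
    {φ : ι → ES n × ES n → ℝ}, (∀ q, ContDiff ℝ ∞ (φ q)) →
    (∀ i j, Sy (fun _ => Set.univ) k (fun q => mixedHessXY (φ q) i j)) →
    (∀ q i j z, |mixedHessXY (φ q) i j z| ≤ A) →
    (∀ q z, C₀ ≤ |Matrix.det (Matrix.of fun i j => mixedHessXY (φ q) i j z)|) → Phase k c0 φ := by
  obtain ⟨M, hM, hH⟩ := mat_bound n A C₀ hC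
  refine ⟨(M ^ 2)⁻¹, by positivity, fun {ι k φ} hφ hm hA hdet => ?_⟩
  refine ⟨by positivity, hφ, fun v w => mixed_Sy' hφ hm v w, fun q y y' ξ => ?_, fun q y ξ ξ' => ?_⟩
  · have hs : ∀ j : Fin n, ContDiff ℝ ∞ (dLine ((0, bv j) : ES n × ES n) (φ q)) := fun j =>
      contDiff_dLine (hφ q) _
    refine grad_low hM (f := fun j y => dLine ((0, bv j) : ES n × ES n) (φ q) (y, ξ))
      (fun j => (hs j).comp (contDiff_id.prodMk contDiff_const)) (fun z v => ?_) y y'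
    have h1 := hH (Matrix.of fun i j => mixedHessXY (φ q) i j (z, ξ)).transpose
      (fun i j => hA q j i _) (by rw [Matrix.det_transpose]; exact hdet q _) (fun i => v i)
    refine h1.trans (le_of_eq ?_)
    congr 1
    refine Finset.sum_congr rfl fun j _ => ?_
    congr 1
    have h2 := dLine_affine (hs j) (ContinuousLinearMap.inl ℝ (ES n) (ES n)) (0, ξ) v
    simp only [ContinuousLinearMap.inl_apply, Prod.mk_add_mk, zero_add, add_zero] at h2
    rw [h2]
    have e2 : ((v, 0) : ES n × ES n) = ∑ j, v j • dX j := by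
      refine Prod.ext ?_ ?_
      · rw [Prod.fst_sum]; simpa [dX] using es_sum v
      · rw [Prod.snd_sum]; simp [dX]
    simp only
    rw [e2, dLine_sum_smul]
    simp only [Matrix.mulVec, dotProduct, Matrix.transpose_apply, Matrix.of_apply, smul_eq_mul, mixedHessXY]
    refine Finset.sum_congr rfl fun i _ => ?_
    rw [mul_comm]; rfl
  · have hs : ∀ j : Fin n, ContDiff ℝ ∞ (dLine ((bv j, 0) : ES n × ES n) (φ q)) := fun j =>
      contDiff_dLine (hφ q) _
    refine grad_low hM (f := fun j ξ => dLine ((bv j, 0) : ES n × ES n) (φ q) (y, ξ))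
      (fun j => (hs j).comp (contDiff_const.prodMk contDiff_id)) (fun z v => ?_) ξ ξ'
    have h1 := hH (Matrix.of fun i j => mixedHessXY (φ q) i j (y, z))
      (fun i j => hA q i j _) (hdet q _) (fun i => v i)
    refine h1.trans (le_of_eq ?_)
    congr 1
    refine Finset.sum_congr rfl fun j _ => ?_
    congr 1
    have h2 := dLine_affine (hs j) (ContinuousLinearMap.inr ℝ (ES n) (ES n)) (y, 0) v
    simp only [ContinuousLinearMap.inr_apply, Prod.mk_add_mk, zero_add, add_zero] at h2
    rw [h2]
    have e1 : ((0, v) : ES n × ES n) = ∑ j, v j • dY j := by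
      refine Prod.ext ?_ ?_
      · rw [Prod.fst_sum]; simp [dY]
      · rw [Prod.snd_sum]; simpa [dY] using es_sum v
    simp only
    rw [e1, dLine_sum_smul]
    simp only [Matrix.mulVec, dotProduct, Matrix.of_apply, smul_eq_mul, mixedHessXY]
    refine Finset.sum_congr rfl fun i _ => ?_
    rw [mul_comm, dLine_comm (hφ q)]; rfl

end Conv2

section Fin
variable {n : ℕ}

lemma nice_schwartz (u : 𝓢(ES n, ℂ)) : Nice (fun y => u y) := by
  refine ⟨u.continuous.aestronglyMeasurable, fun N => ?_⟩
  refine ⟨2 ^ N * ((Finset.Iic (N, 0)).sup fun m => SchwartzMap.seminorm ℝ m.1 m.2) u, fun y => ?_⟩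
  have h := SchwartzMap.one_add_le_sup_seminorm_apply (𝕜 := ℝ) (m := (N, 0)) (le_refl N) (le_refl 0) u y
  rw [norm_iteratedFDeriv_zero] at h
  refine le_trans ?_ h
  have hj : jap y ≤ 1 + ‖y‖ := by
    refine (sq_le_sq₀ (jap_pos y).le (by positivity)).1 ?_
    rw [jap_sq]
    nlinarith [norm_nonneg y]
  have := jap_pos y
  gcongr

lemma eLp_Wt (m : ℝ) (f : ES n → ℂ) :
    eLpNorm (fun x => ((jap x ^ m : ℝ) : ℂ) * f x) 2 volume ^ 2 =
      Wt (fun x => jap x ^ (2 * m)) f := by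
  have e := eLpNorm_nnreal_pow_eq_lintegral (f := fun x => ((jap x ^ m : ℝ) : ℂ) * f x)
    (μ := (volume : Measure (ES n))) (p := 2) (by norm_num)
  have e' : eLpNorm (fun x => ((jap x ^ m : ℝ) : ℂ) * f x) 2 volume ^ 2 =
      ∫⁻ x, ‖((jap x ^ m : ℝ) : ℂ) * f x‖ₑ ^ 2 := by
    simpa using e
  rw [e']
  unfold Wt
  refine lintegral_congr fun x => ?_
  have hj := jap_pos x
  rw [← ofReal_norm, ← ENNReal.ofReal_pow (norm_nonneg _), norm_mul, mul_pow, Complex.norm_real,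
    Real.norm_of_nonneg (by positivity), ← Real.rpow_natCast (jap x ^ m), ← Real.rpow_mul hj.le]
  congr 3
  push_cast
  ring

end Fin

/-- (Simplified main theorem.) Weighted `L²`-boundedness of
`Tu(x) = ∫∫ e^{i(x·ξ+φ(y,ξ))} a(x,y,ξ) u(y) dy dξ` on `L²_m` for every `m ∈ ℝ`, when
`|det ∂_y∂_ξ φ| ≥ C₀`, all derivatives of the entries of `∂_y∂_ξ φ` are bounded,
`|∂_ξ^α φ| ≤ C_α ⟨y⟩` for `|α| ≥ 1`, and `|∂_x^α∂_y^β∂_ξ^γ a| ≤ C_{αβγ} ⟨x⟩^{-|α|}`;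
the constant depends only on `n`, `m`, `C₀` and finitely many (order `≤ N`) of the
constants (all bounded by `A`), and is independent of the compact set `K`. -/
theorem statement11 (n : ℕ) (m : ℝ) (C₀ : ℝ) (hC₀ : 0 < C₀) :
    ∃ N : ℕ, ∀ A : ℝ, ∃ C : ℝ, 0 < C ∧
      ∀ (φ : EuclideanSpace ℝ (Fin n) × EuclideanSpace ℝ (Fin n) → ℝ)
        (a : EuclideanSpace ℝ (Fin n) × EuclideanSpace ℝ (Fin n) ×
              EuclideanSpace ℝ (Fin n) → ℂ)
        (K : Set (EuclideanSpace ℝ (Fin n))), IsCompact K →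
        ContDiff ℝ (⊤ : ℕ∞) φ → ContDiff ℝ (⊤ : ℕ∞) a →
        -- nondegeneracy of the mixed Hessian `∂_y∂_ξ φ`:
        (∀ z, C₀ ≤ |Matrix.det (Matrix.of fun i j => mixedHessXY φ i j z)|) →
        -- all derivatives of the entries of `∂_y∂_ξ φ` are bounded:
        (∀ i j : Fin n, ∀ α β : Fin n → ℕ, ∃ Cb : ℝ,
          ∀ z, |mderiv dX α (mderiv dY β (mixedHessXY φ i j)) z| ≤ Cb) →
        -- `|∂_ξ^α φ(y,ξ)| ≤ C_α ⟨y⟩` for all `|α| ≥ 1`: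
        (∀ α : Fin n → ℕ, 1 ≤ mdeg α → ∃ Cb : ℝ,
          ∀ z : EuclideanSpace ℝ (Fin n) × EuclideanSpace ℝ (Fin n),
            |mderiv dY α φ z| ≤ Cb * jap z.1) →
        -- `|∂_x^α∂_y^β∂_ξ^γ a| ≤ C_{αβγ} ⟨x⟩^{-|α|}` for all `α, β, γ`:
        (∀ α β γ : Fin n → ℕ, ∃ Cb : ℝ,
          ∀ x y ξ, ‖mderiv d3X α (mderiv d3Y β (mderiv d3Xi γ a)) (x, y, ξ)‖ ≤
            Cb * jap x ^ (-(mdeg α : ℝ))) →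
        -- `a` vanishes for `ξ` outside the compact set `K`:
        (∀ x y ξ, ξ ∉ K → a (x, y, ξ) = 0) →
        -- the quantitative bounds of order `≤ N`, with constant `A`:
        (∀ i j : Fin n, ∀ α β : Fin n → ℕ, mdeg α ≤ N → mdeg β ≤ N →
          ∀ z, |mderiv dX α (mderiv dY β (mixedHessXY φ i j)) z| ≤ A) →
        (∀ α : Fin n → ℕ, 1 ≤ mdeg α → mdeg α ≤ N →
          ∀ z : EuclideanSpace ℝ (Fin n) × EuclideanSpace ℝ (Fin n),
            |mderiv dY α φ z| ≤ A * jap z.1) →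
        (∀ α β γ : Fin n → ℕ, mdeg α ≤ N → mdeg β ≤ N → mdeg γ ≤ N →
          ∀ x y ξ, ‖mderiv d3X α (mderiv d3Y β (mderiv d3Xi γ a)) (x, y, ξ)‖ ≤
            A * jap x ^ (-(mdeg α : ℝ))) →
        ∀ u : 𝓢(EuclideanSpace ℝ (Fin n), ℂ),
          eLpNorm (fun x => ((jap x ^ m : ℝ) : ℂ) * ∫ ξ, ∫ y,
              Complex.exp (Complex.I * ((⟪x, ξ⟫ + φ (y, ξ) : ℝ) : ℂ)) * a (x, y, ξ) * u y)
              2 volume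
            ≤ ENNReal.ofReal C *
              eLpNorm (fun x => ((jap x ^ m : ℝ) : ℂ) * u x) 2 volume := by
  set N0 : ℕ := ⌈|m|⌉₊ + 1 with hN0
  have hN0' : |m| + 1 ≤ (N0 : ℝ) := by
    rw [hN0]; push_cast
    linarith [Nat.le_ceil |m|]
  refine ⟨3 * n + 2 + N0 + n + 1, fun A => ?_⟩
  obtain ⟨c0, hc0, hph⟩ := phase_of n A C₀ hC₀
  set k := 3 * n + 2 + N0 with hk
  let ι : Type := {p : (ES n × ES n → ℝ) × (ES n × ES n × ES n → ℂ) //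
    ContDiff ℝ ∞ p.1 ∧ ContDiff ℝ ∞ p.2 ∧
    (∃ K, IsCompact K ∧ ∀ x y ξ, ξ ∉ K → p.2 (x, y, ξ) = 0) ∧
    (∀ z, C₀ ≤ |Matrix.det (Matrix.of fun i j => mixedHessXY p.1 i j z)|) ∧
    (∀ i j : Fin n, ∀ α β : Fin n → ℕ, mdeg α ≤ k + n + 1 → mdeg β ≤ k + n + 1 →
          ∀ z, |mderiv dX α (mderiv dY β (mixedHessXY p.1 i j)) z| ≤ A) ∧
    (∀ α : Fin n → ℕ, 1 ≤ mdeg α → mdeg α ≤ k + n + 1 →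
          ∀ z : ES n × ES n, |mderiv dY α p.1 z| ≤ A * jap z.1) ∧
    (∀ α β γ : Fin n → ℕ, mdeg α ≤ k + n + 1 → mdeg β ≤ k + n + 1 → mdeg γ ≤ k + n + 1 →
          ∀ x y ξ, ‖mderiv d3X α (mderiv d3Y β (mderiv d3Xi γ p.2)) (x, y, ξ)‖ ≤
            A * jap x ^ (-(mdeg α : ℝ)))}
  let Φ : ι → ES n × ES n → ℝ := fun q => q.1.1
  let a' : ι → ES n × (ES n × ES n) → ℂ := fun q => q.1.2
  have hΦ : ∀ q, ContDiff ℝ ∞ (Φ q) := fun q => q.2.1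
  have ha' : ∀ q, ContDiff ℝ ∞ (a' q) := fun q => q.2.2.1
  have hm : ∀ i j, Sy (fun _ : ι => Set.univ) (k + n + 1) (fun q => mixedHessXY (Φ q) i j) :=
    fun i j => mixed_Sy hΦ (fun q => q.2.2.2.2.2.1) i j
  have hm' : ∀ i j, Sy (fun _ : ι => Set.univ) k (fun q => mixedHessXY (Φ q) i j) :=
    fun i j => (hm i j).mono (by omega)
  have hb : ∀ (q : ι) i j z, |mixedHessXY (Φ q) i j z| ≤ A := by
    intro q i j z
    have h := q.2.2.2.2.2.1 i j 0 0 (by simp [mdeg]) (by simp [mdeg]) z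
    rwa [mderiv_zero, mderiv_zero] at h
  have hP : Phase k c0 Φ := hph hΦ hm' hb (fun q => q.2.2.2.2.1)
  have hG : Grow k Φ := grow_of (M := k + n + 1) (by omega) hΦ hm (fun q => q.2.2.2.2.2.2.1)
  have hA : Sy (fun p : ι × ℕ => ann n p.2) (k + n + 1) (fun p z => a' p.1 ((2:ℝ) ^ p.2 • z.1, z.2)) :=
    ampl_Sy ha' (fun q => q.2.2.2.2.2.2.2)
  obtain ⟨C, hC, hE⟩ := stepE hN0' hP hG (hA.mono (by omega)) (fun q => q.2.2.2.1)
  refine ⟨Real.sqrt C, Real.sqrt_pos.2 hC, ?_⟩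
  intro φ a K hK hφ ha hdet _ _ _ haK h1 h2 h3 u
  have h := hE ⟨(φ, a), hφ, ha, ⟨K, hK, haK⟩, hdet, h1, h2, h3⟩ (fun y => u y) (nice_schwartz u)
  rw [← eLp_Wt, ← eLp_Wt] at h
  have hs : ENNReal.ofReal C = ENNReal.ofReal (Real.sqrt C) ^ 2 := by
    rw [← ENNReal.ofReal_pow (Real.sqrt_nonneg _), Real.sq_sqrt hC.le]
  rw [hs, ← mul_pow] at h
  exact (ENNReal.pow_right_strictMono (n := 2) (by norm_num)).le_iff_le.1 h
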